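/- Let f ∈ L log L(𝕋²). Then for every A > 0, for almost every (x,y) ∈ 𝕋², lim_{m→∞} (1/(m+1)) Σ_{n=0}^{m} ( exp(A·|S_{nn}(x,y,f) − f(x,y)|) − 1 ) = 0. -/

import Mathlib

open MeasureTheory Filter Set

noncomputable section

/-- `[-π, π)`, a fundamental domain for the circle `𝕋 = ℝ/2πℤ`. -/
def T1 : Set ℝ := Set.Ico (-Real.pi) Real.pi

/-- `[-π, π)²`, a fundamental domain for the torus `𝕋²`. -/
def T2 : Set (ℝ × ℝ) := T1 ×ˢ T1

/-- `log⁺ u = log u` for `u > 1`, and `0` otherwise. -/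
def logPlus (u : ℝ) : ℝ := if 1 < u then Real.log u else 0

/-- `f` is `2π`-periodic in each variable. -/
def Biperiodic (f : ℝ × ℝ → ℝ) : Prop :=
  ∀ x y : ℝ, f (x + 2 * Real.pi, y) = f (x, y) ∧ f (x, y + 2 * Real.pi) = f (x, y)

/-- Fourier coefficients `f̂(m,n)` of a function on `𝕋²`. -/
def fourierCoef2 (f : ℝ × ℝ → ℝ) (m n : ℤ) : ℂ :=
  (1 / (4 * (Real.pi : ℂ) ^ 2)) *
    ∫ p in T2, (f p : ℂ) * Complex.exp (-Complex.I * ((m : ℂ) * (p.1 : ℂ) + (n : ℂ) * (p.2 : ℂ)))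

/-- Quadratic partial sums `S_{nn}(x, y, f)` of the double Fourier series.
(For real `f` the symmetric sum is real, so we take the real part.) -/
def Snn (f : ℝ × ℝ → ℝ) (n : ℕ) (x y : ℝ) : ℝ :=
  (∑ m ∈ Finset.Icc (-(n : ℤ)) (n : ℤ), ∑ k ∈ Finset.Icc (-(n : ℤ)) (n : ℤ),
    fourierCoef2 f m k * Complex.exp (Complex.I * ((m : ℂ) * (x : ℂ) + (k : ℂ) * (y : ℂ)))).re

/-- The `BMO[0,1]` norm:
`‖g‖_BMO = sup_{I ⊂ [0,1]} (1/|I|) ∫_I |g - g_I| + |∫_0^1 g|`. -/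
def bmoNorm (g : ℝ → ℝ) : ℝ :=
  (⨆ I : {p : ℝ × ℝ // 0 ≤ p.1 ∧ p.1 < p.2 ∧ p.2 ≤ 1},
      (I.1.2 - I.1.1)⁻¹ *
        ∫ t in Set.Icc I.1.1 I.1.2,
          |g t - (I.1.2 - I.1.1)⁻¹ * ∫ s in Set.Icc I.1.1 I.1.2, g s|) +
    |∫ t in Set.Icc (0 : ℝ) 1, g t|

/-- The step function `Σ_{k=0}^n ξ_k 𝟙_{δ_k^n}` with `δ_k^n = [k/(n+1), (k+1)/(n+1)]`. -/
def stepFun (ξ : ℕ → ℝ) (n : ℕ) (t : ℝ) : ℝ :=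
  ∑ k ∈ Finset.range (n + 1),
    Set.indicator (Set.Icc ((k : ℝ) / ((n : ℝ) + 1)) (((k : ℝ) + 1) / ((n : ℝ) + 1)))
      (fun _ => ξ k) t

/-- `bmo[ξ_n] = sup_{n ≥ 0} ‖Σ_{k=0}^n ξ_k 𝟙_{δ_k^n}‖_BMO`. -/
def bmoSeq (ξ : ℕ → ℝ) : ℝ := ⨆ n : ℕ, bmoNorm (stepFun ξ n)

/-- `L` is the principal value `p.v. ∫_𝕋 g`, i.e. the limit as `ε → 0⁺` of the
integrals over `{ε < |t| < π}`. -/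
def pvT1 (g : ℝ → ℝ) (L : ℝ) : Prop :=
  Filter.Tendsto (fun ε : ℝ => ∫ t in {t : ℝ | ε < |t| ∧ |t| < Real.pi}, g t)
    (nhdsWithin 0 (Set.Ioi 0)) (nhds L)

/-- `L` is the two-dimensional principal value `p.v. ∬_{𝕋²} g`, the limit as `ε → 0⁺`
of the integrals over `{ε < |t| < π, ε < |s| < π}`. -/
def pvT2 (g : ℝ × ℝ → ℝ) (L : ℝ) : Prop :=
  Filter.Tendsto
    (fun ε : ℝ =>
      ∫ q in {q : ℝ × ℝ | (ε < |q.1| ∧ |q.1| < Real.pi) ∧ ε < |q.2| ∧ |q.2| < Real.pi}, g q)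
    (nhdsWithin 0 (Set.Ioi 0)) (nhds L)

/-- Luxemburg norm with respect to a Young function `M`. -/
def luxNorm {α : Type*} [MeasurableSpace α] (μ : Measure α) (M : ℝ → ℝ) (g : α → ℝ) : ℝ :=
  sInf {lam : ℝ | 0 < lam ∧ ∫⁻ x, ENNReal.ofReal (M (|g x| / lam)) ∂μ ≤ 1}

/-- The Young function `Φ(t) = t log⁺ t`. -/
def PhiY (t : ℝ) : ℝ := t * logPlus t

/-- The Young function `Ψ(t) = eᵗ - 1`. -/
def PsiY (t : ℝ) : ℝ := Real.exp t - 1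

namespace AES

/-! ### A dyadic John–Nirenberg inequality for sequences -/

/-- Sum of `φ` over the dyadic block `[j 2^k, (j+1) 2^k)`. -/
def blk (k j : ℕ) (φ : ℕ → ℝ) : ℝ := ∑ l ∈ Finset.range (2 ^ k), φ (j * 2 ^ k + l)

lemma blk_succ (k j : ℕ) (φ : ℕ → ℝ) :
    blk (k + 1) j φ = blk k (2 * j) φ + blk k (2 * j + 1) φ := by
  unfold blk
  have h2 : 2 ^ (k + 1) = 2 ^ k + 2 ^ k := by ring
  rw [h2, Finset.sum_range_add]
  congr 1
  · refine Finset.sum_congr rfl fun l _ => ?_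
    congr 1; ring
  · refine Finset.sum_congr rfl fun l _ => ?_
    congr 1; ring

lemma blk_mono {k j : ℕ} {φ ψ : ℕ → ℝ} (h : ∀ n, φ n ≤ ψ n) : blk k j φ ≤ blk k j ψ :=
  Finset.sum_le_sum fun _ _ => h _

lemma blk_nonneg {k j : ℕ} {φ : ℕ → ℝ} (h : ∀ n, 0 ≤ φ n) : 0 ≤ blk k j φ :=
  Finset.sum_nonneg fun _ _ => h _

lemma blk_const (k j : ℕ) (a : ℝ) : blk k j (fun _ => a) = a * 2 ^ k := by
  simp [blk, mul_comm]

lemma blk_add (k j : ℕ) (φ ψ : ℕ → ℝ) : blk k j (fun n => φ n + ψ n) = blk k j φ + blk k j ψ := by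
  simp [blk, Finset.sum_add_distrib]

lemma blk_mul (k j : ℕ) (a : ℝ) (φ : ℕ → ℝ) : blk k j (fun n => a * φ n) = a * blk k j φ := by
  simp [blk, Finset.mul_sum]

lemma blk_center (ξ : ℕ → ℂ) (k j : ℕ) (a b : ℂ) :
    ‖a - b‖ * 2 ^ k ≤ blk k j (fun n => ‖ξ n - a‖) + blk k j (fun n => ‖ξ n - b‖) := by
  rw [← blk_const k j, ← blk_add]
  refine blk_mono fun n => ?_
  have h : a - b = -(ξ n - a) + (ξ n - b) := by ring
  rw [h]
  exact (norm_add_le _ _).trans (by rw [norm_neg])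

lemma jn_inner (ξ : ℕ → ℂ) (c : ℕ → ℕ → ℂ) (B : ℝ) (hB : 0 < B) (K i : ℕ) (hi : i ≤ K)
    (h : ∀ k ≤ K, ∀ j, blk k j (fun n => ‖ξ n - c k j‖) ≤ B * 2 ^ k)
    (U : ∀ k < i, ∀ j, blk k j (fun n => Real.exp ((20 * B)⁻¹ * ‖ξ n - c k j‖)) ≤ 4 * 2 ^ k) :
    ∀ k ≤ i, ∀ j, ∀ a : ℂ, ‖c k j - a‖ ≤ 3 * B →
      blk k j (fun n => Real.exp ((20 * B)⁻¹ * ‖ξ n - a‖)) ≤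
        Real.exp (1 / 5) * 2 ^ k +
          (2 * Real.exp (3 / 10) / B) * blk k j (fun n => ‖ξ n - a‖) := by
  have hγ : (20 * B)⁻¹ * B = 1 / 20 := by field_simp
  have hγ0 : 0 ≤ (20 * B)⁻¹ := by positivity
  intro k
  induction k with
  | zero =>
    intro _ j a ha
    have h1 := h 0 (Nat.zero_le _) j
    simp only [blk, pow_zero, Finset.range_one, Finset.sum_singleton, mul_one, add_zero] at h1 ⊢
    have h2 : ‖ξ j - a‖ ≤ 4 * B := by
      have : ξ j - a = (ξ j - c 0 j) + (c 0 j - a) := by ring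
      rw [this]
      exact (norm_add_le _ _).trans (by linarith)
    have h3 : Real.exp ((20 * B)⁻¹ * ‖ξ j - a‖) ≤ Real.exp (1 / 5) := by
      apply Real.exp_le_exp.2
      calc (20 * B)⁻¹ * ‖ξ j - a‖ ≤ (20 * B)⁻¹ * (4 * B) := by gcongr
        _ = 4 * ((20 * B)⁻¹ * B) := by ring
        _ = 1 / 5 := by rw [hγ]; norm_num
    have h4 : 0 ≤ (2 * Real.exp (3 / 10) / B) * ‖ξ j - a‖ := by positivity
    linarith
  | succ k ih =>
    intro hk j a ha
    have key : ∀ j', (j' = 2 * j ∨ j' = 2 * j + 1) →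
        blk k j' (fun n => Real.exp ((20 * B)⁻¹ * ‖ξ n - a‖)) ≤
        Real.exp (1 / 5) * 2 ^ k +
          (2 * Real.exp (3 / 10) / B) * blk k j' (fun n => ‖ξ n - a‖) := by
      intro j' hj'
      by_cases hc : ‖c k j' - a‖ ≤ 3 * B
      · exact ih (by omega) j' a hc
      · push Not at hc
        have p2 : (0 : ℝ) < 2 ^ k := by positivity
        have e1 := h k (by omega) j'
        have e2 := h (k + 1) (by omega) j
        have e3 : blk k j' (fun n => ‖ξ n - c (k + 1) j‖) ≤
            blk (k + 1) j (fun n => ‖ξ n - c (k + 1) j‖) := by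
          rw [blk_succ]
          have n1 : 0 ≤ blk k (2 * j) (fun n => ‖ξ n - c (k + 1) j‖) :=
            blk_nonneg fun n => norm_nonneg _
          have n2 : 0 ≤ blk k (2 * j + 1) (fun n => ‖ξ n - c (k + 1) j‖) :=
            blk_nonneg fun n => norm_nonneg _
          rcases hj' with rfl | rfl <;> linarith
        have e4 := blk_center ξ k j' (c k j') (c (k + 1) j)
        have e5 : ‖c k j' - c (k + 1) j‖ ≤ 3 * B := by
          have : ‖c k j' - c (k + 1) j‖ * 2 ^ k ≤ 3 * B * 2 ^ k := by
            rw [pow_succ] at e2; linarith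
          exact le_of_mul_le_mul_right this p2
        have e6 : ‖c k j' - a‖ ≤ 6 * B := by
          have : c k j' - a = (c k j' - c (k + 1) j) + (c (k + 1) j - a) := by ring
          rw [this]
          exact (norm_add_le _ _).trans (by linarith)
        have e7 := blk_center ξ k j' (c k j') a
        have e8 : 2 * B * 2 ^ k ≤ blk k j' (fun n => ‖ξ n - a‖) := by
          have : 3 * B * 2 ^ k ≤ ‖c k j' - a‖ * 2 ^ k := by gcongr
          linarith
        have e9 : blk k j' (fun n => Real.exp ((20 * B)⁻¹ * ‖ξ n - a‖)) ≤
            Real.exp (3 / 10) * (4 * 2 ^ k) := by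
          refine le_trans ?_ (mul_le_mul_of_nonneg_left (U k (by omega) j') (Real.exp_pos _).le)
          rw [← blk_mul]
          refine blk_mono fun n => ?_
          rw [← Real.exp_add]
          apply Real.exp_le_exp.2
          have : ‖ξ n - a‖ ≤ 6 * B + ‖ξ n - c k j'‖ := by
            have : ξ n - a = (c k j' - a) + (ξ n - c k j') := by ring
            rw [this]
            exact (norm_add_le _ _).trans (by linarith)
          calc (20 * B)⁻¹ * ‖ξ n - a‖ ≤ (20 * B)⁻¹ * (6 * B + ‖ξ n - c k j'‖) := by gcongr
            _ = 6 * ((20 * B)⁻¹ * B) + (20 * B)⁻¹ * ‖ξ n - c k j'‖ := by ring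
            _ = _ := by rw [hγ]; norm_num
        have e10 : Real.exp (3 / 10) * (4 * 2 ^ k) =
            (2 * Real.exp (3 / 10) / B) * (2 * B * 2 ^ k) := by field_simp; ring
        have e11 : (2 * Real.exp (3 / 10) / B) * (2 * B * 2 ^ k) ≤
            (2 * Real.exp (3 / 10) / B) * blk k j' (fun n => ‖ξ n - a‖) := by gcongr
        have e12 : 0 ≤ Real.exp (1 / 5) * 2 ^ k := by positivity
        linarith
    rw [blk_succ, blk_succ, pow_succ]
    have k1 := key (2 * j) (Or.inl rfl)
    have k2 := key (2 * j + 1) (Or.inr rfl)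
    linarith

/-- Dyadic John–Nirenberg inequality. -/
lemma jn (ξ : ℕ → ℂ) (c : ℕ → ℕ → ℂ) (B : ℝ) (hB : 0 < B) (K : ℕ)
    (h : ∀ k ≤ K, ∀ j, blk k j (fun n => ‖ξ n - c k j‖) ≤ B * 2 ^ k) :
    ∀ i, i ≤ K → ∀ j, blk i j (fun n => Real.exp ((20 * B)⁻¹ * ‖ξ n - c i j‖)) ≤ 4 * 2 ^ i := by
  intro i
  induction i using Nat.strong_induction_on with
  | _ i IH =>
    intro hi j
    have h1 := jn_inner ξ c B hB K i hi h (fun k hk j => IH k hk (by omega) j) i le_rfl j (c i j)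
      (by simp; positivity)
    have h2 := h i hi j
    have h3 : (2 * Real.exp (3 / 10) / B) * blk i j (fun n => ‖ξ n - c i j‖) ≤
        (2 * Real.exp (3 / 10) / B) * (B * 2 ^ i) := by gcongr
    have h4 : (2 * Real.exp (3 / 10) / B) * (B * 2 ^ i) = 2 * Real.exp (3 / 10) * 2 ^ i := by
      field_simp
    have h5 : Real.exp (1 / 5) + 2 * Real.exp (3 / 10) ≤ 4 := by
      have a1 : Real.exp (1 / 5) ≤ 5 / 4 := by
        rw [show (1 : ℝ) / 5 = -(-(1 / 5)) by ring, Real.exp_neg]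
        have := Real.add_one_le_exp (-(1 / 5) : ℝ)
        rw [inv_le_comm₀ (Real.exp_pos _) (by norm_num)]
        norm_num at this ⊢; linarith
      have a2 : Real.exp (3 / 10) ≤ 1.3545 := by
        have := Real.exp_bound' (x := 3 / 10) (by norm_num) (by norm_num) (n := 4) (by norm_num)
        simp [Finset.sum_range_succ, Nat.factorial] at this
        norm_num at this ⊢; linarith
      norm_num at a1 a2 ⊢; linarith
    have p2 : (0 : ℝ) < 2 ^ i := by positivity
    nlinarith

end AES

namespace AES

/-! ### Averages over a period and basic kernels -/

/-- `e^{iu}`. -/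
def ee (u : ℝ) : ℂ := Complex.exp (u * Complex.I)

lemma ee_add (u v : ℝ) : ee (u + v) = ee u * ee v := by
  unfold ee; rw [← Complex.exp_add]; congr 1; push_cast; ring

lemma ee_zero : ee 0 = 1 := by simp [ee]

lemma norm_ee (u : ℝ) : ‖ee u‖ = 1 := by
  unfold ee; exact Complex.norm_exp_ofReal_mul_I u

lemma ee_ne (u : ℝ) : ee u ≠ 0 := by
  unfold ee; exact Complex.exp_ne_zero _

lemma ee_conj (u : ℝ) : (starRingEnd ℂ) (ee u) = ee (-u) := by
  unfold ee
  rw [← Complex.exp_conj]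
  congr 1
  simp

lemma ee_neg (u : ℝ) : ee (-u) = (ee u)⁻¹ := by
  unfold ee; rw [← Complex.exp_neg]; congr 1; push_cast; ring

lemma ee_sub (u v : ℝ) : ee (u - v) = ee u * (starRingEnd ℂ) (ee v) := by
  rw [sub_eq_add_neg, ee_add, ee_conj]

lemma ee_pow (u : ℝ) (n : ℕ) : ee u ^ n = ee (n * u) := by
  unfold ee; rw [← Complex.exp_nat_mul]; congr 1; push_cast; ring

@[fun_prop]
lemma ee_cont : Continuous ee := by
  unfold ee; fun_prop

lemma ee_per : Function.Periodic ee (2 * Real.pi) := by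
  intro u
  rw [ee_add]
  have : ee (2 * Real.pi) = 1 := by
    unfold ee; push_cast; exact Complex.exp_two_pi_mul_I
  rw [this, mul_one]

/-- Average over one period. -/
def av {E : Type*} [NormedAddCommGroup E] [NormedSpace ℝ E] (φ : ℝ → E) : E :=
  (2 * Real.pi)⁻¹ • ∫ t in (-Real.pi)..Real.pi, φ t

section
variable {E : Type*} [NormedAddCommGroup E] [NormedSpace ℝ E]

lemma c_nonneg : (0:ℝ) ≤ (2 * Real.pi)⁻¹ := by positivity

lemma pi_le : -Real.pi ≤ Real.pi := by linarith [Real.pi_pos]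

lemma av_add {φ ψ : ℝ → E} (h1 : Continuous φ) (h2 : Continuous ψ) :
    av (fun t => φ t + ψ t) = av φ + av ψ := by
  unfold av
  rw [intervalIntegral.integral_add (h1.intervalIntegrable _ _) (h2.intervalIntegrable _ _), smul_add]

lemma av_sub {φ ψ : ℝ → E} (h1 : Continuous φ) (h2 : Continuous ψ) :
    av (fun t => φ t - ψ t) = av φ - av ψ := by
  unfold av
  rw [intervalIntegral.integral_sub (h1.intervalIntegrable _ _) (h2.intervalIntegrable _ _), smul_sub]

lemma av_sum {ι : Type*} (s : Finset ι) {φ : ι → ℝ → E} (h : ∀ i ∈ s, Continuous (φ i)) :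
    av (fun t => ∑ i ∈ s, φ i t) = ∑ i ∈ s, av (φ i) := by
  unfold av
  rw [intervalIntegral.integral_finsetSum (fun i hi => (h i hi).intervalIntegrable _ _),
    Finset.smul_sum]

lemma norm_av_le (φ : ℝ → E) : ‖av φ‖ ≤ av (fun t => ‖φ t‖) := by
  unfold av
  rw [norm_smul, Real.norm_of_nonneg c_nonneg, smul_eq_mul]
  exact mul_le_mul_of_nonneg_left (intervalIntegral.norm_integral_le_integral_norm pi_le) c_nonneg

lemma av_shift {φ : ℝ → E} (h : Function.Periodic φ (2 * Real.pi)) (a : ℝ) :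
    av (fun t => φ (t + a)) = av φ := by
  unfold av
  rw [intervalIntegral.integral_comp_add_right]
  have := h.intervalIntegral_add_eq (-Real.pi + a) (-Real.pi)
  have e1 : -Real.pi + a + 2 * Real.pi = Real.pi + a := by ring
  have e2 : -Real.pi + 2 * Real.pi = Real.pi := by ring
  rw [e1, e2] at this
  rw [this]

lemma av_reflect (φ : ℝ → E) : av (fun t => φ (-t)) = av φ := by
  unfold av
  rw [intervalIntegral.integral_comp_neg]; simp

lemma av_sub_left {φ : ℝ → E} (h : Function.Periodic φ (2 * Real.pi)) (a : ℝ) :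
    av (fun t => φ (a - t)) = av φ := by
  rw [← av_reflect φ]
  have h2 : Function.Periodic (fun t => φ (-t)) (2 * Real.pi) := by
    intro t
    have := h (-(t + 2 * Real.pi))
    simp only at this ⊢
    rw [← this]; congr 1; ring
  rw [← av_shift h2 (-a)]
  congr 1; ext t; congr 1; ring

lemma av_congr {φ ψ : ℝ → E} (h : ∀ t, φ t = ψ t) : av φ = av ψ := by
  rw [show φ = ψ from funext h]

lemma av_cont {X : Type*} [TopologicalSpace X] [FirstCountableTopology X] {F : X → ℝ → E} (h : Continuous (Function.uncurry F)) :
    Continuous (fun x => av (F x)) := by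
  unfold av
  exact (intervalIntegral.continuous_parametric_intervalIntegral_of_continuous' h _ _).const_smul _

lemma av_swap {F : ℝ → ℝ → E} (h : Continuous (Function.uncurry F)) :
    av (fun x => av (fun y => F x y)) = av (fun y => av (fun x => F x y)) := by
  unfold av
  rw [intervalIntegral.integral_smul, intervalIntegral.integral_smul]
  congr 2
  apply MeasureTheory.intervalIntegral_intervalIntegral_swap
  rw [Set.uIoc_of_le pi_le]
  have hK : IsCompact (Set.Icc (-Real.pi) Real.pi ×ˢ Set.Icc (-Real.pi) Real.pi) :=
    isCompact_Icc.prod isCompact_Icc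
  exact (h.continuousOn.integrableOn_compact hK).mono_set
    (Set.prod_mono Set.Ioc_subset_Icc_self Set.Ioc_subset_Icc_self)

end

lemma av_const {E : Type*} [NormedAddCommGroup E] [NormedSpace ℝ E] [CompleteSpace E] (c : E) : av (fun _ => c) = c := by
  unfold av
  rw [intervalIntegral.integral_const, smul_smul]
  have : (2 * Real.pi)⁻¹ * (Real.pi - -Real.pi) = 1 := by
    have := Real.pi_pos; field_simp; norm_num
  rw [this, one_smul]

lemma av_mono {φ ψ : ℝ → ℝ} (h1 : Continuous φ) (h2 : Continuous ψ) (h : ∀ t, φ t ≤ ψ t) :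
    av φ ≤ av ψ := by
  unfold av
  rw [smul_eq_mul, smul_eq_mul]
  exact mul_le_mul_of_nonneg_left (intervalIntegral.integral_mono_on pi_le
    (h1.intervalIntegrable _ _) (h2.intervalIntegrable _ _) (fun t _ => h t)) c_nonneg

lemma av_nonneg {φ : ℝ → ℝ} (h : ∀ t, 0 ≤ φ t) : 0 ≤ av φ := by
  unfold av
  exact mul_nonneg c_nonneg (intervalIntegral.integral_nonneg pi_le (fun t _ => h t))

lemma av_cmul {𝕜 : Type*} [RCLike 𝕜] (c : 𝕜) (φ : ℝ → 𝕜) : av (fun t => c * φ t) = c * av φ := by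
  unfold av
  rw [intervalIntegral.integral_const_mul, mul_smul_comm]

lemma av_mulc {𝕜 : Type*} [RCLike 𝕜] (c : 𝕜) (φ : ℝ → 𝕜) : av (fun t => φ t * c) = av φ * c := by
  rw [mul_comm, ← av_cmul]; simp only [mul_comm]

lemma av_ofReal (φ : ℝ → ℝ) : av (fun t => (φ t : ℂ)) = ((av φ : ℝ) : ℂ) := by
  unfold av
  rw [intervalIntegral.integral_ofReal]; simp

lemma av_conj (φ : ℝ → ℂ) : av (fun t => (starRingEnd ℂ) (φ t)) = (starRingEnd ℂ) (av φ) := by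
  unfold av
  rw [intervalIntegral.integral_of_le pi_le, intervalIntegral.integral_of_le pi_le]
  rw [integral_conj, Complex.real_smul, Complex.real_smul, map_mul, Complex.conj_ofReal]

/-- `∑_{m=1}^n e^{imu}`. -/
def Ker (n : ℕ) (u : ℝ) : ℂ := ∑ m ∈ Finset.range n, ee u ^ (m + 1)

/-- The Poisson kernel. -/
def pk (r u : ℝ) : ℝ := (1 - r ^ 2) / ‖1 - r * ee u‖ ^ 2

/-- One-sided conjugate kernel. -/
def hk (r u : ℝ) : ℂ := r * ee u / (1 - r * ee u)

def Q (n : ℕ) (g : ℝ → ℂ) (x : ℝ) : ℂ := av (fun u => g (x - u) * Ker n u)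

def PI (r : ℝ) (φ : ℝ → ℝ) (x : ℝ) : ℝ := av (fun u => φ (x - u) * pk r u)

lemma den_ne {r : ℝ} (h0 : 0 ≤ r) (h1 : r < 1) (u : ℝ) : (1 : ℂ) - r * ee u ≠ 0 := by
  intro h
  have h2 : (r : ℂ) * ee u = 1 := by linear_combination -h
  have h3 := congrArg norm h2
  rw [norm_mul, norm_ee, Complex.norm_real, Real.norm_of_nonneg h0] at h3
  simp at h3; linarith

lemma den_pos {r : ℝ} (h0 : 0 ≤ r) (h1 : r < 1) (u : ℝ) : 0 < ‖(1 : ℂ) - r * ee u‖ :=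
  norm_pos_iff.2 (den_ne h0 h1 u)

lemma den_le {r : ℝ} (h0 : 0 ≤ r) (h1 : r < 1) (u : ℝ) : ‖(1 : ℂ) - r * ee u‖ ≤ 2 := by
  calc _ ≤ ‖(1:ℂ)‖ + ‖(r:ℂ) * ee u‖ := norm_sub_le _ _
    _ ≤ 2 := by rw [norm_mul, norm_ee, Complex.norm_real, Real.norm_of_nonneg h0]; simp; linarith

lemma pk_cont {r : ℝ} (h0 : 0 ≤ r) (h1 : r < 1) : Continuous (pk r) := by
  unfold pk
  refine Continuous.div continuous_const (by fun_prop) (fun u => ?_)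
  exact pow_ne_zero _ (den_pos h0 h1 u).ne'

lemma pk_pos {r : ℝ} (h0 : 0 ≤ r) (h1 : r < 1) (u : ℝ) : 0 < pk r u := by
  unfold pk
  have := den_pos h0 h1 u
  have : 0 < 1 - r ^ 2 := by nlinarith
  positivity

lemma pk_per (r : ℝ) : Function.Periodic (pk r) (2 * Real.pi) := by
  intro u; unfold pk; rw [ee_per]

lemma pk_neg (r u : ℝ) : pk r (-u) = pk r u := by
  unfold pk
  rw [← ee_conj]
  have : (1 : ℂ) - r * (starRingEnd ℂ) (ee u) = (starRingEnd ℂ) (1 - r * ee u) := by simp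
  rw [this, RCLike.norm_conj]

lemma hk_cont {r : ℝ} (h0 : 0 ≤ r) (h1 : r < 1) : Continuous (hk r) := by
  unfold hk
  exact Continuous.div (by fun_prop) (by fun_prop) (fun u => den_ne h0 h1 u)

@[fun_prop]
lemma Ker_cont (n : ℕ) : Continuous (Ker n) := by
  unfold Ker; fun_prop

lemma inv_sq_le {r : ℝ} (h0 : 0 ≤ r) (h1 : r < 1) (u : ℝ) :
    (1 - r) * (‖(1 : ℂ) - r * ee u‖⁻¹) ^ 2 ≤ pk r u := by
  unfold pk
  rw [inv_pow, ← div_eq_mul_inv]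
  have := den_pos h0 h1 u
  gcongr
  nlinarith

/-- B1 -/
lemma geom_bd {r : ℝ} (h0 : 0 ≤ r) (h1 : r < 1) {L n : ℕ} (hL : (1 - r) * L = 1) (hn : n ≤ 2 * L) (u : ℝ) :
    ‖∑ j ∈ Finset.range n, ee u ^ j‖ ≤ 4 * ‖(1 : ℂ) - r * ee u‖⁻¹ := by
  set S := ∑ j ∈ Finset.range n, ee u ^ j with hS
  have hd := den_pos h0 h1 u
  have e1 : (1 - (r:ℂ) * ee u) * S = (1 - ee u ^ n) + ((1 - r : ℝ) : ℂ) * (ee u * S) := by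
    have := geom_sum_mul (ee u) n
    rw [← hS] at this
    push_cast
    linear_combination -this
  have hSn : ‖S‖ ≤ n := by
    calc ‖S‖ ≤ ∑ j ∈ Finset.range n, ‖ee u ^ j‖ := norm_sum_le _ _
      _ = n := by simp [norm_ee]
  have e2 : ‖(1 : ℂ) - r * ee u‖ * ‖S‖ ≤ 4 := by
    rw [← norm_mul, e1]
    calc _ ≤ ‖1 - ee u ^ n‖ + ‖((1 - r : ℝ) : ℂ) * (ee u * S)‖ := norm_add_le _ _
      _ ≤ (‖(1:ℂ)‖ + ‖ee u ^ n‖) + (1 - r) * ‖S‖ := by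
          gcongr
          · exact norm_sub_le _ _
          · rw [norm_mul, norm_mul, norm_ee, one_mul, Complex.norm_real, Real.norm_of_nonneg (by linarith)]
      _ ≤ 4 := by
          rw [norm_pow, norm_ee]
          have : (1 - r) * ‖S‖ ≤ (1 - r) * (2 * L) := by
            apply mul_le_mul_of_nonneg_left _ (by linarith)
            calc ‖S‖ ≤ n := hSn
              _ ≤ 2 * L := by exact_mod_cast hn
          simp; linarith
  rw [← div_eq_mul_inv, le_div_iff₀ hd]; linarith

end AES

namespace AES

/-! ### Oscillation estimate for partial sums -/

lemma av_mul_av {φ ψ : ℝ → ℂ} : av φ * av ψ = av (fun u => av (fun u' => φ u * ψ u')) := by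
  rw [← av_mulc]
  apply av_congr; intro u
  rw [av_cmul]

lemma gram {G : ℝ → ℂ} (hG : Continuous G) (n : ℕ) :
    ∑ j ∈ Finset.range n, ∑ k ∈ Finset.range n,
      ‖av (fun u => G u * (ee u ^ j * (starRingEnd ℂ) (ee u) ^ k))‖ ^ 2 ≤
    av (fun u => av (fun u' => ‖G u‖ * ‖G u'‖ * ‖∑ j ∈ Finset.range n, ee (u - u') ^ j‖ ^ 2)) := by
  set φ : ℕ → ℕ → ℝ → ℂ := fun j k u => G u * (ee u ^ j * (starRingEnd ℂ) (ee u) ^ k) with hφ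
  have hcc : Continuous fun u => (starRingEnd ℂ) (ee u) := Complex.continuous_conj.comp ee_cont
  have hφc : ∀ j k, Continuous (φ j k) := by
    intro j k
    exact hG.mul ((ee_cont.pow j).mul (hcc.pow k))
  have key : ((∑ j ∈ Finset.range n, ∑ k ∈ Finset.range n, ‖av (φ j k)‖ ^ 2 : ℝ) : ℂ) =
      av (fun u => av (fun u' => G u * (starRingEnd ℂ) (G u') * ((‖∑ j ∈ Finset.range n, ee (u - u') ^ j‖ ^ 2 : ℝ) : ℂ))) := by
    have h2c : ∀ j k, Continuous (fun p : ℝ × ℝ => φ j k p.1 * (starRingEnd ℂ) (φ j k p.2)) := by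
      intro j k
      exact ((hφc j k).comp continuous_fst).mul (Complex.continuous_conj.comp ((hφc j k).comp continuous_snd))
    push_cast
    have : ∀ j k, (‖av (φ j k)‖ : ℂ) ^ 2 = av (fun u => av (fun u' => φ j k u * (starRingEnd ℂ) (φ j k u'))) := by
      intro j k
      rw [← Complex.mul_conj', ← av_conj, av_mul_av]
    simp only [this]
    have h3c : ∀ j k, Continuous (fun u => av (fun u' => φ j k u * (starRingEnd ℂ) (φ j k u'))) :=
      fun j k => av_cont (F := fun u u' => φ j k u * (starRingEnd ℂ) (φ j k u')) (h2c j k)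
    have h4c : ∀ j k u, Continuous (fun u' => φ j k u * (starRingEnd ℂ) (φ j k u')) := fun j k u =>
      continuous_const.mul (Complex.continuous_conj.comp (hφc j k))
    symm
    calc _ = av (fun u => av (fun u' => ∑ j ∈ Finset.range n, ∑ k ∈ Finset.range n, φ j k u * (starRingEnd ℂ) (φ j k u'))) := by
          apply av_congr; intro u; apply av_congr; intro u'
          have e1 : ((‖∑ j ∈ Finset.range n, ee (u - u') ^ j‖ : ℂ) ^ 2) =
            ∑ j ∈ Finset.range n, ∑ k ∈ Finset.range n, ee (u - u') ^ j * (starRingEnd ℂ) (ee (u - u') ^ k) := by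
            rw [← Complex.mul_conj', map_sum, Finset.sum_mul_sum]
          rw [e1, Finset.mul_sum]
          apply Finset.sum_congr rfl; intro j _
          rw [Finset.mul_sum]
          apply Finset.sum_congr rfl; intro k _
          simp only [hφ, ee_sub, map_mul, map_pow, Complex.conj_conj, mul_pow]
          ring
      _ = av (fun u => ∑ j ∈ Finset.range n, ∑ k ∈ Finset.range n, av (fun u' => φ j k u * (starRingEnd ℂ) (φ j k u'))) := by
          apply av_congr; intro u
          rw [av_sum _ (fun j _ => continuous_finsetSum _ (fun k _ => h4c j k u))]
          apply Finset.sum_congr rfl; intro j _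
          rw [av_sum _ (fun k _ => h4c j k u)]
      _ = _ := by
          rw [av_sum _ (fun j _ => continuous_finsetSum _ (fun k _ => h3c j k))]
          apply Finset.sum_congr rfl; intro j _
          rw [av_sum _ (fun k _ => h3c j k)]
  have hn : 0 ≤ ∑ j ∈ Finset.range n, ∑ k ∈ Finset.range n, ‖av (φ j k)‖ ^ 2 := by positivity
  rw [← Real.norm_of_nonneg hn, ← Complex.norm_real, key]
  have hc5 : Continuous (fun p : ℝ × ℝ => G p.1 * (starRingEnd ℂ) (G p.2) * ((‖∑ j ∈ Finset.range n, ee (p.1 - p.2) ^ j‖ ^ 2 : ℝ) : ℂ)) := by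
    refine Continuous.mul ((hG.comp continuous_fst).mul (Complex.continuous_conj.comp (hG.comp continuous_snd))) ?_
    fun_prop
  have hc6 : Continuous (fun p : ℝ × ℝ => ‖G p.1‖ * ‖G p.2‖ * ‖∑ j ∈ Finset.range n, ee (p.1 - p.2) ^ j‖ ^ 2) := by
    fun_prop
  refine (norm_av_le _).trans ?_
  refine av_mono (continuous_norm.comp (av_cont (F := fun u u' => G u * (starRingEnd ℂ) (G u') * ((‖∑ j ∈ Finset.range n, ee (u - u') ^ j‖ ^ 2 : ℝ) : ℂ)) hc5)) (av_cont (F := fun u u' => ‖G u‖ * ‖G u'‖ * ‖∑ j ∈ Finset.range n, ee (u - u') ^ j‖ ^ 2) hc6) ?_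
  intro u
  refine (norm_av_le _).trans (le_of_eq ?_)
  apply av_congr; intro u'
  rw [norm_mul, norm_mul, RCLike.norm_conj, Complex.norm_real, Real.norm_of_nonneg (by positivity)]

lemma gram_lower {G : ℝ → ℂ} (L : ℕ) :
    L * ∑ l ∈ Finset.range L, ‖av (fun u => G u * ee u ^ l)‖ ^ 2 ≤
    ∑ j ∈ Finset.range (2 * L), ∑ k ∈ Finset.range (2 * L),
      ‖av (fun u => G u * (ee u ^ j * (starRingEnd ℂ) (ee u) ^ k))‖ ^ 2 := by
  rw [Finset.sum_comm]
  have h1 : ∀ k ∈ Finset.range L, ∑ l ∈ Finset.range L, ‖av (fun u => G u * ee u ^ l)‖ ^ 2 ≤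
      ∑ j ∈ Finset.range (2 * L), ‖av (fun u => G u * (ee u ^ j * (starRingEnd ℂ) (ee u) ^ k))‖ ^ 2 := by
    intro k hk
    rw [Finset.mem_range] at hk
    have e : ∀ l, ‖av (fun u => G u * ee u ^ l)‖ ^ 2 = ‖av (fun u => G u * (ee u ^ (k + l) * (starRingEnd ℂ) (ee u) ^ k))‖ ^ 2 := by
      intro l
      congr 2
      apply av_congr; intro u
      have : ee u * (starRingEnd ℂ) (ee u) = 1 := by
        rw [Complex.mul_conj', norm_ee]; simp
      have h3 : ee u ^ (k + l) * (starRingEnd ℂ) (ee u) ^ k = ee u ^ l := by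
        rw [pow_add, mul_right_comm, ← mul_pow, this]; simp
      rw [h3]
    simp only [e]
    rw [← Finset.sum_image (s := Finset.range L) (g := fun l => k + l) (f := fun j => ‖av (fun u => G u * (ee u ^ j * (starRingEnd ℂ) (ee u) ^ k))‖ ^ 2) (by intro a _ b _ h; simpa using h)]
    apply Finset.sum_le_sum_of_subset_of_nonneg
    · intro j hj
      simp only [Finset.mem_image, Finset.mem_range] at hj ⊢
      obtain ⟨a, ha, rfl⟩ := hj
      omega
    · intros; positivity
  calc _ = ∑ k ∈ Finset.range L, ∑ l ∈ Finset.range L, ‖av (fun u => G u * ee u ^ l)‖ ^ 2 := by simp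
    _ ≤ ∑ k ∈ Finset.range L, ∑ j ∈ Finset.range (2 * L), ‖av (fun u => G u * (ee u ^ j * (starRingEnd ℂ) (ee u) ^ k))‖ ^ 2 := Finset.sum_le_sum h1
    _ ≤ _ := by
      apply Finset.sum_le_sum_of_subset_of_nonneg
      · intro j hj
        simp only [Finset.mem_range] at hj ⊢; omega
      · intros; positivity

/-- the bilinear quantity -/
def WW (r : ℝ) (a : ℝ → ℝ) : ℝ := av (fun u => a u * pk r u * av (fun u' => a u' * pk r (u - u')))

lemma main_term {g : ℝ → ℂ} (hg : Continuous g) {r : ℝ} (h0 : 0 ≤ r) (h1 : r < 1) {L : ℕ} (hL : (1 - r) * L = 1)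
    (N : ℕ) :
    ∑ l ∈ Finset.range L, ‖av (fun u => g u * (ee u ^ (N + 1) / (1 - r * ee u)) * ee u ^ l)‖ ^ 2 ≤ 16 * L * WW r (fun u => ‖g u‖) := by
  set G : ℝ → ℂ := fun u => g u * (ee u ^ (N + 1) / (1 - r * ee u)) with hGd
  have hLp : (0:ℝ) < L := by
    rcases Nat.eq_zero_or_pos L with h | h
    · rw [h] at hL; simp at hL
    · exact_mod_cast h
  have hG : Continuous G := hg.mul (Continuous.div (by fun_prop) (by fun_prop) (fun u => den_ne h0 h1 u))
  have hGn : ∀ u, ‖G u‖ = ‖g u‖ * ‖(1:ℂ) - r * ee u‖⁻¹ := by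
    intro u
    simp only [hGd]
    rw [norm_mul, norm_div, norm_pow, norm_ee]; simp
  have hpc := pk_cont h0 h1
  have h3 := (gram_lower (G := G) L).trans (gram hG (2 * L))
  have hinv : ∀ u, (‖(1 : ℂ) - r * ee u‖⁻¹) ^ 2 ≤ L * pk r u := by
    intro u
    have := inv_sq_le h0 h1 u
    calc (‖(1 : ℂ) - r * ee u‖⁻¹) ^ 2 = L * ((1 - r) * (‖(1 : ℂ) - r * ee u‖⁻¹) ^ 2) := by linear_combination - hL * (‖(1 : ℂ) - r * ee u‖⁻¹) ^ 2
      _ ≤ _ := by gcongr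
  have hc1 : Continuous (fun p : ℝ × ℝ => ‖G p.1‖ * ‖G p.2‖ * ‖∑ j ∈ Finset.range (2 * L), ee (p.1 - p.2) ^ j‖ ^ 2) := by
    fun_prop
  have hcA : Continuous (fun p : ℝ × ℝ => ‖g p.1‖ * pk r p.1 * (‖g p.2‖ * pk r (p.1 - p.2))) := by
    fun_prop
  have hcB : Continuous (fun p : ℝ × ℝ => ‖g p.2‖ * pk r p.2 * (‖g p.1‖ * pk r (p.2 - p.1))) := by
    fun_prop
  have h4 : av (fun u => av (fun u' => ‖G u‖ * ‖G u'‖ * ‖∑ j ∈ Finset.range (2 * L), ee (u - u') ^ j‖ ^ 2)) ≤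
      av (fun u => av (fun u' => 8 * L ^ 2 * (‖g u‖ * pk r u * (‖g u'‖ * pk r (u - u')) + ‖g u'‖ * pk r u' * (‖g u‖ * pk r (u' - u))))) := by
    refine av_mono (av_cont (F := fun u u' => _) hc1) (av_cont (F := fun u u' => 8 * (L:ℝ) ^ 2 * (‖g u‖ * pk r u * (‖g u'‖ * pk r (u - u')) + ‖g u'‖ * pk r u' * (‖g u‖ * pk r (u' - u)))) (continuous_const.mul (hcA.add hcB))) ?_
    intro u
    refine av_mono (hc1.comp (Continuous.prodMk_right u)) ((continuous_const.mul (hcA.add hcB)).comp (Continuous.prodMk_right u)) ?_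
    intro u'
    rw [hGn, hGn]
    have e : pk r (u' - u) = pk r (u - u') := by rw [← pk_neg]; congr 1; ring
    rw [e]
    have hb := geom_bd h0 h1 hL le_rfl (u - u')
    have hs : ‖∑ j ∈ Finset.range (2 * L), ee (u - u') ^ j‖ ^ 2 ≤ 16 * (L * pk r (u - u')) := by
      calc _ ≤ (4 * ‖(1 : ℂ) - r * ee (u - u')‖⁻¹) ^ 2 := by gcongr
        _ = 16 * (‖(1 : ℂ) - r * ee (u - u')‖⁻¹) ^ 2 := by ring
        _ ≤ _ := by gcongr; exact hinv _
    have ha : ‖(1:ℂ) - r * ee u‖⁻¹ * ‖(1:ℂ) - r * ee u'‖⁻¹ ≤ (L * pk r u + L * pk r u') / 2 := by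
      have := hinv u
      have := hinv u'
      nlinarith [sq_nonneg (‖(1:ℂ) - r * ee u‖⁻¹ - ‖(1:ℂ) - r * ee u'‖⁻¹)]
    have hp0 := (pk_pos h0 h1 u).le
    have hp1 := (pk_pos h0 h1 u').le
    calc _ = (‖g u‖ * ‖g u'‖) * ((‖(1:ℂ) - r * ee u‖⁻¹ * ‖(1:ℂ) - r * ee u'‖⁻¹) * ‖∑ j ∈ Finset.range (2 * L), ee (u - u') ^ j‖ ^ 2) := by ring
      _ ≤ (‖g u‖ * ‖g u'‖) * (((L * pk r u + L * pk r u') / 2) * (16 * (L * pk r (u - u')))) := by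
          gcongr
      _ = _ := by ring
  have h5 : av (fun u => av (fun u' => 8 * L ^ 2 * (‖g u‖ * pk r u * (‖g u'‖ * pk r (u - u')) + ‖g u'‖ * pk r u' * (‖g u‖ * pk r (u' - u))))) = 16 * L ^ 2 * WW r (fun u => ‖g u‖) := by
    have hA' := fun u : ℝ => hcA.comp (Continuous.prodMk_right u)
    have hB' := fun u : ℝ => hcB.comp (Continuous.prodMk_right u)
    have hAc := av_cont (F := fun u u' => ‖g u‖ * pk r u * (‖g u'‖ * pk r (u - u'))) hcA
    have hBc := av_cont (F := fun u u' => ‖g u'‖ * pk r u' * (‖g u‖ * pk r (u' - u))) hcB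
    have e1 : av (fun u => av (fun u' => 8 * (L:ℝ) ^ 2 * (‖g u‖ * pk r u * (‖g u'‖ * pk r (u - u')) + ‖g u'‖ * pk r u' * (‖g u‖ * pk r (u' - u))))) =
      av (fun u => 8 * (L:ℝ) ^ 2 * (av (fun u' => ‖g u‖ * pk r u * (‖g u'‖ * pk r (u - u'))) + av (fun u' => ‖g u'‖ * pk r u' * (‖g u‖ * pk r (u' - u))))) := by
      apply av_congr; intro u
      rw [av_cmul]
      congr 1
      exact av_add (hA' u) (hB' u)
    rw [e1, av_cmul, av_add hAc hBc, av_swap (F := fun u u' => ‖g u'‖ * pk r u' * (‖g u‖ * pk r (u' - u))) hcB]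
    have e2 : av (fun u => av (fun u' => ‖g u‖ * pk r u * (‖g u'‖ * pk r (u - u')))) = WW r (fun u => ‖g u‖) := by
      unfold WW
      apply av_congr; intro u
      rw [av_cmul]
    rw [e2]; ring
  have h6 := h3.trans (h4.trans h5.le)
  have : (L:ℝ) * ∑ l ∈ Finset.range L, ‖av (fun u => G u * ee u ^ l)‖ ^ 2 ≤ L * (16 * L * WW r (fun u => ‖g u‖)) := by
    linarith
  exact le_of_mul_le_mul_left this hLp

/-- B2 (square form), translated to the origin. -/
lemma osc0 {g : ℝ → ℂ} (hg : Continuous g) {r : ℝ} (h0 : 0 ≤ r) (h1 : r < 1) {L : ℕ} (hL : (1 - r) * L = 1)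
    (N : ℕ) :
    ∑ l ∈ Finset.range L, ‖av (fun u => g u * Ker (N + l) u) -
      (av (fun u => g u * Ker N u) + av (fun u => g u * (ee u ^ N * hk r u)))‖ ^ 2 ≤
    L * (72 * (av (fun u => ‖g u‖ * pk r u)) ^ 2 + 32 * WW r (fun u => ‖g u‖)) := by
  have hpc := pk_cont h0 h1
  have hhc := hk_cont h0 h1
  set P := av (fun u => ‖g u‖ * pk r u) with hP
  have hdc : Continuous fun u => (1:ℂ) - r * ee u := by fun_prop
  have hPn : 0 ≤ P := av_nonneg (fun t => mul_nonneg (norm_nonneg _) (pk_pos h0 h1 t).le)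
  have step : ∀ l ∈ Finset.range L, ‖av (fun u => g u * Ker (N + l) u) -
      (av (fun u => g u * Ker N u) + av (fun u => g u * (ee u ^ N * hk r u)))‖ ^ 2 ≤
      72 * P ^ 2 + 2 * ‖av (fun u => g u * (ee u ^ (N + 1) / (1 - r * ee u)) * ee u ^ l)‖ ^ 2 := by
    intro l hl
    set E : ℝ → ℂ := fun u => ((1 - r : ℝ) : ℂ) * (ee u ^ 2 * (∑ j ∈ Finset.range l, ee u ^ j) + ee u) / (1 - r * ee u) with hE
    have hEc : Continuous E := Continuous.div (by fun_prop) hdc (fun u => den_ne h0 h1 u)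
    have hEb : ∀ u, ‖E u‖ ≤ 6 * pk r u := by
      intro u
      have hb := geom_bd h0 h1 hL (n := l) (by have := Finset.mem_range.1 hl; omega) u
      have hi := inv_sq_le h0 h1 u
      have hd2 := den_le h0 h1 u
      have hd := den_pos h0 h1 u
      set d := ‖(1:ℂ) - r * ee u‖ with hdd
      have h1d : 1 ≤ 2 * d⁻¹ := by
        rw [← div_eq_mul_inv, le_div_iff₀ hd]; linarith
      simp only [hE]
      rw [norm_div, norm_mul, Complex.norm_real, Real.norm_of_nonneg (by linarith), ← hdd]
      calc (1 - r) * ‖ee u ^ 2 * (∑ j ∈ Finset.range l, ee u ^ j) + ee u‖ / d ≤ (1 - r) * (4 * d⁻¹ + 2 * d⁻¹) / d := by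
            have h5 : ‖ee u ^ 2 * (∑ j ∈ Finset.range l, ee u ^ j) + ee u‖ ≤ 4 * d⁻¹ + 2 * d⁻¹ := by
              refine (norm_add_le _ _).trans ?_
              rw [norm_mul, norm_pow, norm_ee]
              linarith
            have h6 : 0 ≤ 1 - r := by linarith
            gcongr
        _ = 6 * ((1 - r) * d⁻¹ ^ 2) := by rw [div_eq_mul_inv]; ring
        _ ≤ _ := by linarith
    have hM : Continuous (fun u => g u * (ee u ^ (N + 1) / (1 - r * ee u)) * ee u ^ l) :=
      (hg.mul (Continuous.div (by fun_prop) hdc (fun u => den_ne h0 h1 u))).mul (by fun_prop)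
    have e1 : av (fun u => g u * Ker (N + l) u) -
      (av (fun u => g u * Ker N u) + av (fun u => g u * (ee u ^ N * hk r u))) =
      av (fun u => g u * (ee u ^ N * E u)) - av (fun u => g u * (ee u ^ (N + 1) / (1 - r * ee u)) * ee u ^ l) := by
      rw [← av_add (by fun_prop) (by fun_prop), ← av_sub (by fun_prop) (by fun_prop), ← av_sub (by fun_prop) hM]
      apply av_congr; intro u
      have hK : Ker (N + l) u = Ker N u + ee u ^ N * (ee u * ∑ j ∈ Finset.range l, ee u ^ j) := by
        unfold Ker
        rw [Finset.sum_range_add, Finset.mul_sum, Finset.mul_sum]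
        congr 1
        apply Finset.sum_congr rfl; intro j _; ring
      rw [hK]
      have hgs := geom_sum_mul (ee u) l
      have hne := den_ne h0 h1 u
      simp only [hE, hk]
      set S := ∑ j ∈ Finset.range l, ee u ^ j
      have hi : (1 - (r:ℂ) * ee u) * (1 - (r:ℂ) * ee u)⁻¹ = 1 := mul_inv_cancel₀ hne
      simp only [div_eq_mul_inv]
      set i := (1 - (r:ℂ) * ee u)⁻¹
      push_cast
      linear_combination (- g u * ee u ^ N * ee u * S) * hi + (- g u * ee u ^ N * ee u * i) * hgs
    rw [e1]
    have hA : ‖av (fun u => g u * (ee u ^ N * E u))‖ ≤ 6 * P := by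
      refine (norm_av_le _).trans ?_
      rw [hP, ← av_cmul (𝕜 := ℝ)]
      refine av_mono (by fun_prop) (by fun_prop) (fun u => ?_)
      rw [norm_mul, norm_mul, norm_pow, norm_ee]
      have := mul_le_mul_of_nonneg_left (hEb u) (norm_nonneg (g u))
      simp only [one_pow, one_mul]; linarith
    set X := av (fun u => g u * (ee u ^ N * E u))
    set Y := av (fun u => g u * (ee u ^ (N + 1) / (1 - r * ee u)) * ee u ^ l)
    have h7 := norm_sub_le X Y
    have h8 : ‖X - Y‖ ^ 2 ≤ (‖X‖ + ‖Y‖) ^ 2 := by gcongr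
    have h9 : ‖X‖ ^ 2 ≤ (6 * P) ^ 2 := by gcongr
    nlinarith [sq_nonneg (‖X‖ - ‖Y‖)]
  refine (Finset.sum_le_sum step).trans ?_
  rw [Finset.sum_add_distrib, ← Finset.mul_sum (a := (2:ℝ))]
  have := main_term hg h0 h1 hL N
  simp only [Finset.sum_const, Finset.card_range, nsmul_eq_mul]
  linarith

lemma osc0' {g : ℝ → ℂ} (hg : Continuous g) {r : ℝ} (h0 : 0 ≤ r) (h1 : r < 1) {L : ℕ} (hL : (1 - r) * L = 1)
    (N : ℕ) {D : ℝ} (hD : 0 ≤ D) (hP : av (fun u => ‖g u‖ * pk r u) ≤ D) (hW : WW r (fun u => ‖g u‖) ≤ D ^ 2) :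
    ∑ l ∈ Finset.range L, ‖av (fun u => g u * Ker (N + l) u) -
      (av (fun u => g u * Ker N u) + av (fun u => g u * (ee u ^ N * hk r u)))‖ ≤ 11 * D * L := by
  have h := osc0 hg h0 h1 hL N
  have hPn : 0 ≤ av (fun u => ‖g u‖ * pk r u) := av_nonneg (fun t => mul_nonneg (norm_nonneg _) (pk_pos h0 h1 t).le)
  set a : ℕ → ℝ := fun l => ‖av (fun u => g u * Ker (N + l) u) -
      (av (fun u => g u * Ker N u) + av (fun u => g u * (ee u ^ N * hk r u)))‖
  have hP2 : (av (fun u => ‖g u‖ * pk r u)) ^ 2 ≤ D ^ 2 := by gcongr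
  have h2 : ∑ l ∈ Finset.range L, a l ^ 2 ≤ L * (121 * D ^ 2) := by
    refine h.trans ?_
    gcongr
    nlinarith
  have cs := sq_sum_le_card_mul_sum_sq (s := Finset.range L) (f := a)
  rw [Finset.card_range] at cs
  have h3 : (∑ l ∈ Finset.range L, a l) ^ 2 ≤ (11 * D * L) ^ 2 := by
    calc _ ≤ _ := cs
      _ ≤ L * (L * (121 * D ^ 2)) := by gcongr
      _ = _ := by ring
  exact le_of_sq_le_sq h3 (by positivity)

end AES

namespace AES

/-! ### Maximal function and Marcinkiewicz integral -/

lemma den_sq (r u : ℝ) : ‖(1:ℂ) - r * ee u‖ ^ 2 = (1 - r) ^ 2 + 4 * r * Real.sin (u / 2) ^ 2 := by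
  have h1 : ‖(1:ℂ) - r * ee u‖ ^ 2 = (1 - r * Real.cos u) ^ 2 + (r * Real.sin u) ^ 2 := by
    rw [← Complex.normSq_eq_norm_sq, Complex.normSq_apply]
    have : ee u = Real.cos u + Real.sin u * Complex.I := by
      unfold ee; rw [Complex.exp_mul_I]; push_cast; ring
    rw [this]
    simp [-Complex.ofReal_cos, -Complex.ofReal_sin]
    ring
  rw [h1]
  have h2 : Real.cos u = 1 - 2 * Real.sin (u / 2) ^ 2 := by
    have := Real.cos_two_mul (u / 2)
    rw [show 2 * (u / 2) = u by ring] at this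
    rw [this, Real.cos_sq']; ring
  have h3 : Real.sin u ^ 2 = 1 - Real.cos u ^ 2 := Real.sin_sq u
  rw [mul_pow, h3, h2]; ring

lemma den_lower {r : ℝ} (h0 : 0 ≤ r) (h1 : r < 1) {u : ℝ} (hu : |u| ≤ Real.pi) :
    max ((1 - r) ^ 2) (u ^ 2) ≤ 40 * ‖(1:ℂ) - r * ee u‖ ^ 2 := by
  rw [den_sq]
  have hs2 := sq_nonneg (Real.sin (u / 2))
  have hpi := Real.pi_pos
  have hpi2 : Real.pi ^ 2 ≤ 10 := by
    have := Real.pi_lt_d2; nlinarith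
  apply max_le
  · nlinarith [sq_nonneg (1 - r), mul_nonneg h0 hs2]
  · have hu2 : u ^ 2 ≤ Real.pi ^ 2 := by rw [← sq_abs u]; gcongr
    rcases le_or_gt r (1/2) with h | h
    · nlinarith [mul_nonneg h0 hs2]
    · have hsin : (u / Real.pi) ^ 2 ≤ Real.sin (u / 2) ^ 2 := by
        have := Real.mul_abs_le_abs_sin (x := u / 2) (by rw [abs_div, abs_two]; linarith)
        rw [← sq_abs (Real.sin _), ← sq_abs (u / Real.pi)]
        have h7 : |u / Real.pi| ≤ |Real.sin (u / 2)| := by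
          refine le_trans (le_of_eq ?_) this
          rw [abs_div, abs_div, abs_two, abs_of_pos hpi]; field_simp
        gcongr
      have h5 : u ^ 2 ≤ 10 * Real.sin (u / 2) ^ 2 := by
        have : u ^ 2 = Real.pi ^ 2 * (u / Real.pi) ^ 2 := by field_simp
        rw [this]
        exact mul_le_mul hpi2 hsin (sq_nonneg _) (by norm_num)
      nlinarith [sq_nonneg (1 - r)]

lemma pk_upper {r : ℝ} (h0 : 0 ≤ r) (h1 : r < 1) {u : ℝ} (hu : |u| ≤ Real.pi) :
    pk r u ≤ 80 * (1 - r) / max ((1 - r) ^ 2) (u ^ 2) := by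
  unfold pk
  have h := den_lower h0 h1 hu
  have hd := den_pos h0 h1 u
  have hm : 0 < max ((1 - r) ^ 2) (u ^ 2) := lt_max_of_lt_left (by have : 0 < 1 - r := by linarith
                                                                   positivity)
  rw [div_le_div_iff₀ (by positivity) hm]
  have : 1 - r ^ 2 ≤ 2 * (1 - r) := by nlinarith
  calc (1 - r ^ 2) * max ((1 - r) ^ 2) (u ^ 2) ≤ (2 * (1 - r)) * (40 * ‖(1:ℂ) - r * ee u‖ ^ 2) :=
        mul_le_mul this h hm.le (by linarith)
    _ = _ := by ring

lemma shell_aux {b : ℝ → ℝ} (hb : Continuous b) (hb0 : ∀ u, 0 ≤ b u) {s Λ : ℝ} (hs : 0 < s)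
    (h : ∀ ρ, s ≤ ρ → ∫ u in (-ρ)..ρ, b u ≤ Λ * ρ) (N : ℕ) :
    ∫ u in (-(2 ^ N * s))..(2 ^ N * s), b u / max (s ^ 2) (u ^ 2) ≤ Λ / s * (5 - 4 * (1/2) ^ N) := by
  have hm : ∀ u : ℝ, 0 < max (s ^ 2) (u ^ 2) := fun u => lt_max_of_lt_left (by positivity)
  have hkc : Continuous (fun u => b u / max (s ^ 2) (u ^ 2)) :=
    hb.div (by fun_prop) (fun u => (hm u).ne')
  induction N with
  | zero =>
    simp only [pow_zero, one_mul]
    calc ∫ u in (-s)..s, b u / max (s ^ 2) (u ^ 2) ≤ ∫ u in (-s)..s, b u / s ^ 2 := by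
          apply intervalIntegral.integral_mono_on (by linarith) (hkc.intervalIntegrable _ _)
            ((hb.div_const _).intervalIntegrable _ _)
          intro u _
          have := hb0 u
          gcongr
          exact le_max_left _ _
      _ ≤ Λ * s / s ^ 2 := by
          rw [intervalIntegral.integral_div]
          gcongr
          exact h s le_rfl
      _ = _ := by field_simp; norm_num
  | succ N ih =>
    set ρ := 2 ^ N * s with hρ
    have hρs : s ≤ ρ := by
      rw [hρ]; have : (1:ℝ) ≤ 2 ^ N := one_le_pow₀ (by norm_num)
      nlinarith
    have hρ0 : 0 < ρ := by linarith
    have e : (2:ℝ) ^ (N + 1) * s = 2 * ρ := by rw [hρ]; ring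
    rw [e]
    have i1 : ∀ a c, IntervalIntegrable (fun u => b u / max (s ^ 2) (u ^ 2)) volume a c := fun a c => hkc.intervalIntegrable _ _
    have i2 : ∀ a c, IntervalIntegrable b volume a c := fun a c => hb.intervalIntegrable _ _
    have sp := intervalIntegral.integral_add_adjacent_intervals (i1 (-(2*ρ)) (-ρ)) (i1 (-ρ) ρ)
    have sp2 := intervalIntegral.integral_add_adjacent_intervals (i1 (-(2*ρ)) ρ) (i1 ρ (2*ρ))
    have sq1 := intervalIntegral.integral_add_adjacent_intervals (i2 (-(2*ρ)) (-ρ)) (i2 (-ρ) ρ)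
    have sq2 := intervalIntegral.integral_add_adjacent_intervals (i2 (-(2*ρ)) ρ) (i2 ρ (2*ρ))
    have hmid : 0 ≤ ∫ u in (-ρ)..ρ, b u := intervalIntegral.integral_nonneg (by linarith) (fun u _ => hb0 u)
    have h2 := h (2 * ρ) (by linarith)
    have bd1 : ∫ u in (-(2*ρ))..(-ρ), b u / max (s ^ 2) (u ^ 2) ≤ (∫ u in (-(2*ρ))..(-ρ), b u) / ρ ^ 2 := by
      rw [← intervalIntegral.integral_div]
      apply intervalIntegral.integral_mono_on (by linarith) (i1 _ _)
            ((hb.div_const _).intervalIntegrable _ _)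
      intro u hu
      have := hb0 u
      gcongr
      refine le_trans ?_ (le_max_right _ _)
      nlinarith [hu.1, hu.2]
    have bd2 : ∫ u in ρ..(2*ρ), b u / max (s ^ 2) (u ^ 2) ≤ (∫ u in ρ..(2*ρ), b u) / ρ ^ 2 := by
      rw [← intervalIntegral.integral_div]
      apply intervalIntegral.integral_mono_on (by linarith) (i1 _ _)
            ((hb.div_const _).intervalIntegrable _ _)
      intro u hu
      have := hb0 u
      gcongr
      refine le_trans ?_ (le_max_right _ _)
      nlinarith [hu.1, hu.2]
    have h3 : (∫ u in (-(2*ρ))..(-ρ), b u) / ρ ^ 2 + (∫ u in ρ..(2*ρ), b u) / ρ ^ 2 ≤ Λ * (2 * ρ) / ρ ^ 2 := by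
      rw [← add_div]
      gcongr
      linarith
    have h4 : Λ * (2 * ρ) / ρ ^ 2 = Λ / s * (2 * (1/2) ^ N) := by
      rw [hρ]; field_simp
      rw [mul_assoc, ← mul_pow]; norm_num
    rw [← sp2, ← sp]
    calc _ ≤ Λ / s * (5 - 4 * (1/2) ^ N) + Λ / s * (2 * (1/2) ^ N) := by linarith
      _ = _ := by ring

lemma shell {a : ℝ → ℝ} (ha : Continuous a) (ha0 : ∀ u, 0 ≤ a u) {r Λ : ℝ} (h0 : 0 ≤ r) (h1 : r < 1) (t : ℝ)
    (h : ∀ ρ, 1 - r ≤ ρ → ∫ u in (t - ρ)..(t + ρ), a u ≤ Λ * ρ) :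
    PI r a t ≤ 640 * Λ := by
  set s := 1 - r with hs
  have hs0 : 0 < s := by linarith
  have hpi := Real.pi_gt_three
  obtain ⟨N, hN⟩ := pow_unbounded_of_one_lt (Real.pi / s) (by norm_num : (1:ℝ) < 2)
  rw [div_lt_iff₀ hs0] at hN
  have hb : Continuous (fun u => a (t - u)) := by fun_prop
  have hm : ∀ u : ℝ, 0 < max (s ^ 2) (u ^ 2) := fun u => lt_max_of_lt_left (by positivity)
  have hkc : Continuous (fun u => a (t - u) / max (s ^ 2) (u ^ 2)) :=
    hb.div (by fun_prop) (fun u => (hm u).ne')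
  have hΛ : 0 ≤ Λ := by
    have := h 1 (by linarith)
    have h2 : 0 ≤ ∫ u in (t - 1)..(t + 1), a u := intervalIntegral.integral_nonneg (by linarith) (fun u _ => ha0 u)
    linarith
  have h2 : ∀ ρ, s ≤ ρ → ∫ u in (-ρ)..ρ, a (t - u) ≤ Λ * ρ := by
    intro ρ hρ
    rw [intervalIntegral.integral_comp_sub_left]
    simpa using h ρ hρ
  have h3 := shell_aux hb (fun u => ha0 _) hs0 h2 N
  have h4 : ∫ u in (-Real.pi)..Real.pi, a (t - u) / max (s ^ 2) (u ^ 2) ≤ 5 * Λ / s := by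
    calc _ ≤ ∫ u in (-(2 ^ N * s))..(2 ^ N * s), a (t - u) / max (s ^ 2) (u ^ 2) := by
          apply intervalIntegral.integral_mono_interval (by linarith) pi_le (by linarith)
          · exact Eventually.of_forall (fun u => div_nonneg (ha0 _) (hm u).le)
          · exact hkc.intervalIntegrable _ _
      _ ≤ _ := h3
      _ ≤ Λ / s * 5 := by
          apply mul_le_mul_of_nonneg_left _ (by positivity)
          have : (0:ℝ) ≤ (1/2) ^ N := by positivity
          linarith
      _ = _ := by ring
  unfold PI av
  rw [smul_eq_mul]
  have h5 : ∫ u in (-Real.pi)..Real.pi, a (t - u) * pk r u ≤ 80 * s * (5 * Λ / s) := by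
    calc _ ≤ ∫ u in (-Real.pi)..Real.pi, 80 * s * (a (t - u) / max (s ^ 2) (u ^ 2)) := by
          apply intervalIntegral.integral_mono_on pi_le
            ((hb.mul (pk_cont h0 h1)).intervalIntegrable _ _)
            ((continuous_const.mul hkc).intervalIntegrable _ _)
          intro u hu
          have := pk_upper h0 h1 (u := u) (abs_le.2 hu)
          calc a (t - u) * pk r u ≤ a (t - u) * (80 * (1 - r) / max ((1 - r) ^ 2) (u ^ 2)) :=
                mul_le_mul_of_nonneg_left this (ha0 _)
            _ = 80 * s * (a (t - u) / max (s ^ 2) (u ^ 2)) := by rw [← hs]; ring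
      _ = 80 * s * ∫ u in (-Real.pi)..Real.pi, (a (t - u) / max (s ^ 2) (u ^ 2)) := intervalIntegral.integral_const_mul _ _
      _ ≤ _ := by gcongr
  have h6 : 80 * s * (5 * Λ / s) = 400 * Λ := by field_simp; ring
  rw [h6] at h5
  have h7 : (2 * Real.pi)⁻¹ ≤ 1 := by
    apply inv_le_one_of_one_le₀; linarith
  have h8 : 0 ≤ ∫ u in (-Real.pi)..Real.pi, a (t - u) * pk r u :=
    intervalIntegral.integral_nonneg pi_le (fun u _ => mul_nonneg (ha0 _) (pk_pos h0 h1 u).le)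
  nlinarith

/-- integrals over long intervals, by periodicity -/
lemma int_two {a : ℝ → ℝ} (ha : Continuous a) (hp : Function.Periodic a (2 * Real.pi)) (x : ℝ) (n : ℕ) :
    ∫ u in x..(x + n * (2 * Real.pi)), a u = n * (2 * Real.pi * av a) := by
  have e0 : ∀ y, ∫ u in y..(y + 2 * Real.pi), a u = 2 * Real.pi * av a := by
    intro y
    have := hp.intervalIntegral_add_eq y (-Real.pi)
    rw [this]
    unfold av
    rw [show -Real.pi + 2 * Real.pi = Real.pi by ring, smul_eq_mul]
    have := Real.pi_pos
    field_simp
  induction n with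
  | zero => simp
  | succ n ih =>
    have := intervalIntegral.integral_add_adjacent_intervals (ha.intervalIntegrable (μ := volume) x (x + n * (2 * Real.pi))) (ha.intervalIntegrable (x + n * (2 * Real.pi)) (x + n * (2 * Real.pi) + 2 * Real.pi))
    rw [ih, e0] at this
    have e : x + ((n + 1 : ℕ) : ℝ) * (2 * Real.pi) = x + n * (2 * Real.pi) + 2 * Real.pi := by push_cast; ring
    rw [e, ← this]; push_cast; ring

lemma int_long {a : ℝ → ℝ} (ha : Continuous a) (ha0 : ∀ u, 0 ≤ a u) (hp : Function.Periodic a (2 * Real.pi)) (x ρ : ℝ)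
    (hρ : Real.pi ≤ ρ) : ∫ u in (x - ρ)..(x + ρ), a u ≤ 4 * av a * ρ := by
  have hpi := Real.pi_pos
  set n := ⌈ρ / Real.pi⌉₊ with hn
  have h1 : ρ ≤ n * Real.pi := by
    have := Nat.le_ceil (ρ / Real.pi)
    rwa [div_le_iff₀ hpi] at this
  have h2 : n * Real.pi ≤ 2 * ρ := by
    have := (Nat.ceil_lt_add_one (show 0 ≤ ρ / Real.pi from div_nonneg (by linarith) hpi.le)).le
    rw [← hn] at this
    calc n * Real.pi ≤ (ρ / Real.pi + 1) * Real.pi := by gcongr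
      _ = ρ + Real.pi := by field_simp
      _ ≤ _ := by linarith
  have hav : 0 ≤ av a := av_nonneg ha0
  calc _ ≤ ∫ u in (x - ρ)..((x - ρ) + n * (2 * Real.pi)), a u := by
        apply intervalIntegral.integral_mono_interval le_rfl (by linarith) (by linarith)
        · exact Eventually.of_forall (fun u => ha0 u)
        · exact ha.intervalIntegrable _ _
    _ = n * (2 * Real.pi * av a) := int_two ha hp _ _
    _ ≤ _ := by nlinarith

/-- The bad set for the maximal function. -/
def Bad (a : ℝ → ℝ) (lam : ℝ) : Set ℝ := {x | ∃ ρ, 0 < ρ ∧ lam * ρ < ∫ u in (x - ρ)..(x + ρ), a u}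

lemma Bad_open {a : ℝ → ℝ} (ha : Continuous a) (lam : ℝ) : IsOpen (Bad a lam) := by
  have : Bad a lam = ⋃ ρ ∈ Set.Ioi (0:ℝ), {x | lam * ρ < ∫ u in (x - ρ)..(x + ρ), a u} := by
    ext x; simp [Bad]
  rw [this]
  refine isOpen_biUnion (fun ρ _ => ?_)
  apply isOpen_lt continuous_const
  have : (fun x => ∫ u in (x - ρ)..(x + ρ), a u) = fun x => (∫ u in (0:ℝ)..(x + ρ), a u) - ∫ u in (0:ℝ)..(x - ρ), a u := by
    ext x
    rw [intervalIntegral.integral_interval_sub_left (ha.intervalIntegrable _ _) (ha.intervalIntegrable _ _)]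
  rw [this]
  have hc : Continuous (fun x => ∫ u in (0:ℝ)..x, a u) := intervalIntegral.continuous_primitive (fun _ _ => ha.intervalIntegrable _ _) _
  exact (hc.comp (by fun_prop)).sub (hc.comp (by fun_prop))

lemma Bad_meas {a : ℝ → ℝ} (ha : Continuous a) (ha0 : ∀ u, 0 ≤ a u) (hp : Function.Periodic a (2 * Real.pi))
    {lam : ℝ} (hl : 0 < lam) (hl4 : 4 * av a ≤ lam) :
    volume (Bad a lam ∩ Set.Icc (-Real.pi) Real.pi) ≤ ENNReal.ofReal (40 * Real.pi * av a / lam) := by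
  have hpi := Real.pi_pos
  set t := Bad a lam ∩ Set.Icc (-Real.pi) Real.pi with ht
  have hch : ∀ x : ℝ, ∃ ρ, x ∈ t → (0 < ρ ∧ lam * ρ < ∫ u in (x - ρ)..(x + ρ), a u) := by
    intro x
    by_cases hx : x ∈ t
    · obtain ⟨ρ, h⟩ := hx.1; exact ⟨ρ, fun _ => h⟩
    · exact ⟨0, fun h => absurd h hx⟩
  choose R hR using hch
  have hRpi : ∀ x ∈ t, R x ≤ Real.pi := by
    intro x hx
    by_contra hc
    have h1 := int_long ha ha0 hp x (R x) (by linarith)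
    have h2 := (hR x hx).2
    have h3 := (hR x hx).1
    nlinarith
  obtain ⟨u, hut, hdisj, hcov⟩ := Vitali.exists_disjoint_subfamily_covering_enlargement_closedBall t id R Real.pi hRpi 5 (by norm_num)
  simp only [id] at hdisj hcov
  have hucount : u.Countable := by
    refine hdisj.countable_of_nonempty_interior (fun x hx => ?_)
    rw [interior_closedBall _ (hR x (hut hx)).1.ne']
    exact ⟨x, Metric.mem_ball_self (hR x (hut hx)).1⟩
  have hsub : t ⊆ ⋃ x ∈ u, Metric.closedBall x (5 * R x) := by
    intro x hx
    obtain ⟨b, hb, hb2⟩ := hcov x hx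
    exact Set.mem_biUnion hb (hb2 (Metric.mem_closedBall_self (hR x hx).1.le))
  have hball : ∀ x ∈ u, volume (Metric.closedBall x (5 * R x)) ≤ ENNReal.ofReal (10 / lam) * ∫⁻ y in Metric.closedBall x (R x), ENNReal.ofReal (a y) := by
    intro x hx
    have h1 := hR x (hut hx)
    rw [← ofReal_integral_eq_lintegral_ofReal, ← ENNReal.ofReal_mul (by positivity), Real.volume_closedBall]
    · apply ENNReal.ofReal_le_ofReal
      rw [Real.closedBall_eq_Icc, integral_Icc_eq_integral_Ioc, ← intervalIntegral.integral_of_le (by linarith)]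
      rw [div_mul_eq_mul_div, le_div_iff₀ hl]
      linarith
    · rw [Real.closedBall_eq_Icc]
      exact ha.integrableOn_Icc
    · exact Eventually.of_forall ha0
  calc volume t ≤ volume (⋃ x ∈ u, Metric.closedBall x (5 * R x)) := measure_mono hsub
    _ ≤ ∑' x : u, volume (Metric.closedBall (x:ℝ) (5 * R x)) := measure_biUnion_le _ hucount _
    _ ≤ ∑' x : u, ENNReal.ofReal (10 / lam) * ∫⁻ y in Metric.closedBall (x:ℝ) (R x), ENNReal.ofReal (a y) :=
        ENNReal.tsum_le_tsum (fun x => hball x x.2)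
    _ = ENNReal.ofReal (10 / lam) * ∫⁻ y in ⋃ x ∈ u, Metric.closedBall (x:ℝ) (R x), ENNReal.ofReal (a y) := by
        rw [ENNReal.tsum_mul_left, lintegral_biUnion hucount (fun x _ => measurableSet_closedBall) hdisj]
    _ ≤ ENNReal.ofReal (10 / lam) * ∫⁻ y in Set.Icc (-(2 * Real.pi)) (2 * Real.pi), ENNReal.ofReal (a y) := by
        gcongr
        intro y hy
        simp only [Set.mem_iUnion] at hy
        obtain ⟨x, hx, hy⟩ := hy
        rw [Real.closedBall_eq_Icc] at hy
        have h1 := hRpi x (hut hx)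
        have h2 := (hut hx).2
        exact ⟨by linarith [hy.1, h2.1], by linarith [hy.2, h2.2]⟩
    _ = ENNReal.ofReal (10 / lam) * ENNReal.ofReal (4 * Real.pi * av a) := by
        congr 1
        rw [← ofReal_integral_eq_lintegral_ofReal ha.integrableOn_Icc (Eventually.of_forall ha0), integral_Icc_eq_integral_Ioc, ← intervalIntegral.integral_of_le (by linarith)]
        congr 1
        have := int_two ha hp (-(2 * Real.pi)) 2
        rw [show -(2 * Real.pi) + ((2:ℕ):ℝ) * (2 * Real.pi) = 2 * Real.pi by push_cast; ring] at this
        rw [this]; push_cast; ring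
    _ = _ := by
        rw [← ENNReal.ofReal_mul (by positivity)]
        congr 1; ring

lemma lint_tail {δ : ℝ} (hδ : 0 < δ) :
    ∫⁻ y in {y : ℝ | δ ≤ |y|}, ENNReal.ofReal (1 / y ^ 2) ≤ ENNReal.ofReal (2 / δ) := by
  have h1 : ∫⁻ y in Set.Ioi δ, ENNReal.ofReal (1 / y ^ 2) = ENNReal.ofReal (1 / δ) := by
    have hi := integrableOn_Ioi_rpow_of_lt (show (-2:ℝ) < -1 by norm_num) hδ
    have hv := integral_Ioi_rpow_of_lt (show (-2:ℝ) < -1 by norm_num) hδ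
    have e : ∫⁻ y in Set.Ioi δ, ENNReal.ofReal (1 / y ^ 2) = ∫⁻ y in Set.Ioi δ, ENNReal.ofReal (y ^ (-2:ℝ)) := by
      apply setLIntegral_congr_fun measurableSet_Ioi
      intro y hy
      simp only
      rw [Real.rpow_neg (hδ.trans hy).le, one_div]
      norm_num
    rw [e, ← ofReal_integral_eq_lintegral_ofReal hi, hv]
    · congr 1
      norm_num
      rw [Real.rpow_neg hδ.le, Real.rpow_one]
    · filter_upwards [ae_restrict_mem measurableSet_Ioi] with y hy
      exact Real.rpow_nonneg (hδ.trans hy).le _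
  have h2 : ∫⁻ y in Set.Iio (-δ), ENNReal.ofReal (1 / y ^ 2) = ∫⁻ y in Set.Ioi δ, ENNReal.ofReal (1 / y ^ 2) := by
    have hmp := Measure.measurePreserving_neg (volume : Measure ℝ)
    have := hmp.setLIntegral_comp_preimage_emb (MeasurableEquiv.neg ℝ).measurableEmbedding (fun y => ENNReal.ofReal (1 / y ^ 2)) (Set.Ioi δ)
    rw [← this]
    have e : (fun x : ℝ => -x) ⁻¹' Set.Ioi δ = Set.Iio (-δ) := by
      ext x; simp only [Set.mem_preimage, Set.mem_Ioi, Set.mem_Iio]; constructor <;> intro h <;> linarith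
    have e' : (Neg.neg : ℝ → ℝ) ⁻¹' Set.Ioi δ = Set.Iio (-δ) := e
    rw [e']
    apply lintegral_congr; intro y; simp
  have h3 : {y : ℝ | δ ≤ |y|} ⊆ (Set.Ioi δ ∪ Set.Iio (-δ)) ∪ {δ, -δ} := by
    intro y hy
    simp only [Set.mem_ofPred_eq, le_abs'] at hy
    simp only [Set.mem_union, Set.mem_Ioi, Set.mem_Iio, Set.mem_insert_iff, Set.mem_singleton_iff]
    rcases hy with h | h
    · rcases h.lt_or_eq with h | h
      · left; right; exact h
      · right; right; exact h
    · rcases h.lt_or_eq with h | h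
      · left; left; exact h
      · right; left; exact h.symm
  calc _ ≤ ∫⁻ y in (Set.Ioi δ ∪ Set.Iio (-δ)) ∪ {δ, -δ}, ENNReal.ofReal (1 / y ^ 2) := lintegral_mono_set h3
    _ ≤ _ + _ := lintegral_union_le _ _ _
    _ ≤ (_ + _) + _ := by gcongr; exact lintegral_union_le _ _ _
    _ = ENNReal.ofReal (1 / δ) + ENNReal.ofReal (1 / δ) + 0 := by
        rw [h2, h1]
        congr 1
        apply setLIntegral_measure_zero
        exact (Set.Finite.measure_zero (by simp) _)
    _ = _ := by
        rw [add_zero, ← ENNReal.ofReal_add (by positivity) (by positivity)]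
        congr 1; ring

end AES

namespace AES

/-- The Marcinkiewicz integral. -/
def MJ (a : ℝ → ℝ) (E : Set ℝ) (x : ℝ) : ENNReal :=
  ∫⁻ t in Set.Icc (-(2 * Real.pi)) (2 * Real.pi), ENNReal.ofReal (a t * Metric.infDist t E / (x - t) ^ 2)

lemma MJ_meas_aux {a : ℝ → ℝ} (ha : Continuous a) (E : Set ℝ) :
    Measurable (Function.uncurry fun x t : ℝ => ENNReal.ofReal (a t * Metric.infDist t E / (x - t) ^ 2)) := by
  apply Measurable.ennreal_ofReal
  have h1 : Measurable (fun p : ℝ × ℝ => a p.2 * Metric.infDist p.2 E) :=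
    ((ha.comp continuous_snd).mul ((Metric.continuous_infDist_pt E).comp continuous_snd)).measurable
  have h2 : Measurable (fun p : ℝ × ℝ => (p.1 - p.2) ^ 2) := by fun_prop
  exact h1.div h2

lemma MJ_meas {a : ℝ → ℝ} (ha : Continuous a) (E : Set ℝ) : Measurable (MJ a E) :=
  (MJ_meas_aux ha E).lintegral_prod_right'

lemma MJ_int {a : ℝ → ℝ} (ha : Continuous a) (ha0 : ∀ u, 0 ≤ a u) (hp : Function.Periodic a (2 * Real.pi)) (E : Set ℝ) :
    ∫⁻ x in E, MJ a E x ≤ ENNReal.ofReal (8 * Real.pi * av a) := by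
  have hpi := Real.pi_pos
  unfold MJ
  rw [lintegral_lintegral_swap (MJ_meas_aux ha E).aemeasurable]
  have hin : ∀ t, ∫⁻ x in E, ENNReal.ofReal (a t * Metric.infDist t E / (x - t) ^ 2) ≤ ENNReal.ofReal (2 * a t) := by
    intro t
    have hd0 : 0 ≤ Metric.infDist t E := Metric.infDist_nonneg
    rcases hd0.eq_or_lt with h | h
    · simp [← h]
    · have e : ∀ x : ℝ, ENNReal.ofReal (a t * Metric.infDist t E / (x - t) ^ 2) = ENNReal.ofReal (a t * Metric.infDist t E) * ENNReal.ofReal (1 / (x - t) ^ 2) := by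
        intro x
        rw [← ENNReal.ofReal_mul (mul_nonneg (ha0 _) hd0)]
        congr 1; ring
      simp only [e]
      rw [lintegral_const_mul _ (by fun_prop)]
      have h2 : ∫⁻ x in E, ENNReal.ofReal (1 / (x - t) ^ 2) ≤ ENNReal.ofReal (2 / Metric.infDist t E) := by
        refine le_trans ?_ (lint_tail h)
        have hmp := measurePreserving_sub_right (volume : Measure ℝ) t
        have := hmp.setLIntegral_comp_preimage_emb (MeasurableEquiv.subRight t).measurableEmbedding (fun y => ENNReal.ofReal (1 / y ^ 2)) {y : ℝ | Metric.infDist t E ≤ |y|}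
        rw [← this]
        apply lintegral_mono_set
        intro x hx
        show Metric.infDist t E ≤ |x - t|
        rw [abs_sub_comm, ← Real.dist_eq]
        exact Metric.infDist_le_dist_of_mem hx
      calc _ ≤ ENNReal.ofReal (a t * Metric.infDist t E) * ENNReal.ofReal (2 / Metric.infDist t E) := by gcongr
        _ = _ := by
          rw [← ENNReal.ofReal_mul (mul_nonneg (ha0 _) hd0)]
          congr 1; field_simp
  calc _ ≤ ∫⁻ t in Set.Icc (-(2 * Real.pi)) (2 * Real.pi), ENNReal.ofReal (2 * a t) := lintegral_mono (fun t => hin t)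
    _ = _ := by
      have h2a : Continuous (fun t => 2 * a t) := by fun_prop
      rw [← ofReal_integral_eq_lintegral_ofReal h2a.integrableOn_Icc (Eventually.of_forall (fun t => mul_nonneg (by norm_num) (ha0 t))), integral_Icc_eq_integral_Ioc, ← intervalIntegral.integral_of_le (by linarith)]
      congr 1
      have := int_two ha hp (-(2 * Real.pi)) 2
      rw [show -(2 * Real.pi) + ((2:ℕ):ℝ) * (2 * Real.pi) = 2 * Real.pi by push_cast; ring] at this
      have h3 := intervalIntegral.integral_const_mul (a := -(2 * Real.pi)) (b := 2 * Real.pi) (μ := volume) (2:ℝ) a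
      rw [h3, this]; push_cast; ring

lemma PI_cont {a : ℝ → ℝ} (ha : Continuous a) {r : ℝ} (h0 : 0 ≤ r) (h1 : r < 1) : Continuous (PI r a) := by
  have := pk_cont h0 h1
  exact av_cont (F := fun x u => a (x - u) * pk r u) (by unfold Function.uncurry; fun_prop)

theorem good_set {a : ℝ → ℝ} (ha : Continuous a) (ha0 : ∀ u, 0 ≤ a u) (hp : Function.Periodic a (2 * Real.pi))
    {lam : ℝ} (hl : 0 < lam) :
    ∃ B : Set ℝ, MeasurableSet B ∧ volume (B ∩ Set.Icc (-Real.pi) Real.pi) ≤ ENNReal.ofReal (48 * Real.pi * av a / lam) ∧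
      ∀ x ∈ Set.Icc (-Real.pi) Real.pi, x ∉ B → ∀ r, 0 ≤ r → r < 1 →
        PI r a x ≤ 1000 * lam ∧ PI r (fun t => a t * PI r a t) x ≤ (1000 * lam) ^ 2 := by
  have hpi := Real.pi_pos
  have hav : 0 ≤ av a := av_nonneg ha0
  rcases lt_or_ge lam (4 * av a) with h4 | h4
  · refine ⟨Set.univ, MeasurableSet.univ, ?_, fun x _ hx => absurd (Set.mem_univ x) hx⟩
    rw [Set.univ_inter, Real.volume_Icc]
    apply ENNReal.ofReal_le_ofReal
    rw [le_div_iff₀ hl]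
    nlinarith
  set E := (Bad a lam)ᶜ with hE
  have hEc : IsClosed E := (Bad_open ha lam).isClosed_compl
  have hMm := MJ_meas ha E
  set J := {x | ENNReal.ofReal lam ≤ MJ a E x} with hJ
  have hJm : MeasurableSet J := measurableSet_le measurable_const hMm
  refine ⟨Bad a lam ∪ (J ∩ E), (Bad_open ha lam).measurableSet.union (hJm.inter hEc.measurableSet), ?_, ?_⟩
  · have h1 := Bad_meas ha ha0 hp hl h4
    have h2 : volume (J ∩ E) ≤ ENNReal.ofReal (8 * Real.pi * av a / lam) := by
      have := mul_meas_ge_le_lintegral (μ := volume.restrict E) hMm (ENNReal.ofReal lam)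
      rw [Measure.restrict_apply hJm] at this
      have h3 := this.trans (MJ_int ha ha0 hp E)
      rw [ENNReal.ofReal_div_of_pos hl, ENNReal.le_div_iff_mul_le (Or.inl (by simpa using hl)) (Or.inl ENNReal.ofReal_ne_top), mul_comm]
      exact h3
    calc _ ≤ volume ((Bad a lam ∩ Set.Icc (-Real.pi) Real.pi) ∪ (J ∩ E)) := by
          apply measure_mono
          rintro x ⟨h | h, hx⟩
          · left; exact ⟨h, hx⟩
          · right; exact h
      _ ≤ _ + _ := measure_union_le _ _
      _ ≤ ENNReal.ofReal (40 * Real.pi * av a / lam) + ENNReal.ofReal (8 * Real.pi * av a / lam) := add_le_add h1 h2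
      _ = _ := by
        rw [← ENNReal.ofReal_add (by positivity) (by positivity)]
        congr 1; ring
  intro x hx hxB r h0 h1
  have hxE : x ∈ E := fun h => hxB (Or.inl h)
  have hxJ : MJ a E x < ENNReal.ofReal lam := by
    by_contra hc
    exact hxB (Or.inr ⟨not_lt.1 hc, hxE⟩)
  have hne : E.Nonempty := ⟨x, hxE⟩
  set s := 1 - r with hs
  have hs0 : 0 < s := by linarith
  have hPt : ∀ t, PI r a t ≤ 640 * (lam * (1 + Metric.infDist t E / s)) := by
    intro t
    apply shell ha ha0 h0 h1
    intro ρ hρ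
    rw [← hs] at hρ
    obtain ⟨e, he, hd⟩ := hEc.exists_infDist_eq_dist hne t
    have hδ : 0 ≤ Metric.infDist t E := Metric.infDist_nonneg
    set δ := Metric.infDist t E with hδd
    rw [Real.dist_eq] at hd
    have h5 : ∫ u in (e - (ρ + δ))..(e + (ρ + δ)), a u ≤ lam * (ρ + δ) := by
      by_contra hc
      exact he ⟨ρ + δ, by linarith, not_le.1 hc⟩
    have h6 := abs_le.1 hd.symm.le
    calc _ ≤ ∫ u in (e - (ρ + δ))..(e + (ρ + δ)), a u := by
          apply intervalIntegral.integral_mono_interval (by linarith) (by linarith) (by linarith)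
          · exact Eventually.of_forall (fun u => ha0 u)
          · exact ha.intervalIntegrable _ _
      _ ≤ _ := h5
      _ ≤ _ := by
        have : δ ≤ δ / s * ρ := by
          rw [div_mul_eq_mul_div, le_div_iff₀ hs0]; gcongr
        nlinarith
  have hδx : Metric.infDist x E = 0 := Metric.infDist_zero_of_mem hxE
  have hPx : PI r a x ≤ 640 * lam := by
    have := hPt x
    rw [hδx] at this; simpa using this
  refine ⟨by linarith, ?_⟩
  have hpc := pk_cont h0 h1
  have hdc : Continuous (fun u => Metric.infDist (x - u) E) := (Metric.continuous_infDist_pt E).comp (by fun_prop)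
  have hac : Continuous (fun u => a (x - u)) := by fun_prop
  have hPc := PI_cont ha h0 h1
  set f1 : ℝ → ℝ := fun u => a (x - u) * Metric.infDist (x - u) E / s * pk r u with hf1
  have hf1c : Continuous f1 := ((hac.mul hdc).div_const _).mul hpc
  have hf10 : ∀ u, 0 ≤ f1 u := fun u => mul_nonneg (div_nonneg (mul_nonneg (ha0 _) Metric.infDist_nonneg) hs0.le) (pk_pos h0 h1 u).le
  have hb : av f1 ≤ 80 * lam := by
    have h5 : ∫ u in (-Real.pi)..Real.pi, f1 u ≤ 80 * lam := by
      have h6 : ENNReal.ofReal (∫ u in (-Real.pi)..Real.pi, f1 u) ≤ ENNReal.ofReal (80 * lam) := by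
        rw [intervalIntegral.integral_of_le pi_le, ofReal_integral_eq_lintegral_ofReal (hf1c.integrableOn_Icc.mono_set Set.Ioc_subset_Icc_self) (Eventually.of_forall hf10)]
        set h : ℝ → ENNReal := fun t => ENNReal.ofReal (a t * Metric.infDist t E / (x - t) ^ 2) with hh
        calc _ ≤ ∫⁻ u in Set.Ioc (-Real.pi) Real.pi, ENNReal.ofReal 80 * (Set.Icc (-(2 * Real.pi)) (2 * Real.pi)).indicator h (x - u) := by
              apply setLIntegral_mono' measurableSet_Ioc
              intro u hu
              rw [Set.indicator_of_mem (show x - u ∈ Set.Icc (-(2 * Real.pi)) (2 * Real.pi) from ⟨by linarith [hx.1, hu.2], by linarith [hx.2, hu.1]⟩)]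
              rw [hh, ← ENNReal.ofReal_mul (by norm_num)]
              apply ENNReal.ofReal_le_ofReal
              simp only [hf1, sub_sub_cancel]
              by_cases hu0 : u = 0
              · rw [hu0, sub_zero, hδx]; simp
              · have hpu := pk_upper h0 h1 (u := u) (abs_le.2 ⟨hu.1.le, hu.2⟩)
                rw [← hs] at hpu
                have hu2 : 0 < u ^ 2 := by positivity
                have hpu2 : pk r u ≤ 80 * s / u ^ 2 := hpu.trans (by
                  gcongr
                  exact le_max_right _ _)
                calc _ ≤ a (x - u) * Metric.infDist (x - u) E / s * (80 * s / u ^ 2) := by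
                      apply mul_le_mul_of_nonneg_left hpu2
                      exact div_nonneg (mul_nonneg (ha0 _) Metric.infDist_nonneg) hs0.le
                  _ = _ := by field_simp
          _ ≤ ∫⁻ u, ENNReal.ofReal 80 * (Set.Icc (-(2 * Real.pi)) (2 * Real.pi)).indicator h (x - u) := setLIntegral_le_lintegral _ _
          _ = ENNReal.ofReal 80 * ∫⁻ u, (Set.Icc (-(2 * Real.pi)) (2 * Real.pi)).indicator h (x - u) := lintegral_const_mul' _ _ ENNReal.ofReal_ne_top
          _ = ENNReal.ofReal 80 * MJ a E x := by
              rw [lintegral_sub_left_eq_self (fun t => (Set.Icc (-(2 * Real.pi)) (2 * Real.pi)).indicator h t) x, lintegral_indicator measurableSet_Icc]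
              rfl
          _ ≤ ENNReal.ofReal 80 * ENNReal.ofReal lam := by gcongr
          _ = _ := by rw [← ENNReal.ofReal_mul (by norm_num)]
      exact (ENNReal.ofReal_le_ofReal_iff (by positivity)).1 h6
    unfold av
    rw [smul_eq_mul]
    have h7 : (2 * Real.pi)⁻¹ ≤ 1 := by
      apply inv_le_one_of_one_le₀; linarith [Real.pi_gt_three]
    have h8 : 0 ≤ ∫ u in (-Real.pi)..Real.pi, f1 u := intervalIntegral.integral_nonneg pi_le (fun u _ => hf10 u)
    nlinarith
  calc PI r (fun t => a t * PI r a t) x ≤ av (fun u => 640 * lam * (a (x - u) * pk r u + f1 u)) := by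
        unfold PI
        apply av_mono
        · exact (hac.mul (hPc.comp (by fun_prop))).mul hpc
        · fun_prop
        intro u
        have h5 := hPt (x - u)
        have h6 := mul_nonneg (ha0 (x - u)) (pk_pos h0 h1 u).le
        calc a (x - u) * PI r a (x - u) * pk r u = PI r a (x - u) * (a (x - u) * pk r u) := by ring
          _ ≤ _ := mul_le_mul_of_nonneg_right h5 h6
          _ = _ := by simp only [hf1]; ring
    _ = 640 * lam * (PI r a x + av f1) := by
        rw [av_cmul, av_add (by fun_prop) hf1c]; rfl
    _ ≤ 640 * lam * (640 * lam + 80 * lam) := by gcongr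
    _ ≤ _ := by nlinarith

end AES

namespace AES

/-! ### Herglotz integrals -/

lemma circ_eq {E : Type*} [NormedAddCommGroup E] [NormedSpace ℝ E] (f : ℂ → E) (R : ℝ) :
    Real.circleAverage f 0 R = av (fun θ => f (R * ee θ)) := by
  rw [Real.circleAverage_def]
  unfold av
  congr 1
  have hp : Function.Periodic (fun θ => f (R * ee θ)) (2 * Real.pi) := by
    intro θ; simp only; rw [ee_per]
  have := hp.intervalIntegral_add_eq 0 (-Real.pi)
  rw [zero_add, show -Real.pi + 2 * Real.pi = Real.pi by ring] at this
  rw [← this]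
  apply intervalIntegral.integral_congr
  intro θ _
  simp [circleMap, ee]

def HF (v : ℝ → ℝ) (w : ℂ) : ℂ := av (fun t => herglotzRieszKernel 0 w (ee t) * (v t : ℂ))

lemma arg_ee {v : ℝ → ℝ} (hp : Function.Periodic v (2 * Real.pi)) (θ : ℝ) : v (Complex.arg (ee θ)) = v θ := by
  unfold ee
  rw [Complex.arg_exp_mul_I]
  unfold toIocMod
  exact hp.sub_zsmul_eq _

lemma HF_diff {v : ℝ → ℝ} (hv : Continuous v) (hp : Function.Periodic v (2 * Real.pi)) :
    DifferentiableOn ℂ (HF v) (Metric.ball 0 1) := by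
  have hci : CircleIntegrable (fun ζ : ℂ => ((v (Complex.arg ζ) : ℝ) : ℂ)) 0 1 := by
    unfold CircleIntegrable
    have : (fun θ => ((v (Complex.arg (circleMap 0 1 θ)) : ℝ) : ℂ)) = fun θ => (v θ : ℂ) := by
      ext θ
      have : circleMap 0 1 θ = ee θ := by simp [circleMap, ee]
      rw [this, arg_ee hp]
    rw [this]
    exact Continuous.intervalIntegrable (by fun_prop) _ _
  have h := differentiableOn_circleAverage_herglotzRieszKernel_smul hci
  have e : HF v = fun w => Real.circleAverage
      (fun ζ => herglotzRieszKernel 0 w ζ • ((v (Complex.arg ζ) : ℝ) : ℂ)) 0 1 := by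
    funext w
    rw [circ_eq]
    unfold HF
    apply av_congr; intro t
    simp [arg_ee hp]
  rw [e]; exact h

lemma ee_ne_w {w : ℂ} (hw : ‖w‖ < 1) (t : ℝ) : ee t - w ≠ 0 := by
  intro h
  rw [sub_eq_zero] at h
  rw [← h, norm_ee] at hw
  exact lt_irrefl _ hw

lemma HF_int_cont {v : ℝ → ℝ} (hv : Continuous v) {w : ℂ} (hw : ‖w‖ < 1) :
    Continuous (fun t => herglotzRieszKernel 0 w (ee t) * (v t : ℂ)) := by
  refine Continuous.mul ?_ (by fun_prop)
  unfold herglotzRieszKernel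
  simp only [sub_zero]
  exact Continuous.div (by fun_prop) (by fun_prop) (fun t => ee_ne_w hw t)

lemma norm_ree {r : ℝ} (h0 : 0 ≤ r) (x : ℝ) : ‖(r:ℂ) * ee x‖ = r := by
  rw [norm_mul, norm_ee, Complex.norm_real, Real.norm_of_nonneg h0, mul_one]

lemma exists_polar (w : ℂ) : ∃ x, w = ‖w‖ * ee x := ⟨Complex.arg w, by
  unfold ee; exact (Complex.norm_mul_exp_arg_mul_I w).symm⟩

lemma norm_sub_ee (R ρ x θ : ℝ) : ‖(R:ℂ) * ee θ - ρ * ee x‖ = ‖(R:ℂ) - ρ * ee (x - θ)‖ := by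
  have : (R:ℂ) * ee θ - ρ * ee x = ee θ * (R - ρ * ee (x - θ)) := by
    have : ee x = ee θ * ee (x - θ) := by rw [← ee_add]; congr 1; ring
    rw [this]; ring
  rw [this, norm_mul, norm_ee, one_mul]

lemma poisson_eq {R ρ : ℝ} (hR : 0 < R) (h0 : 0 ≤ ρ) (x θ : ℝ) :
    poissonKernel 0 (ρ * ee x) (R * ee θ) = pk (ρ / R) (x - θ) := by
  rw [poissonKernel_def]
  simp only [sub_zero]
  rw [norm_ree hR.le, norm_ree h0, norm_sub_ee]
  unfold pk
  have : (R:ℂ) - ρ * ee (x - θ) = R * (1 - ((ρ / R : ℝ) : ℂ) * ee (x - θ)) := by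
    have : (R:ℂ) ≠ 0 := by exact_mod_cast hR.ne'
    push_cast; field_simp
  rw [this, norm_mul, Complex.norm_real, Real.norm_of_nonneg hR.le, mul_pow, ← div_div]
  congr 1
  field_simp

lemma av_re {φ : ℝ → ℂ} (h : Continuous φ) : (av φ).re = av (fun t => (φ t).re) := by
  unfold av
  rw [Complex.smul_re]
  congr 1
  exact (Complex.reCLM.intervalIntegral_comp_comm (h.intervalIntegrable _ _)).symm

lemma av_im {φ : ℝ → ℂ} (h : Continuous φ) : (av φ).im = av (fun t => (φ t).im) := by
  unfold av
  rw [Complex.smul_im]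
  congr 1
  exact (Complex.imCLM.intervalIntegral_comp_comm (h.intervalIntegrable _ _)).symm

lemma PI_eq {v : ℝ → ℝ} (hp : Function.Periodic v (2 * Real.pi)) (r x : ℝ) :
    PI r v x = av (fun t => v t * pk r (x - t)) := by
  unfold PI
  have hpp : Function.Periodic (fun u => v (x - u) * pk r u) (2 * Real.pi) := by
    intro u
    simp only
    rw [pk_per, ← hp (x - (u + 2 * Real.pi))]
    congr 2; ring
  rw [← av_sub_left hpp x]
  apply av_congr; intro t
  simp

lemma HF_re {v : ℝ → ℝ} (hv : Continuous v) (hp : Function.Periodic v (2 * Real.pi)) {r : ℝ} (h0 : 0 ≤ r) (h1 : r < 1) (x : ℝ) :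
    (HF v (r * ee x)).re = PI r v x := by
  unfold HF
  rw [av_re (HF_int_cont hv (by rw [norm_ree h0]; exact h1)), PI_eq hp]
  apply av_congr; intro t
  have h2 := poisson_eq (R := 1) one_pos h0 x t
  rw [poissonKernel_eq_re_herglotzRieszKernel] at h2
  simp only [Complex.ofReal_one, one_mul, div_one, Function.comp] at h2
  rw [Complex.mul_re, ← h2]
  simp [mul_comm]

lemma HF_zero (v : ℝ → ℝ) : HF v 0 = (av v : ℝ) := by
  unfold HF
  rw [← av_ofReal]
  apply av_congr; intro t
  have := ee_ne t
  simp [herglotzRieszKernel_def, this]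

lemma PI_pos {v : ℝ → ℝ} (hv : Continuous v) (hv0 : ∀ t, 0 < v t) {r : ℝ} (h0 : 0 ≤ r) (h1 : r < 1) (x : ℝ) : 0 < PI r v x := by
  unfold PI av
  have hpi := Real.pi_pos
  refine mul_pos (by positivity) ?_
  apply intervalIntegral.intervalIntegral_pos_of_pos
  · exact Continuous.intervalIntegrable (by have := pk_cont h0 h1; fun_prop) _ _
  · intro u; exact mul_pos (hv0 _) (pk_pos h0 h1 u)
  · linarith

lemma HF_re_pos {v : ℝ → ℝ} (hv : Continuous v) (hp : Function.Periodic v (2 * Real.pi)) (hv0 : ∀ t, 0 < v t)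
    {w : ℂ} (hw : ‖w‖ < 1) : 0 < (HF v w).re := by
  obtain ⟨x, hx⟩ := exists_polar w
  rw [hx, HF_re hv hp (norm_nonneg w) hw]
  exact PI_pos hv hv0 (norm_nonneg w) hw x

/-- one-sided conjugate integral versus Herglotz integral -/
lemma av_hk {v : ℝ → ℝ} (hv : Continuous v) (hp : Function.Periodic v (2 * Real.pi)) {r : ℝ} (h0 : 0 ≤ r) (h1 : r < 1) (x : ℝ) :
    av (fun u => (v (x - u) : ℂ) * hk r u) = (HF v (r * ee x) - av v) / 2 := by
  have hpp : Function.Periodic (fun u => (v (x - u) : ℂ) * hk r u) (2 * Real.pi) := by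
    intro u
    simp only [hk]
    rw [ee_per, ← hp (x - (u + 2 * Real.pi))]
    congr 3; ring
  have hw : ‖(r:ℂ) * ee x‖ < 1 := by rw [norm_ree h0]; exact h1
  rw [← av_sub_left hpp x]
  unfold HF
  rw [← av_ofReal, ← av_sub (HF_int_cont hv hw) (by fun_prop), div_eq_mul_inv, ← av_mulc]
  apply av_congr; intro t
  simp only [sub_sub_cancel]
  rw [herglotzRieszKernel_def]
  simp only [sub_zero]
  have hne := ee_ne_w hw t
  have e1 : hk r (x - t) = r * ee x / (ee t - r * ee x) := by
    unfold hk
    have : ee x = ee t * ee (x - t) := by rw [← ee_add]; congr 1; ring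
    have h3 := den_ne h0 h1 (x - t)
    have h4 := ee_ne t
    rw [this, show ee t - (r:ℂ) * (ee t * ee (x - t)) = ee t * (1 - r * ee (x - t)) by ring]
    field_simp
  rw [e1]
  field_simp
  ring

/-- square root -/
def HG (v : ℝ → ℝ) (w : ℂ) : ℂ := Complex.exp (Complex.log (HF v w) / 2)

lemma HG_diff {v : ℝ → ℝ} (hv : Continuous v) (hp : Function.Periodic v (2 * Real.pi)) (hv0 : ∀ t, 0 < v t) :
    DifferentiableOn ℂ (HG v) (Metric.ball 0 1) := by
  unfold HG
  apply DifferentiableOn.cexp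
  apply DifferentiableOn.div_const
  apply (HF_diff hv hp).clog
  intro w hw
  exact Or.inl (HF_re_pos hv hp hv0 (by simpa using hw))

lemma HG_re {v : ℝ → ℝ} (w : ℂ) : 0 ≤ (HG v w).re := by
  unfold HG
  rw [Complex.exp_re]
  apply mul_nonneg (Real.exp_pos _).le
  apply Real.cos_nonneg_of_mem_Icc
  have h1 : (Complex.log (HF v w) / 2).im = Complex.arg (HF v w) / 2 := by
    rw [← Complex.log_im]; simp
  rw [h1]
  have := Complex.neg_pi_lt_arg (HF v w)
  have := Complex.arg_le_pi (HF v w)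
  exact ⟨by linarith, by linarith⟩

lemma HF_le_HG {v : ℝ → ℝ} {w : ℂ} (h : 0 < (HF v w).re) : ‖HF v w‖ ≤ 2 * (HG v w).re ^ 2 := by
  have hne : HF v w ≠ 0 := by
    intro h0; rw [h0] at h; simp at h
  have h2 : HG v w ^ 2 = HF v w := by
    unfold HG
    rw [← Complex.exp_nat_mul]
    push_cast
    rw [mul_div_cancel₀ _ (by norm_num), Complex.exp_log hne]
  have h3 : ‖HF v w‖ = (HG v w).re ^ 2 + (HG v w).im ^ 2 := by
    rw [← h2, norm_pow, ← Complex.normSq_eq_norm_sq, Complex.normSq_apply]; ring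
  have h4 : (HF v w).re = (HG v w).re ^ 2 - (HG v w).im ^ 2 := by
    rw [← h2, pow_two, Complex.mul_re]; ring
  rw [h3]; linarith

lemma center_v {v : ℝ → ℝ} (hv : Continuous v) (hp : Function.Periodic v (2 * Real.pi)) (hv0 : ∀ t, 0 < v t)
    {lam : ℝ} (hl : 0 < lam) {ρ0 : ℝ} (hρ1 : ρ0 < 1) (hρ0 : 0 ≤ ρ0) :
    ∃ B : Set ℝ, MeasurableSet B ∧ volume (B ∩ Set.Icc (-Real.pi) Real.pi) ≤ ENNReal.ofReal (48 * Real.pi * √(av v) / lam) ∧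
      ∀ x ∈ Set.Icc (-Real.pi) Real.pi, x ∉ B → ∀ r, 0 ≤ r → r ≤ ρ0 → ‖HF v (r * ee x)‖ ≤ 2 * (1000 * lam) ^ 2 := by
  set R := (1 + ρ0) / 2 with hRd
  have hR1 : R < 1 := by linarith
  have hR0 : 0 < R := by linarith
  have hRρ : ρ0 < R := by linarith
  have hGd := HG_diff hv hp hv0
  have hball : ∀ θ, (R:ℂ) * ee θ ∈ Metric.ball (0:ℂ) 1 := by
    intro θ; rw [mem_ball_zero_iff, norm_ree hR0.le]; exact hR1
  have hGc : Continuous (fun θ => HG v (R * ee θ)) := by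
    exact hGd.continuousOn.comp_continuous (by fun_prop) hball
  set ψ : ℝ → ℝ := fun θ => (HG v (R * ee θ)).re with hψ
  have hψc : Continuous ψ := Complex.continuous_re.comp hGc
  have hψp : Function.Periodic ψ (2 * Real.pi) := by
    intro θ; simp only [hψ]; rw [ee_per]
  have hdc : DiffContOnCl ℂ (HG v) (Metric.ball 0 R) := by
    apply DifferentiableOn.diffContOnCl
    rw [closure_ball _ hR0.ne']
    exact hGd.mono (Metric.closedBall_subset_ball hR1)
  have havψ : av ψ = √(av v) := by
    have h1 : Real.circleAverage (HG v) 0 R = HG v 0 := by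
      apply DiffContOnCl.circleAverage
      rw [abs_of_pos hR0]; exact hdc
    rw [circ_eq] at h1
    rw [hψ, ← av_re hGc, h1]
    unfold HG
    rw [HF_zero]
    have hpos : 0 ≤ av v := av_nonneg (fun t => (hv0 t).le)
    have hpos' : 0 < av v := by
      have := HF_re_pos hv hp hv0 (w := 0) (by simp)
      rw [HF_zero] at this; simpa using this
    rw [← Complex.ofReal_log hpos, show ((Real.log (av v) : ℝ) : ℂ) / 2 = ((Real.log (av v) / 2 : ℝ) : ℂ) by push_cast; ring, ← Complex.ofReal_exp, Complex.ofReal_re]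
    rw [Real.sqrt_eq_rpow, Real.rpow_def_of_pos hpos']
    congr 1; ring
  obtain ⟨B, hBm, hBv, hB⟩ := good_set hψc (fun θ => HG_re _) hψp hl
  rw [havψ] at hBv
  refine ⟨B, hBm, hBv, fun x hx hxB r h0 h1 => ?_⟩
  have hr1 : r < 1 := by linarith
  have hq1 : r / R < 1 := by rw [div_lt_one hR0]; linarith
  have h2 := (hB x hx hxB (r / R) (by positivity) hq1).1
  have h3 : (HG v (r * ee x)).re = PI (r / R) ψ x := by
    have h4 := hdc.circleAverage_poissonKernel_smul (w := r * ee x) (by rw [mem_ball_zero_iff, norm_ree h0]; linarith)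
    rw [circ_eq] at h4
    rw [← h4, PI_eq hψp]
    have e : ∀ θ, (poissonKernel 0 (r * ee x) • HG v) (R * ee θ) = ((pk (r / R) (x - θ) : ℝ) : ℂ) * HG v (R * ee θ) := by
      intro θ
      rw [Pi.smul_apply', poisson_eq hR0 h0, Complex.real_smul]
    rw [av_congr e, av_re]
    · apply av_congr; intro θ
      rw [Complex.re_ofReal_mul, mul_comm]
    · have := pk_cont (r := r / R) (by positivity) hq1
      fun_prop
  refine (HF_le_HG (HF_re_pos hv hp hv0 (by rw [norm_ree h0]; exact hr1))).trans ?_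
  rw [h3]
  have h5 : 0 ≤ PI (r / R) ψ x := h3 ▸ HG_re _
  gcongr

end AES

namespace AES

/-! ### One dimensional exponential estimate -/

lemma WW_eq {a : ℝ → ℝ} (hp : Function.Periodic a (2 * Real.pi)) (r x : ℝ) :
    WW r (fun u => a (x - u)) = PI r (fun t => a t * PI r a t) x := by
  unfold WW
  rw [PI]
  apply av_congr; intro u
  have h1 : PI r a (x - u) = av (fun u' => a (x - u') * pk r (u - u')) := by
    rw [PI_eq hp]
    have hpp : Function.Periodic (fun t => a t * pk r (x - u - t)) (2 * Real.pi) := by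
      intro t
      simp only
      rw [hp t]
      congr 1
      rw [show x - u - (t + 2 * Real.pi) = (x - u - t) - 2 * Real.pi by ring, (pk_per r).sub_eq]
    rw [← av_sub_left hpp x]
    apply av_congr; intro u'
    rw [show x - u - (x - u') = -(u - u') by ring, pk_neg]
  rw [h1]; ring

lemma center1 {q : ℝ → ℝ} (hq : Continuous q) (hp : Function.Periodic q (2 * Real.pi)) (hq0 : ∀ t, 0 ≤ q t)
    {η : ℝ} (hη : 0 < η) (hqη : av q ≤ η)
    {lam : ℝ} (hl : 0 < lam) {ρ0 : ℝ} (hρ1 : ρ0 < 1) (hρ0 : 0 ≤ ρ0) :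
    ∃ B : Set ℝ, MeasurableSet B ∧ volume (B ∩ Set.Icc (-Real.pi) Real.pi) ≤ ENNReal.ofReal (48 * Real.pi * √(2 * η) / lam) ∧
      ∀ x ∈ Set.Icc (-Real.pi) Real.pi, x ∉ B → ∀ r, 0 ≤ r → r ≤ ρ0 →
        ‖av (fun u => ((q (x - u) + η : ℝ) : ℂ) * hk r u)‖ ≤ (1000 * lam) ^ 2 + η := by
  have hv : Continuous (fun t => q t + η) := by fun_prop
  have hvp : Function.Periodic (fun t => q t + η) (2 * Real.pi) := fun t => by simp only [hp t]
  have hav : av (fun t => q t + η) = av q + η := by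
    rw [av_add hq continuous_const, av_const]
  have hq' : 0 ≤ av q := av_nonneg hq0
  obtain ⟨B, hB, hvol, hx⟩ := center_v hv hvp (fun t => by have := hq0 t; linarith) hl hρ1 hρ0
  refine ⟨B, hB, hvol.trans ?_, ?_⟩
  · apply ENNReal.ofReal_le_ofReal
    gcongr
    rw [hav]; linarith
  · intro x hxm hxB r h0 h1
    have := hx x hxm hxB r h0 h1
    rw [av_hk (v := fun t => q t + η) hv hvp h0 (by linarith), norm_div, hav]
    have h3 : ‖HF (fun t => q t + η) (r * ee x) - ((av q + η : ℝ) : ℂ)‖ ≤ 2 * (1000 * lam) ^ 2 + 2 * η := by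
      refine (norm_sub_le _ _).trans ?_
      rw [Complex.norm_real, Real.norm_of_nonneg (by linarith)]
      linarith
    rw [Complex.norm_ofNat]
    linarith

lemma center2 {g : ℝ → ℂ} (hg : Continuous g) (hp : Function.Periodic g (2 * Real.pi))
    {η : ℝ} (hη : 0 < η) (hgη : av (fun t => ‖g t‖) ≤ η)
    {lam : ℝ} (hl : 0 < lam) {ρ0 : ℝ} (hρ1 : ρ0 < 1) (hρ0 : 0 ≤ ρ0) :
    ∃ B : Set ℝ, MeasurableSet B ∧ volume (B ∩ Set.Icc (-Real.pi) Real.pi) ≤ ENNReal.ofReal (192 * Real.pi * √(2 * η) / lam) ∧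
      ∀ x ∈ Set.Icc (-Real.pi) Real.pi, x ∉ B → ∀ r, 0 ≤ r → r ≤ ρ0 →
        ‖av (fun u => g (x - u) * hk r u)‖ ≤ 4 * ((1000 * lam) ^ 2 + η) := by
  have key : ∀ s : ℂ →L[ℝ] ℝ, (∀ z, |s z| ≤ ‖z‖) → ∃ B : Set ℝ, MeasurableSet B ∧ volume (B ∩ Set.Icc (-Real.pi) Real.pi) ≤ ENNReal.ofReal (48 * Real.pi * √(2 * η) / lam) ∧
      ∀ x ∈ Set.Icc (-Real.pi) Real.pi, x ∉ B → ∀ r, 0 ≤ r → r ≤ ρ0 →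
        ‖av (fun u => ((max (s (g (x - u))) 0 + η : ℝ) : ℂ) * hk r u)‖ ≤ (1000 * lam) ^ 2 + η := by
    intro s hs
    refine center1 (q := fun t => max (s (g t)) 0) (by fun_prop) (fun t => by simp only [hp t]) (fun t => le_max_right _ _) hη ?_ hl hρ1 hρ0
    refine le_trans (av_mono (by fun_prop) (by fun_prop) ?_) hgη
    intro t
    exact max_le ((le_abs_self _).trans (hs _)) (norm_nonneg _)
  obtain ⟨B1, m1, v1, h1⟩ := key Complex.reCLM (fun z => Complex.abs_re_le_norm z)
  obtain ⟨B2, m2, v2, h2⟩ := key (-Complex.reCLM) (fun z => by simpa using Complex.abs_re_le_norm z)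
  obtain ⟨B3, m3, v3, h3⟩ := key Complex.imCLM (fun z => Complex.abs_im_le_norm z)
  obtain ⟨B4, m4, v4, h4⟩ := key (-Complex.imCLM) (fun z => by simpa using Complex.abs_im_le_norm z)
  refine ⟨B1 ∪ B2 ∪ (B3 ∪ B4), (m1.union m2).union (m3.union m4), ?_, ?_⟩
  · rw [show 192 * Real.pi * √(2 * η) / lam = 48 * Real.pi * √(2 * η) / lam + 48 * Real.pi * √(2 * η) / lam
      + (48 * Real.pi * √(2 * η) / lam + 48 * Real.pi * √(2 * η) / lam) by ring]
    have hpi := Real.pi_pos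
    rw [ENNReal.ofReal_add (by positivity) (by positivity), ENNReal.ofReal_add (by positivity) (by positivity)]
    simp only [Set.union_inter_distrib_right]
    refine (measure_union_le _ _).trans (add_le_add ((measure_union_le _ _).trans (add_le_add v1 v2)) ((measure_union_le _ _).trans (add_le_add v3 v4)))
  · intro x hx hxB r hr0 hr1
    simp only [Set.mem_union, not_or] at hxB
    have e1 := h1 x hx hxB.1.1 r hr0 hr1
    have e2 := h2 x hx hxB.1.2 r hr0 hr1
    have e3 := h3 x hx hxB.2.1 r hr0 hr1
    have e4 := h4 x hx hxB.2.2 r hr0 hr1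
    have hk' := hk_cont hr0 (show r < 1 by linarith)
    have hc : ∀ s : ℂ →L[ℝ] ℝ, Continuous (fun u => ((max (s (g (x - u))) 0 + η : ℝ) : ℂ) * hk r u) := by
      intro s; fun_prop
    have hm : ∀ a : ℝ, max a 0 - max (-a) 0 = a := by
      intro a
      rcases le_total 0 a with h | h
      · rw [max_eq_left h, max_eq_right (by linarith)]; ring
      · rw [max_eq_right h, max_eq_left (by linarith)]; ring
    have e : av (fun u => g (x - u) * hk r u) =
        (av (fun u => ((max (Complex.reCLM (g (x - u))) 0 + η : ℝ) : ℂ) * hk r u) - av (fun u => ((max ((-Complex.reCLM) (g (x - u))) 0 + η : ℝ) : ℂ) * hk r u))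
        + Complex.I * (av (fun u => ((max (Complex.imCLM (g (x - u))) 0 + η : ℝ) : ℂ) * hk r u) - av (fun u => ((max ((-Complex.imCLM) (g (x - u))) 0 + η : ℝ) : ℂ) * hk r u)) := by
      rw [← av_sub (hc _) (hc _), ← av_sub (hc _) (hc _), ← av_cmul, ← av_add (by have := (hc Complex.reCLM).sub (hc (-Complex.reCLM)); exact this)
        (by have h1 := hc Complex.imCLM
            have h2 := hc (-Complex.imCLM)
            fun_prop)]
      apply av_congr; intro u
      have q1 := hm (g (x - u)).re
      have q2 := hm (g (x - u)).im
      have q3 : g (x - u) = ((g (x - u)).re : ℂ) + (g (x - u)).im * Complex.I := (Complex.re_add_im _).symm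
      rw [← q1, ← q2] at q3
      conv_lhs => rw [q3]
      simp only [neg_apply, Complex.reCLM_apply, Complex.imCLM_apply]
      push_cast
      ring
    rw [e]
    refine (norm_add_le _ _).trans ?_
    rw [norm_mul, Complex.norm_I, one_mul]
    have t1 := norm_sub_le (av (fun u => ((max (Complex.reCLM (g (x - u))) 0 + η : ℝ) : ℂ) * hk r u)) (av (fun u => ((max ((-Complex.reCLM) (g (x - u))) 0 + η : ℝ) : ℂ) * hk r u))
    have t2 := norm_sub_le (av (fun u => ((max (Complex.imCLM (g (x - u))) 0 + η : ℝ) : ℂ) * hk r u)) (av (fun u => ((max ((-Complex.imCLM) (g (x - u))) 0 + η : ℝ) : ℂ) * hk r u))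
    linarith

set_option maxHeartbeats 1000000 in
theorem one_dim {M ε : ℝ} (hM : 0 < M) (hε : 0 < ε) : ∃ η : ℝ, 0 < η ∧ ∀ K : ℕ, ∀ g : ℝ → ℂ, Continuous g →
    Function.Periodic g (2 * Real.pi) → av (fun t => ‖g t‖) ≤ η →
    ∃ B : Set ℝ, MeasurableSet B ∧ volume (B ∩ Set.Icc (-Real.pi) Real.pi) ≤ ENNReal.ofReal ε ∧
      ∀ x ∈ Set.Icc (-Real.pi) Real.pi, x ∉ B → ∀ k ≤ K,
        ∑ n ∈ Finset.range (2 ^ k), Real.exp (M * ‖Q n g x‖) ≤ 12 * 2 ^ k := by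
  have hpi := Real.pi_pos
  obtain ⟨lam, hlam⟩ : ∃ lam : ℝ, lam = 1 / (10 ^ 7 * (M + 1)) := ⟨_, rfl⟩
  have hl : 0 < lam := by rw [hlam]; positivity
  have hlM : lam * (M + 1) = 1 / 10 ^ 7 := by rw [hlam]; field_simp
  obtain ⟨s, hs⟩ : ∃ s : ℝ, s = min (1 / (16 * (M + 1))) (lam * ε / (240 * Real.pi)) := ⟨_, rfl⟩
  have hs0 : 0 < s := by rw [hs]; positivity
  have hs1 : s * (M + 1) ≤ 1 / 16 := by
    have : s ≤ 1 / (16 * (M + 1)) := by rw [hs]; exact min_le_left _ _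
    calc s * (M + 1) ≤ 1 / (16 * (M + 1)) * (M + 1) := by gcongr
      _ = _ := by field_simp
  have hs2 : s ≤ 1 := by nlinarith
  have hs3 : 240 * Real.pi * s / lam ≤ ε := by
    have : s ≤ lam * ε / (240 * Real.pi) := by rw [hs]; exact min_le_right _ _
    rw [div_le_iff₀ hl]
    rw [le_div_iff₀ (by positivity)] at this
    linarith
  refine ⟨s ^ 2 / 2, by positivity, ?_⟩
  intro K g hg hp hav
  have hsq : √(2 * (s ^ 2 / 2)) = s := by
    rw [show 2 * (s ^ 2 / 2) = s ^ 2 by ring]; exact Real.sqrt_sq hs0.le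
  have h2K : (0:ℝ) < 2 ^ K := by positivity
  have hr : ∀ k : ℕ, (0:ℝ) ≤ 1 - (2 ^ k)⁻¹ ∧ (1:ℝ) - (2 ^ k)⁻¹ < 1 := by
    intro k
    have h1 : (1:ℝ) ≤ 2 ^ k := one_le_pow₀ (by norm_num)
    have := inv_le_one_of_one_le₀ h1
    have : (0:ℝ) < (2 ^ k)⁻¹ := by positivity
    constructor <;> linarith
  obtain ⟨B1, m1, v1, h1⟩ := good_set (a := fun t => ‖g t‖) (by fun_prop) (fun _ => norm_nonneg _) (fun t => by simp only [hp t]) hl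
  obtain ⟨B2, m2, v2, h2⟩ := center2 hg hp (η := s ^ 2 / 2) (by positivity) hav hl (hr K).2 (hr K).1
  refine ⟨B1 ∪ B2, m1.union m2, ?_, ?_⟩
  · rw [Set.union_inter_distrib_right]
    refine (measure_union_le _ _).trans ((add_le_add v1 v2).trans ?_)
    have hav0 : 0 ≤ av (fun t => ‖g t‖) := av_nonneg (fun _ => norm_nonneg _)
    rw [← ENNReal.ofReal_add (by positivity) (by positivity)]
    apply ENNReal.ofReal_le_ofReal
    rw [hsq]
    refine le_trans ?_ hs3
    rw [← add_div]
    gcongr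
    have : av (fun t => ‖g t‖) ≤ s := by nlinarith
    nlinarith
  · intro x hx hxB k hk
    simp only [Set.mem_union, not_or] at hxB
    set c : ℕ → ℕ → ℂ := fun k j => Q (j * 2 ^ k) g x + av (fun u => g (x - u) * (ee u ^ (j * 2 ^ k) * AES.hk (1 - (2 ^ k)⁻¹) u)) with hc
    have J := jn (fun n => Q n g x) c (11 * (1000 * lam)) (by positivity) K ?_ k hk 0
    · have hck : ‖c k 0‖ ≤ 4 * ((1000 * lam) ^ 2 + s ^ 2 / 2) := by
        have : c k 0 = av (fun u => g (x - u) * AES.hk (1 - (2 ^ k)⁻¹) u) := by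
          simp only [hc, zero_mul, pow_zero, one_mul]
          simp [Q, Ker, av]
        rw [this]
        apply h2 x hx hxB.2 _ (hr k).1
        have : (2:ℝ) ^ k ≤ 2 ^ K := pow_le_pow_right₀ (by norm_num) hk
        gcongr
      have hMc : M * ‖c k 0‖ ≤ 1 := by
        have : M * ‖c k 0‖ ≤ M * (4 * ((1000 * lam) ^ 2 + s ^ 2 / 2)) := by gcongr
        have a1 : lam * M ≤ 1 / 10 ^ 7 := by nlinarith
        have a2 : lam ≤ 1 / 10 ^ 7 := by nlinarith
        have a3 : s * M ≤ 1 / 16 := by nlinarith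
        have a4 : lam * M * lam ≤ 1 / 10 ^ 7 * (1 / 10 ^ 7) := by gcongr
        have a5 : s * M * s ≤ 1 / 16 * 1 := by gcongr
        nlinarith
      have hM2 : M ≤ (20 * (11 * (1000 * lam)))⁻¹ := by
        rw [le_inv_comm₀ hM (by positivity)]
        rw [← one_div, le_div_iff₀ hM]
        nlinarith
      unfold blk at J
      simp only [zero_mul, zero_add] at J
      calc _ ≤ ∑ n ∈ Finset.range (2 ^ k), Real.exp 1 * Real.exp ((20 * (11 * (1000 * lam)))⁻¹ * ‖Q n g x - c k 0‖) := by
            apply Finset.sum_le_sum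
            intro n _
            rw [← Real.exp_add]
            apply Real.exp_le_exp.mpr
            have t1 : ‖Q n g x‖ ≤ ‖Q n g x - c k 0‖ + ‖c k 0‖ := by
              simpa using norm_add_le (Q n g x - c k 0) (c k 0)
            calc M * ‖Q n g x‖ ≤ M * (‖Q n g x - c k 0‖ + ‖c k 0‖) := by gcongr
              _ = M * ‖c k 0‖ + M * ‖Q n g x - c k 0‖ := by ring
              _ ≤ _ := by gcongr
        _ = Real.exp 1 * ∑ n ∈ Finset.range (2 ^ k), Real.exp ((20 * (11 * (1000 * lam)))⁻¹ * ‖Q n g x - c k 0‖) := by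
            rw [Finset.mul_sum]
        _ ≤ 3 * (4 * 2 ^ k) := by
            gcongr
            have := Real.exp_one_lt_d9
            linarith
        _ = _ := by ring
    · intro k hk j
      obtain ⟨p1, p2⟩ := h1 x hx hxB.1 (1 - (2 ^ k)⁻¹) (hr k).1 (hr k).2
      have h2k : (0:ℝ) < 2 ^ k := by positivity
      have O := osc0' (g := fun u => g (x - u)) (by fun_prop) (hr k).1 (hr k).2 (L := 2 ^ k)
        (by push_cast; field_simp; ring) (j * 2 ^ k) (D := 1000 * lam) (by positivity) p1
        (by rw [← WW_eq (a := fun t => ‖g t‖) (fun t => by simp only [hp t])] at p2; exact p2)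
      unfold blk
      push_cast at O
      exact O

end AES

namespace AES

/-! ### The L log L estimate for the conjugate function -/

lemma circ_mean {G : ℂ → ℂ} (hG : DifferentiableOn ℂ G (Metric.ball 0 1)) {r : ℝ} (h0 : 0 < r) (h1 : r < 1) :
    av (fun θ => G (r * ee θ)) = G 0 := by
  rw [← circ_eq]
  apply DiffContOnCl.circleAverage
  rw [abs_of_pos h0]
  apply DifferentiableOn.diffContOnCl
  rw [closure_ball _ h0.ne']
  exact hG.mono (Metric.closedBall_subset_ball h1)

lemma circ_cont {G : ℂ → ℂ} (hG : DifferentiableOn ℂ G (Metric.ball 0 1)) {r : ℝ} (h0 : 0 < r) (h1 : r < 1) :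
    Continuous (fun θ => G (r * ee θ)) := by
  have := ee_cont
  apply hG.continuousOn.comp_continuous (by fun_prop)
  intro θ; rw [mem_ball_zero_iff, norm_ree h0.le]; exact h1

lemma av_PI {v : ℝ → ℝ} (hv : Continuous v) (hp : Function.Periodic v (2 * Real.pi)) {r : ℝ} (h0 : 0 < r) (h1 : r < 1) :
    av (PI r v) = av v := by
  have h := circ_mean (HF_diff hv hp) h0 h1
  have h2 := congrArg Complex.re h
  rw [av_re (circ_cont (HF_diff hv hp) h0 h1), HF_zero, Complex.ofReal_re] at h2
  rw [← h2]
  apply av_congr; intro x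
  rw [HF_re hv hp h0.le h1]

lemma av_pk {r : ℝ} (h0 : 0 < r) (h1 : r < 1) : av (pk r) = 1 := by
  have h := av_PI (v := fun _ => 1) continuous_const (fun _ => rfl) h0 h1
  rw [av_const] at h
  have : PI r (fun _ => 1) = fun _ => av (pk r) := by
    funext x; unfold PI; apply av_congr; intro u; ring
  rw [this, av_const] at h
  exact h

lemma tangent {x y : ℝ} (hx : 0 < x) (hy : 0 < y) : x * Real.log x + (Real.log x + 1) * (y - x) ≤ y * Real.log y := by
  have := Real.one_sub_inv_le_log_of_pos (x := y / x) (by positivity)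
  rw [Real.log_div hy.ne' hx.ne', inv_div] at this
  have h2 := mul_le_mul_of_nonneg_left this hy.le
  have : y * (1 - x / y) = y - x := by field_simp
  nlinarith

lemma jensen_PI {v : ℝ → ℝ} (hv : Continuous v) (hv0 : ∀ t, 0 < v t) {r : ℝ} (h0 : 0 < r) (h1 : r < 1) (x : ℝ) :
    PI r v x * Real.log (PI r v x) ≤ PI r (fun t => v t * Real.log (v t)) x := by
  have hu := PI_pos hv hv0 h0.le h1 x
  have hpk := pk_cont h0.le h1
  have hlog : Continuous (fun t => Real.log (v t)) := hv.log (fun t => (hv0 t).ne')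
  set u := PI r v x with hud
  have h2 : av (fun t => (u * Real.log u + (Real.log u + 1) * (v (x - t) - u)) * pk r t) ≤ PI r (fun t => v t * Real.log (v t)) x := by
    unfold PI
    apply av_mono (by fun_prop) (by fun_prop)
    intro t
    exact mul_le_mul_of_nonneg_right (tangent hu (hv0 _)) (pk_pos h0.le h1 t).le
  refine le_trans (le_of_eq ?_) h2
  have h3 : av (fun t => (u * Real.log u + (Real.log u + 1) * (v (x - t) - u)) * pk r t) =
      av (fun t => (u * Real.log u - (Real.log u + 1) * u) * pk r t + (Real.log u + 1) * (v (x - t) * pk r t)) := by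
    apply av_congr; intro t; ring
  rw [h3, av_add (by fun_prop) (by fun_prop), av_cmul, av_cmul, av_pk h0 h1]
  change _ = _ + _ * u
  ring

lemma F_bd {F : ℂ} (h : 0 < F.re) : ‖F‖ ≤ 4 / 3 * (F.re * Real.log F.re - (F * Complex.log F).re) + 8 / 3 * F.re := by
  have hne : F ≠ 0 := by intro h0; rw [h0] at h; simp at h
  have hF : 0 < ‖F‖ := norm_pos_iff.mpr hne
  have hre : F.re ≤ ‖F‖ := Complex.re_le_norm F
  have e1 : (F * Complex.log F).re = F.re * Real.log ‖F‖ - F.im * F.arg := by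
    rw [Complex.mul_re, Complex.log_re, Complex.log_im]
  have e2 : F.im ^ 2 / ‖F‖ ≤ F.im * F.arg := by
    have hs : Real.sin F.arg = F.im / ‖F‖ := Complex.sin_arg F
    have hi : F.im = ‖F‖ * Real.sin F.arg := by rw [hs]; field_simp
    have h3 : Real.sin F.arg ^ 2 ≤ Real.sin F.arg * F.arg := by
      have hb := Complex.abs_arg_lt_pi_div_two_iff.mpr (Or.inl h)
      rw [abs_lt] at hb
      have hpi := Real.pi_pos
      rcases le_total 0 F.arg with h4 | h4
      · have := Real.sin_le h4
        have := Real.sin_nonneg_of_nonneg_of_le_pi h4 (by linarith)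
        nlinarith
      · have := Real.le_sin h4
        have := Real.sin_nonpos_of_nonpos_of_neg_pi_le h4 (by linarith)
        nlinarith
    rw [div_le_iff₀ hF, hi]
    nlinarith [mul_le_mul_of_nonneg_left h3 (mul_nonneg hF.le hF.le)]
  have e3 : ‖F‖ - F.re ≤ F.im ^ 2 / ‖F‖ := by
    rw [le_div_iff₀ hF]
    have : ‖F‖ ^ 2 = F.re ^ 2 + F.im ^ 2 := by
      rw [← Complex.normSq_eq_norm_sq, Complex.normSq_apply]; ring
    nlinarith
  have e4 : F.re * (Real.log ‖F‖ - Real.log F.re) ≤ ‖F‖ / 4 + F.re := by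
    have h5 := Real.log_le_sub_one_of_pos (x := ‖F‖ / F.re / 4) (by positivity)
    rw [Real.log_div (by positivity) (by norm_num), Real.log_div hF.ne' h.ne'] at h5
    have h6 : Real.log 4 ≤ 2 := by
      have : Real.log 4 = 2 * Real.log 2 := by
        rw [show (4:ℝ) = 2 ^ 2 by norm_num, Real.log_pow]; norm_num
      have := Real.log_two_lt_d9
      linarith
    have h7 : Real.log ‖F‖ - Real.log F.re ≤ ‖F‖ / F.re / 4 + 1 := by linarith
    calc _ ≤ F.re * (‖F‖ / F.re / 4 + 1) := by gcongr
      _ = _ := by field_simp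
  rw [e1]
  nlinarith

lemma HF_L1 {v : ℝ → ℝ} (hv : Continuous v) (hp : Function.Periodic v (2 * Real.pi)) (hv0 : ∀ t, 0 < v t)
    {r : ℝ} (h0 : 0 < r) (h1 : r < 1) :
    av (fun x => ‖HF v (r * ee x)‖) ≤ 4 / 3 * (av (fun t => v t * Real.log (v t)) + 1) + 8 / 3 * av v := by
  have hlog : Continuous (fun t => Real.log (v t)) := hv.log (fun t => (hv0 t).ne')
  have hFd := HF_diff hv hp
  have hLd : DifferentiableOn ℂ (fun w => HF v w * Complex.log (HF v w)) (Metric.ball 0 1) := by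
    apply hFd.mul
    apply hFd.clog
    intro w hw
    exact Or.inl (HF_re_pos hv hp hv0 (by simpa using hw))
  have hFc := circ_cont hFd h0 h1
  have hLc := circ_cont hLd h0 h1
  have hPc := PI_cont hv h0.le h1
  have hPp := PI_pos hv hv0 h0.le h1
  have hPl : Continuous (fun t => Real.log (PI r v t)) := hPc.log (fun t => (hPp t).ne')
  have hvl : Continuous (fun t => v t * Real.log (v t)) := by fun_prop
  have hvlp : Function.Periodic (fun t => v t * Real.log (v t)) (2 * Real.pi) := fun t => by simp only [hp t]
  have hLre : Continuous (fun x => (HF v (r * ee x) * Complex.log (HF v (r * ee x))).re) := Complex.continuous_re.comp hLc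
  have hPlc := PI_cont hvl h0.le h1
  have hpos' : 0 < av v := by
    have := HF_re_pos hv hp hv0 (w := 0) (by simp)
    rw [HF_zero] at this; simpa using this
  have hm : av (fun x => (HF v (r * ee x) * Complex.log (HF v (r * ee x))).re) = av v * Real.log (av v) := by
    rw [← av_re hLc, circ_mean hLd h0 h1, HF_zero, ← Complex.ofReal_log hpos'.le, ← Complex.ofReal_mul, Complex.ofReal_re]
  have step : av (fun x => ‖HF v (r * ee x)‖) ≤
      av (fun x => 4 / 3 * (PI r (fun t => v t * Real.log (v t)) x - (HF v (r * ee x) * Complex.log (HF v (r * ee x))).re) + 8 / 3 * PI r v x) := by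
    apply av_mono (by fun_prop) (by fun_prop)
    intro x
    have := F_bd (HF_re_pos hv hp hv0 (w := r * ee x) (by rw [norm_ree h0.le]; exact h1))
    rw [HF_re hv hp h0.le h1] at this
    have j := jensen_PI hv hv0 h0 h1 x
    linarith
  refine step.trans ?_
  rw [av_add (by fun_prop) (by fun_prop), av_cmul, av_cmul, av_sub hPlc hLre, hm]
  have a1 : av (fun x => PI r v x) = av v := av_PI hv hp h0 h1
  have a2 : av (fun x => PI r (fun t => v t * Real.log (v t)) x) = av (fun t => v t * Real.log (v t)) := av_PI hvl hvlp h0 h1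
  rw [a1, a2]
  have := tangent (x := 1) one_pos hpos'
  simp at this
  linarith

def Psi (y : ℝ) : ℝ := (y + 1) * Real.log (y + 1)

lemma Psi_nonneg {y : ℝ} (h : 0 ≤ y) : 0 ≤ Psi y := mul_nonneg (by linarith) (Real.log_nonneg (by linarith))

lemma le_Psi {y : ℝ} (h : 0 ≤ y) : y ≤ Psi y := by
  have := tangent (x := 1) (y := y + 1) one_pos (by linarith)
  simp at this
  exact this

lemma Psi_mono {x y : ℝ} (h : 0 ≤ x) (hxy : x ≤ y) : Psi x ≤ Psi y := by
  unfold Psi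
  have := Real.log_nonneg (show 1 ≤ x + 1 by linarith)
  have := Real.log_le_log (show 0 < x + 1 by linarith) (show x + 1 ≤ y + 1 by linarith)
  apply mul_le_mul <;> linarith

lemma Psi_le {y : ℝ} (h : 0 ≤ y) : Psi y ≤ y ^ 2 + y := by
  have := Real.log_le_sub_one_of_pos (show 0 < y + 1 by linarith)
  unfold Psi; nlinarith

lemma Psi_cont {X : Type*} [TopologicalSpace X] {a : X → ℝ} (ha : Continuous a) (h0 : ∀ x, 0 ≤ a x) : Continuous (fun x => Psi (a x)) := by
  unfold Psi
  exact (by fun_prop : Continuous fun x => a x + 1).mul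
    ((by fun_prop : Continuous fun x => a x + 1).log (fun x => by have := h0 x; linarith))

/-- the truncated Hilbert type operator -/
def CP (r : ℝ) (g : ℝ → ℂ) (x : ℝ) : ℂ := av (fun u => g (x - u) * (hk r u - (starRingEnd ℂ) (hk r u)))

lemma CP_v {v : ℝ → ℝ} (hv : Continuous v) (hp : Function.Periodic v (2 * Real.pi)) {r : ℝ} (h0 : 0 ≤ r) (h1 : r < 1) (x : ℝ) :
    ‖CP r (fun t => (v t : ℂ)) x‖ ≤ ‖HF v (r * ee x)‖ := by
  have hkc := hk_cont h0 h1
  have hkc' : Continuous (fun u => (starRingEnd ℂ) (hk r u)) := Complex.continuous_conj.comp hkc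
  have e : CP r (fun t => (v t : ℂ)) x = av (fun u => (v (x - u) : ℂ) * hk r u) - (starRingEnd ℂ) (av (fun u => (v (x - u) : ℂ) * hk r u)) := by
    rw [← av_conj, ← av_sub (by fun_prop) (by simp only [map_mul, Complex.conj_ofReal]; fun_prop)]
    unfold CP
    apply av_congr; intro u
    rw [map_mul, Complex.conj_ofReal]; ring
  rw [e, av_hk hv hp h0 h1, Complex.sub_conj, norm_mul, Complex.norm_I, mul_one, Complex.norm_real, Real.norm_eq_abs]
  have : 2 * ((HF v (r * ee x) - ((av v : ℝ) : ℂ)) / 2).im = (HF v (r * ee x)).im := by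
    have h2 : ((HF v (r * ee x) - ((av v : ℝ) : ℂ)) / 2) = ((1 / 2 : ℝ) : ℂ) * (HF v (r * ee x) - ((av v : ℝ) : ℂ)) := by push_cast; ring
    rw [h2, Complex.im_ofReal_mul, Complex.sub_im, Complex.ofReal_im]
    ring
  rw [this]
  exact Complex.abs_im_le_norm _

lemma CP_cont {g : ℝ → ℂ} (hg : Continuous g) {r : ℝ} (h0 : 0 ≤ r) (h1 : r < 1) : Continuous (CP r g) := by
  have hkc := hk_cont h0 h1
  have hkc' : Continuous (fun u => (starRingEnd ℂ) (hk r u)) := Complex.continuous_conj.comp hkc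
  exact av_cont (F := fun x u => g (x - u) * (hk r u - (starRingEnd ℂ) (hk r u))) (by unfold Function.uncurry; fun_prop)

lemma CP_L1 {g : ℝ → ℂ} (hg : Continuous g) (hp : Function.Periodic g (2 * Real.pi)) {r : ℝ} (h0 : 0 < r) (h1 : r < 1) :
    av (fun x => ‖CP r g x‖) ≤ 16 * (av (fun t => Psi ‖g t‖) + 1) := by
  have hkc := hk_cont h0.le h1
  have hkc' : Continuous (fun u => (starRingEnd ℂ) (hk r u)) := Complex.continuous_conj.comp hkc
  set q : (ℂ →L[ℝ] ℝ) → ℝ → ℝ := fun s t => max (s (g t)) 0 + 1 with hq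
  have hqc : ∀ s, Continuous (q s) := by intro s; simp only [hq]; fun_prop
  have hPsi := Psi_cont (a := fun t => ‖g t‖) (by fun_prop) (fun t => norm_nonneg _)
  have key : ∀ s : ℂ →L[ℝ] ℝ, (∀ z, |s z| ≤ ‖z‖) → av (fun x => ‖CP r (fun t => (q s t : ℂ)) x‖) ≤ 4 * (av (fun t => Psi ‖g t‖) + 1) := by
    intro s hs
    have hqp : Function.Periodic (q s) (2 * Real.pi) := by intro t; simp only [hq, hp t]
    have hq0 : ∀ t, 0 < q s t := by
      intro t; simp only [hq]; have := le_max_right (s (g t)) 0; linarith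
    have hqlog : Continuous (fun t => Real.log (q s t)) := (hqc s).log (fun t => (hq0 t).ne')
    have hle : ∀ t, max (s (g t)) 0 ≤ ‖g t‖ := fun t => max_le ((le_abs_self _).trans (hs _)) (norm_nonneg _)
    calc _ ≤ av (fun x => ‖HF (q s) (r * ee x)‖) := by
          apply av_mono
          · have := CP_cont (g := fun t => (q s t : ℂ)) (by have := hqc s; fun_prop) h0.le h1
            fun_prop
          · have := circ_cont (HF_diff (hqc s) hqp) h0 h1
            fun_prop
          · intro x; exact CP_v (hqc s) hqp h0.le h1 x
      _ ≤ _ := HF_L1 (hqc s) hqp hq0 h0 h1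
      _ ≤ 4 / 3 * (av (fun t => Psi ‖g t‖) + 1) + 8 / 3 * (av (fun t => Psi ‖g t‖) + 1) := by
          have b1 : av (fun t => q s t * Real.log (q s t)) ≤ av (fun t => Psi ‖g t‖) := by
            apply av_mono (by have := hqc s; fun_prop) hPsi
            intro t
            exact Psi_mono (le_max_right _ _) (hle t)
          have b2 : av (q s) ≤ av (fun t => Psi ‖g t‖) + 1 := by
            rw [← av_const (1:ℝ), ← av_add hPsi continuous_const]
            apply av_mono (hqc s) (by fun_prop)
            intro t
            simp only [hq]
            have := le_Psi (norm_nonneg (g t))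
            have := hle t
            linarith
          linarith
      _ = _ := by ring
  have k1 := key Complex.reCLM (fun z => Complex.abs_re_le_norm z)
  have k2 := key (-Complex.reCLM) (fun z => by simpa using Complex.abs_re_le_norm z)
  have k3 := key Complex.imCLM (fun z => Complex.abs_im_le_norm z)
  have k4 := key (-Complex.imCLM) (fun z => by simpa using Complex.abs_im_le_norm z)
  have hcc : ∀ s, Continuous (fun x => ‖CP r (fun t => (q s t : ℂ)) x‖) := by
    intro s
    have := CP_cont (g := fun t => (q s t : ℂ)) (by have := hqc s; fun_prop) h0.le h1
    fun_prop
  have hm : ∀ a : ℝ, max a 0 - max (-a) 0 = a := by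
    intro a
    rcases le_total 0 a with h | h
    · rw [max_eq_left h, max_eq_right (by linarith)]; ring
    · rw [max_eq_right h, max_eq_left (by linarith)]; ring
  have hc : ∀ s x, Continuous (fun u => (q s (x - u) : ℂ) * (hk r u - (starRingEnd ℂ) (hk r u))) := by
    intro s x; have := hqc s; fun_prop
  have e : ∀ x, CP r g x = (CP r (fun t => (q Complex.reCLM t : ℂ)) x - CP r (fun t => (q (-Complex.reCLM) t : ℂ)) x)
        + Complex.I * (CP r (fun t => (q Complex.imCLM t : ℂ)) x - CP r (fun t => (q (-Complex.imCLM) t : ℂ)) x) := by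
    intro x
    unfold CP
    rw [← av_sub (hc _ _) (hc _ _), ← av_sub (hc _ _) (hc _ _), ← av_cmul,
      ← av_add (by have := (hc Complex.reCLM x).sub (hc (-Complex.reCLM) x); exact this)
        (by have h1 := hc Complex.imCLM x
            have h2 := hc (-Complex.imCLM) x
            fun_prop)]
    apply av_congr; intro u
    have q1 := hm (g (x - u)).re
    have q2 := hm (g (x - u)).im
    have q3 : g (x - u) = ((g (x - u)).re : ℂ) + (g (x - u)).im * Complex.I := (Complex.re_add_im _).symm
    rw [← q1, ← q2] at q3
    conv_lhs => rw [q3]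
    simp only [hq, neg_apply, Complex.reCLM_apply, Complex.imCLM_apply]
    push_cast
    ring
  have hb : ∀ x, ‖CP r g x‖ ≤ (‖CP r (fun t => (q Complex.reCLM t : ℂ)) x‖ + ‖CP r (fun t => (q (-Complex.reCLM) t : ℂ)) x‖)
        + (‖CP r (fun t => (q Complex.imCLM t : ℂ)) x‖ + ‖CP r (fun t => (q (-Complex.imCLM) t : ℂ)) x‖) := by
    intro x
    rw [e x]
    refine (norm_add_le _ _).trans ?_
    rw [norm_mul, Complex.norm_I, one_mul]
    exact add_le_add (norm_sub_le _ _) (norm_sub_le _ _)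
  have h1' := hcc Complex.reCLM
  have h2' := hcc (-Complex.reCLM)
  have h3' := hcc Complex.imCLM
  have h4' := hcc (-Complex.imCLM)
  have hg' := CP_cont hg h0.le h1
  refine (av_mono (by fun_prop) (by fun_prop) hb).trans ?_
  rw [av_add (by fun_prop) (by fun_prop), av_add h1' h2', av_add h3' h4']
  linarith

end AES

namespace AES

/-! ### Trigonometric polynomials -/

lemma ee_int_per (k : ℤ) (x : ℝ) : ee (k * (x + 2 * Real.pi)) = ee (k * x) := by
  rw [mul_add, ee_add]
  have : ee (k * (2 * Real.pi)) = 1 := by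
    unfold ee
    rw [Complex.exp_eq_one_iff]
    exact ⟨k, by push_cast; ring⟩
  rw [this, mul_one]

lemma av_ee (k : ℤ) : av (fun u => ee (k * u)) = if k = 0 then 1 else 0 := by
  split_ifs with h
  · rw [h]; simp only [Int.cast_zero, zero_mul, ee_zero]; exact av_const 1
  · unfold av ee
    have hk : (k : ℂ) * Complex.I ≠ 0 := mul_ne_zero (by exact_mod_cast h) Complex.I_ne_zero
    have e : (fun u : ℝ => Complex.exp (((k * u : ℝ) : ℂ) * Complex.I)) = fun u : ℝ => Complex.exp ((k * Complex.I) * u) := by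
      funext u; congr 1; push_cast; ring
    rw [e, integral_exp_mul_complex hk]
    have : Complex.exp (k * Complex.I * (Real.pi : ℝ)) = Complex.exp (k * Complex.I * ((-Real.pi : ℝ) : ℂ)) := by
      rw [Complex.exp_eq_exp_iff_exists_int]
      exact ⟨k, by push_cast; ring⟩
    rw [this, sub_self, zero_div, smul_zero]

lemma hk_expand {r : ℝ} (h0 : 0 ≤ r) (h1 : r < 1) (N : ℕ) (u : ℝ) :
    hk r u = ∑ m ∈ Finset.range N, (r : ℂ) ^ (m + 1) * ee u ^ (m + 1) + (r : ℂ) ^ N * (ee u ^ N * hk r u) := by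
  have hd := den_ne h0 h1 u
  induction N with
  | zero => simp
  | succ N ih =>
    rw [Finset.sum_range_succ]
    conv_lhs => rw [ih]
    have : hk r u = r * ee u + r * ee u * hk r u := by
      unfold hk; field_simp; ring
    conv_lhs => rw [this]
    ring

lemma av_ee_mul_hk (j : ℤ) {r : ℝ} (h0 : 0 ≤ r) (h1 : r < 1) :
    av (fun u => ee (-(j * u)) * hk r u) = if 0 < j then (r : ℂ) ^ j.natAbs else 0 := by
  have hkc := hk_cont h0 h1
  have hee := ee_cont
  have key : ∀ N : ℕ, j.natAbs ≤ N → av (fun u => ee (-(j * u)) * hk r u) = (if 0 < j then (r : ℂ) ^ j.natAbs else 0)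
      + (r : ℂ) ^ N * av (fun u => ee (-(j * u)) * (ee u ^ N * hk r u)) := by
    intro N hN
    have e : ∀ u, ee (-(j * u)) * hk r u = ∑ m ∈ Finset.range N, (r : ℂ) ^ (m + 1) * ee (((m + 1 : ℕ) - j : ℤ) * u) + (r : ℂ) ^ N * (ee (-(j * u)) * (ee u ^ N * hk r u)) := by
      intro u
      conv_lhs => rw [hk_expand h0 h1 N u]
      rw [mul_add, Finset.mul_sum]
      congr 1
      · apply Finset.sum_congr rfl
        intro m _
        rw [ee_pow, show (((m + 1 : ℕ) - j : ℤ) : ℝ) * u = -(j * u) + ((m + 1 : ℕ) : ℝ) * u by push_cast; ring, ee_add]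
        ring
      · ring
    rw [av_congr e, av_add (by fun_prop) (by fun_prop), av_cmul, av_sum _ (by intro m _; fun_prop)]
    congr 1
    have e2 : ∀ m ∈ Finset.range N, av (fun u => (r : ℂ) ^ (m + 1) * ee (((m + 1 : ℕ) - j : ℤ) * u)) =
        if ((m + 1 : ℕ) : ℤ) = j then (r : ℂ) ^ (m + 1) else 0 := by
      intro m _
      rw [av_cmul, av_ee]
      by_cases h : ((m + 1 : ℕ) : ℤ) = j
      · rw [if_pos h, if_pos (by omega), mul_one]
      · rw [if_neg h, if_neg (by omega), mul_zero]
    rw [Finset.sum_congr rfl e2]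
    split_ifs with hj
    · rw [Finset.sum_eq_single (j.natAbs - 1)]
      · rw [if_pos (by omega)]; congr 1; omega
      · intro m _ hm; rw [if_neg (by omega)]
      · intro h; simp only [Finset.mem_range] at h; omega
    · apply Finset.sum_eq_zero
      intro m _; rw [if_neg (by omega)]
  set C := av (fun u => ‖hk r u‖) with hC
  set X := av (fun u => ee (-(j * u)) * hk r u) - (if 0 < j then (r : ℂ) ^ j.natAbs else 0) with hX
  have hle : ∀ N : ℕ, j.natAbs ≤ N → ‖X‖ ≤ r ^ N * C := by
    intro N hN
    have : X = (r : ℂ) ^ N * av (fun u => ee (-(j * u)) * (ee u ^ N * hk r u)) := by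
      rw [hX, key N hN]; ring
    rw [this, norm_mul, norm_pow, Complex.norm_real, Real.norm_of_nonneg h0]
    gcongr
    refine (norm_av_le _).trans (le_of_eq ?_)
    apply av_congr; intro u
    rw [norm_mul, norm_mul, norm_pow, norm_ee, norm_ee]; ring
  have hlim : Tendsto (fun N : ℕ => r ^ N * C) atTop (nhds 0) := by
    simpa using (tendsto_pow_atTop_nhds_zero_of_lt_one h0 h1).mul_const C
  have : ‖X‖ ≤ 0 := ge_of_tendsto hlim (eventually_atTop.mpr ⟨j.natAbs, fun N hN => hle N hN⟩)
  have hX0 : X = 0 := norm_le_zero_iff.mp this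
  rw [hX] at hX0
  exact sub_eq_zero.mp hX0

lemma CP_ee (j : ℤ) {r : ℝ} (h0 : 0 ≤ r) (h1 : r < 1) (x : ℝ) :
    av (fun u => ee (j * (x - u)) * (hk r u - (starRingEnd ℂ) (hk r u))) = (j.sign : ℂ) * (r : ℂ) ^ j.natAbs * ee (j * x) := by
  have hkc := hk_cont h0 h1
  have hkc' : Continuous (fun u => (starRingEnd ℂ) (hk r u)) := Complex.continuous_conj.comp hkc
  have hee := ee_cont
  have e : ∀ u, ee (j * (x - u)) * (hk r u - (starRingEnd ℂ) (hk r u)) =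
      ee (j * x) * (ee (-(j * u)) * hk r u - (starRingEnd ℂ) (ee (-((-j : ℤ) * u)) * hk r u)) := by
    intro u
    rw [show (j:ℝ) * (x - u) = j * x + -(j * u) by ring, ee_add, map_mul, ee_conj]
    push_cast
    rw [show - -(-(j:ℝ) * u) = -(j * u) by ring]
    ring
  have hcj : Continuous (fun u => (starRingEnd ℂ) (ee (-((-j : ℤ) * u)) * hk r u)) :=
    Complex.continuous_conj.comp (by fun_prop)
  rw [av_congr e, av_cmul, av_sub (by fun_prop) hcj, av_conj, av_ee_mul_hk j h0 h1, av_ee_mul_hk (-j) h0 h1]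
  rcases lt_trichotomy j 0 with h | h | h
  · rw [if_neg (by omega), if_pos (by omega), Int.sign_eq_neg_one_of_neg h, Int.natAbs_neg, map_pow, Complex.conj_ofReal]
    push_cast; ring
  · subst h; simp
  · rw [if_pos h, if_neg (by omega), Int.sign_eq_one_of_pos h]
    push_cast; simp; ring

lemma Q_ee (j : ℤ) (n : ℕ) (x : ℝ) :
    av (fun u => ee (j * (x - u)) * Ker n u) = if 1 ≤ j ∧ j ≤ n then ee (j * x) else 0 := by
  have hee := ee_cont
  have e : ∀ u, ee (j * (x - u)) * Ker n u = ∑ m ∈ Finset.range n, ee (j * x) * ee (((m + 1 : ℕ) - j : ℤ) * u) := by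
    intro u
    unfold Ker
    rw [Finset.mul_sum]
    apply Finset.sum_congr rfl
    intro m _
    rw [ee_pow, ← ee_add, ← ee_add]
    congr 1; push_cast; ring
  rw [av_congr e, av_sum _ (by intro m _; fun_prop)]
  have e2 : ∀ m ∈ Finset.range n, av (fun u => ee (j * x) * ee (((m + 1 : ℕ) - j : ℤ) * u)) =
        if ((m + 1 : ℕ) : ℤ) = j then ee (j * x) else 0 := by
    intro m _
    rw [av_cmul, av_ee]
    by_cases h : ((m + 1 : ℕ) : ℤ) = j
    · rw [if_pos h, if_pos (by omega), mul_one]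
    · rw [if_neg h, if_neg (by omega), mul_zero]
  rw [Finset.sum_congr rfl e2]
  split_ifs with hj
  · rw [Finset.sum_eq_single (j.natAbs - 1)]
    · rw [if_pos (by omega)]
    · intro m _ hm; rw [if_neg (by omega)]
    · intro h; simp only [Finset.mem_range] at h; omega
  · apply Finset.sum_eq_zero
    intro m hm
    simp only [Finset.mem_range] at hm
    rw [if_neg (by omega)]

/-- conjugation of a one dimensional trigonometric polynomial is bounded from `L log L` to `L¹` -/
lemma conj_L1 {ι : Type*} (s : Finset ι) (c : ι → ℂ) (n : ι → ℤ) :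
    av (fun x => ‖∑ i ∈ s, ((n i).sign : ℂ) * c i * ee (n i * x)‖) ≤ 16 * (av (fun t => Psi ‖∑ i ∈ s, c i * ee (n i * t)‖) + 1) := by
  have hee := ee_cont
  set g : ℝ → ℂ := fun t => ∑ i ∈ s, c i * ee (n i * t) with hg
  have hgc : Continuous g := by simp only [hg]; fun_prop
  have hgp : Function.Periodic g (2 * Real.pi) := by
    intro t; simp only [hg, ee_int_per]
  have e : ∀ r : ℝ, 0 < r → r < 1 → ∀ x, CP r g x = ∑ i ∈ s, ((n i).sign : ℂ) * c i * (r : ℂ) ^ (n i).natAbs * ee (n i * x) := by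
    intro r h0 h1 x
    have hkc := hk_cont h0.le h1
    have hkc' : Continuous (fun u => (starRingEnd ℂ) (hk r u)) := Complex.continuous_conj.comp hkc
    unfold CP
    have e1 : ∀ u, g (x - u) * (hk r u - (starRingEnd ℂ) (hk r u)) = ∑ i ∈ s, c i * (ee (n i * (x - u)) * (hk r u - (starRingEnd ℂ) (hk r u))) := by
      intro u
      simp only [hg]
      rw [Finset.sum_mul]
      apply Finset.sum_congr rfl; intro i _; ring
    rw [av_congr e1, av_sum _ (by intro i _; fun_prop)]
    apply Finset.sum_congr rfl; intro i _
    rw [av_cmul, CP_ee _ h0.le h1]; ring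
  have hcont : Continuous (fun r : ℝ => av (fun x => ‖∑ i ∈ s, ((n i).sign : ℂ) * c i * (r : ℂ) ^ (n i).natAbs * ee (n i * x)‖)) :=
    av_cont (F := fun (r : ℝ) x => ‖∑ i ∈ s, ((n i).sign : ℂ) * c i * (r : ℂ) ^ (n i).natAbs * ee (n i * x)‖) (by unfold Function.uncurry; fun_prop)
  have hlim := (hcont.tendsto 1).mono_left (nhdsWithin_le_nhds (s := Set.Iio 1))
  simp only [Complex.ofReal_one, one_pow, mul_one] at hlim
  refine le_of_tendsto hlim ?_
  have : ∀ᶠ r : ℝ in nhdsWithin 1 (Set.Iio 1), r ∈ Set.Ioo (0:ℝ) 1 := Ioo_mem_nhdsLT one_pos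
  filter_upwards [this] with r hr
  have := CP_L1 hgc hgp hr.1 hr.2
  rw [av_congr (fun x => by rw [e r hr.1 hr.2 x])] at this
  exact this

def TT (s : Finset (ℤ × ℤ)) (c : ℤ × ℤ → ℂ) (x y : ℝ) : ℂ := ∑ q ∈ s, c q * ee (q.1 * x + q.2 * y)

lemma TT_cont (s c) : Continuous (fun p : ℝ × ℝ => TT s c p.1 p.2) := by
  have hee := ee_cont
  unfold TT; fun_prop

lemma TT_perx (s c) (y : ℝ) : Function.Periodic (fun x => TT s c x y) (2 * Real.pi) := by
  intro x; simp only [TT, ee_add, ee_int_per]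

lemma TT_pery (s c) (x : ℝ) : Function.Periodic (fun y => TT s c x y) (2 * Real.pi) := by
  intro y; simp only [TT, ee_add, ee_int_per]

lemma skew {F : ℝ → ℝ → ℝ} (hF : Continuous (fun p : ℝ × ℝ => F p.1 p.2)) (hp : ∀ x, Function.Periodic (F x) (2 * Real.pi)) (e : ℤ) :
    av (fun y => av (fun t => F t (y + e * t))) = av (fun x => av (fun y => F x y)) := by
  rw [av_swap (F := fun y t => F t (y + e * t)) (by
    have : Continuous (fun p : ℝ × ℝ => (p.2, p.1 + e * p.2)) := by fun_prop
    exact hF.comp this)]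
  apply av_congr; intro t
  exact av_shift (hp t) (e * t)

lemma skew_cont {F : ℝ → ℝ → ℝ} (hF : Continuous (fun p : ℝ × ℝ => F p.1 p.2)) (e : ℤ) :
    Continuous (fun y => av (fun t => F t (y + e * t))) := by
  refine av_cont (F := fun y t => F t (y + e * t)) ?_
  have : Continuous (fun p : ℝ × ℝ => (p.2, p.1 + e * p.2)) := by fun_prop
  exact hF.comp this

lemma av_mono2 {F G : ℝ → ℝ → ℝ} (hF : Continuous (fun p : ℝ × ℝ => F p.1 p.2)) (hG : Continuous (fun p : ℝ × ℝ => G p.1 p.2)) (h : ∀ x y, F x y ≤ G x y) :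
    av (fun x => av (fun y => F x y)) ≤ av (fun x => av (fun y => G x y)) := by
  apply av_mono (av_cont (F := F) hF) (av_cont (F := G) hG)
  intro x
  exact av_mono (hF.comp (by fun_prop : Continuous fun y : ℝ => (x, y))) (hG.comp (by fun_prop : Continuous fun y : ℝ => (x, y))) (h x)

/-- multiply coefficients by `sgn (m + e k)` -/
def sgc (e : ℤ) (c : ℤ × ℤ → ℂ) : ℤ × ℤ → ℂ := fun q => ((q.1 + e * q.2).sign : ℂ) * c q

lemma conj_L1_2 (s : Finset (ℤ × ℤ)) (c : ℤ × ℤ → ℂ) (e : ℤ) {K : ℝ} (hK : 0 < K) :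
    av (fun x => av (fun y => ‖TT s (sgc e c) x y‖)) ≤
      16 / K * (av (fun x => av (fun y => Psi (K * ‖TT s c x y‖))) + 1) := by
  have hee := ee_cont
  have c1 : Continuous (fun p : ℝ × ℝ => ‖TT s (sgc e c) p.1 p.2‖) := (TT_cont _ _).norm
  have c2 : Continuous (fun p : ℝ × ℝ => Psi (K * ‖TT s c p.1 p.2‖)) :=
    Psi_cont (by have := TT_cont s c; fun_prop) (fun p => by positivity)
  have p1 : ∀ x, Function.Periodic (fun y => ‖TT s (sgc e c) x y‖) (2 * Real.pi) := by
    intro x y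
    have := TT_pery s (sgc e c) x y
    simp only at this
    simp only [this]
  have p2 : ∀ x, Function.Periodic (fun y => Psi (K * ‖TT s c x y‖)) (2 * Real.pi) := by
    intro x y
    have := TT_pery s c x y
    simp only at this
    simp only [this]
  have s1 := skew (F := fun x y => ‖TT s (sgc e c) x y‖) c1 p1 e
  have s2 := skew (F := fun x y => Psi (K * ‖TT s c x y‖)) c2 p2 e
  rw [← s1, ← s2]
  have a1 := skew_cont (F := fun x y => ‖TT s (sgc e c) x y‖) c1 e
  have a2 := skew_cont (F := fun x y => Psi (K * ‖TT s c x y‖)) c2 e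
  have hpt : ∀ y, av (fun t => ‖TT s (sgc e c) t (y + e * t)‖) ≤
      16 / K * (av (fun t => Psi (K * ‖TT s c t (y + e * t)‖)) + 1) := by
    intro y
    have h := conj_L1 s (fun q => K * (c q * ee (q.2 * y))) (fun q => q.1 + e * q.2)
    have f1 : ∀ t, ‖∑ q ∈ s, ((q.1 + e * q.2).sign : ℂ) * (K * (c q * ee (q.2 * y))) * ee (((q.1 + e * q.2 : ℤ) : ℝ) * t)‖
        = K * ‖TT s (sgc e c) t (y + e * t)‖ := by
      intro t
      have : ∑ q ∈ s, ((q.1 + e * q.2).sign : ℂ) * (K * (c q * ee (q.2 * y))) * ee (((q.1 + e * q.2 : ℤ) : ℝ) * t)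
        = K * TT s (sgc e c) t (y + e * t) := by
        unfold TT sgc
        rw [Finset.mul_sum]
        apply Finset.sum_congr rfl; intro q _
        rw [show (q.1:ℝ) * t + q.2 * (y + e * t) = q.2 * y + ((q.1 + e * q.2 : ℤ) : ℝ) * t by push_cast; ring, ee_add]
        ring
      rw [this, norm_mul, Complex.norm_real, Real.norm_of_nonneg hK.le]
    have f2 : ∀ t, ‖∑ q ∈ s, (K * (c q * ee (q.2 * y))) * ee (((q.1 + e * q.2 : ℤ) : ℝ) * t)‖
        = K * ‖TT s c t (y + e * t)‖ := by
      intro t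
      have : ∑ q ∈ s, (K * (c q * ee (q.2 * y))) * ee (((q.1 + e * q.2 : ℤ) : ℝ) * t)
        = K * TT s c t (y + e * t) := by
        unfold TT
        rw [Finset.mul_sum]
        apply Finset.sum_congr rfl; intro q _
        rw [show (q.1:ℝ) * t + q.2 * (y + e * t) = q.2 * y + ((q.1 + e * q.2 : ℤ) : ℝ) * t by push_cast; ring, ee_add]
        ring
      rw [this, norm_mul, Complex.norm_real, Real.norm_of_nonneg hK.le]
    simp only [f1, f2] at h
    rw [av_cmul] at h
    rw [div_mul_eq_mul_div, le_div_iff₀ hK, mul_comm]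
    exact h
  have gen : ∀ (P R : ℝ → ℝ), Continuous P → Continuous R → (∀ y, P y ≤ 16 / K * (R y + 1)) → av P ≤ 16 / K * (av R + 1) := by
    intro P R hP hR h
    refine (av_mono hP (by fun_prop) h).trans (le_of_eq ?_)
    rw [av_cmul, av_add hR continuous_const, av_const]
  exact gen (fun y => av (fun t => ‖TT s (sgc e c) t (y + e * t)‖)) (fun y => av (fun t => Psi (K * ‖TT s c t (y + e * t)‖))) a1 a2 hpt

end AES

namespace AES

/-! ### Two dimensional lifting -/

lemma T1_meas : MeasurableSet T1 := measurableSet_Ico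

lemma T2_meas : MeasurableSet T2 := T1_meas.prod T1_meas

lemma lint_av {φ : ℝ → ℝ} (hφ : Continuous φ) (h0 : ∀ t, 0 ≤ φ t) :
    ∫⁻ y in T1, ENNReal.ofReal (φ y) = ENNReal.ofReal (2 * Real.pi * av φ) := by
  have hpi := Real.pi_pos
  have hi : IntegrableOn φ T1 := (hφ.continuousOn.integrableOn_compact isCompact_Icc).mono_set Set.Ico_subset_Icc_self
  rw [← ofReal_integral_eq_lintegral_ofReal hi (ae_of_all _ h0)]
  congr 1
  unfold av T1
  rw [integral_Ico_eq_integral_Ioc, ← intervalIntegral.integral_of_le pi_le, smul_eq_mul]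
  field_simp

/-- exceptional sets -/
def Bd (M C : ℝ) (K : ℕ) (u : ℕ → ℝ × ℝ → ℝ) : Set (ℝ × ℝ) :=
  {p | p ∈ T2 ∧ ∃ k ≤ K, C * 2 ^ k < ∑ n ∈ Finset.range (2 ^ k), Real.exp (M * u n p)}

lemma Bd_meas (M C : ℝ) (K : ℕ) {u : ℕ → ℝ × ℝ → ℝ} (hu : ∀ n, Continuous (u n)) : MeasurableSet (Bd M C K u) := by
  have : Bd M C K u = T2 ∩ ⋃ k ∈ Finset.range (K + 1), {p | C * 2 ^ k < ∑ n ∈ Finset.range (2 ^ k), Real.exp (M * u n p)} := by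
    ext p
    simp only [Bd, Set.mem_ofPred_eq, Set.mem_inter_iff, Set.mem_iUnion, Finset.mem_range, Nat.lt_succ_iff, exists_prop]
  rw [this]
  refine T2_meas.inter (Finset.measurableSet_biUnion _ ?_)
  intro k _
  exact (isOpen_lt continuous_const (by fun_prop)).measurableSet

lemma Qx_cont {g : ℝ → ℝ → ℂ} (hg : Continuous (fun p : ℝ × ℝ => g p.1 p.2)) (n : ℕ) :
    Continuous (fun p : ℝ × ℝ => ‖Q n (fun x => g x p.2) p.1‖) := by
  refine Continuous.norm ?_
  unfold Q
  refine av_cont (F := fun (p : ℝ × ℝ) u => g (p.1 - u) p.2 * Ker n u) ?_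
  have hk := Ker_cont n
  have h1 : Continuous (fun p : (ℝ × ℝ) × ℝ => (p.1.1 - p.2, p.1.2)) := by fun_prop
  exact (hg.comp h1).mul (hk.comp continuous_snd)

lemma two_dim {M ε : ℝ} (hM : 0 < M) (hε : 0 < ε) : ∃ η : ℝ, 0 < η ∧ ∀ K : ℕ, ∀ g : ℝ → ℝ → ℂ, Continuous (fun p : ℝ × ℝ => g p.1 p.2) →
    (∀ y, Function.Periodic (fun x => g x y) (2 * Real.pi)) → av (fun x => av (fun y => ‖g x y‖)) ≤ η →
    volume (Bd M 12 K (fun n p => ‖Q n (fun x => g x p.2) p.1‖)) ≤ ENNReal.ofReal ε := by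
  have hpi := Real.pi_pos
  obtain ⟨η1, hη1, H⟩ := one_dim hM (ε := ε / (4 * Real.pi)) (by positivity)
  refine ⟨η1 * ε / (8 * Real.pi ^ 2), by positivity, ?_⟩
  intro K g hg hp hav
  have hmeas := Bd_meas M 12 K (fun n => Qx_cont hg n)
  set E := Bd M 12 K (fun n p => ‖Q n (fun x => g x p.2) p.1‖) with hE
  set a : ℝ → ℝ := fun y => av (fun x => ‖g x y‖) with ha
  have hac : Continuous a := by
    refine av_cont (F := fun y x => ‖g x y‖) ?_
    have h1 : Continuous (fun p : ℝ × ℝ => (p.2, p.1)) := by fun_prop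
    exact (hg.comp h1).norm
  have ha0 : ∀ y, 0 ≤ a y := fun y => av_nonneg (fun _ => norm_nonneg _)
  have haa : av a ≤ η1 * ε / (8 * Real.pi ^ 2) := by
    rw [ha, av_swap (F := fun y x => ‖g x y‖) (by
      have h1 : Continuous (fun p : ℝ × ℝ => (p.2, p.1)) := by fun_prop
      exact (hg.comp h1).norm)]
    exact hav
  have hsl : ∀ y, volume ((fun x => (x, y)) ⁻¹' E) ≤ T1.indicator (fun y => ENNReal.ofReal (ε / (4 * Real.pi) + 2 * Real.pi / η1 * a y)) y := by
    intro y
    by_cases hy : y ∈ T1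
    · rw [Set.indicator_of_mem hy]
      by_cases hay : a y ≤ η1
      · obtain ⟨B, hB, hBv, hBx⟩ := H K (fun x => g x y) (hg.comp (by fun_prop : Continuous fun x : ℝ => (x, y))) (hp y) hay
        refine (measure_mono (t := B ∩ Set.Icc (-Real.pi) Real.pi) ?_).trans (hBv.trans (ENNReal.ofReal_le_ofReal ?_))
        · intro x hx
          simp only [hE, Bd, Set.mem_preimage, Set.mem_ofPred_eq] at hx
          obtain ⟨hx2, k, hk, hlt⟩ := hx
          have hxI : x ∈ Set.Icc (-Real.pi) Real.pi := Set.Ico_subset_Icc_self hx2.1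
          refine ⟨?_, hxI⟩
          by_contra hxB
          exact absurd (hBx x hxI hxB k hk) (not_le.mpr hlt)
        · have := ha0 y
          have : 0 ≤ 2 * Real.pi / η1 * a y := by positivity
          linarith
      · refine (measure_mono (t := T1) ?_).trans ?_
        · intro x hx
          exact hx.1.1
        · unfold T1
          rw [Real.volume_Ico]
          apply ENNReal.ofReal_le_ofReal
          push Not at hay
          have h1 : 2 * Real.pi / η1 * η1 ≤ 2 * Real.pi / η1 * a y := by gcongr
          have h2 : 2 * Real.pi / η1 * η1 = 2 * Real.pi := by field_simp
          have h3 : 0 < ε / (4 * Real.pi) := by positivity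
          linarith
    · rw [Set.indicator_of_notMem hy]
      have : (fun x => (x, y)) ⁻¹' E = ∅ := by
        ext x; simp only [Set.mem_preimage, Set.mem_empty_iff_false, iff_false]
        intro hx; exact hy hx.1.2
      rw [this]; simp
  rw [Measure.volume_eq_prod, Measure.prod_apply_symm hmeas]
  refine (lintegral_mono hsl).trans ?_
  rw [lintegral_indicator T1_meas, lint_av (by fun_prop) (fun y => by have := ha0 y; positivity)]
  apply ENNReal.ofReal_le_ofReal
  rw [av_add continuous_const (by fun_prop), av_const, av_cmul]
  calc 2 * Real.pi * (ε / (4 * Real.pi) + 2 * Real.pi / η1 * av a) ≤ 2 * Real.pi * (ε / (4 * Real.pi) + 2 * Real.pi / η1 * (η1 * ε / (8 * Real.pi ^ 2))) := by gcongr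
    _ = ε := by field_simp; ring

lemma two_dim' {M ε : ℝ} (hM : 0 < M) (hε : 0 < ε) : ∃ η : ℝ, 0 < η ∧ ∀ K : ℕ, ∀ g : ℝ → ℝ → ℂ, Continuous (fun p : ℝ × ℝ => g p.1 p.2) →
    (∀ y, Function.Periodic (fun x => g x y) (2 * Real.pi)) → (∀ x, Function.Periodic (fun y => g x y) (2 * Real.pi)) → av (fun x => av (fun y => ‖g x y‖)) ≤ η →
    volume (Bd M 12 K (fun n p => ‖Q n (fun x => g x p.2) p.1‖)) ≤ ENNReal.ofReal ε ∧
    volume (Bd M 12 K (fun n p => ‖Q n (fun y => g p.1 y) p.2‖)) ≤ ENNReal.ofReal ε := by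
  obtain ⟨η, hη, H⟩ := two_dim hM hε
  refine ⟨η, hη, fun K g hg hpx hpy hav => ⟨H K g hg hpx hav, ?_⟩⟩
  have hsw : Continuous (fun p : ℝ × ℝ => (p.2, p.1)) := by fun_prop
  have h2 := H K (fun x y => g y x) (hg.comp hsw) hpy (by
    rw [av_swap (F := fun x y => ‖g y x‖) (hg.comp hsw).norm]; exact hav)
  have hm := Bd_meas M 12 K (fun n => Qx_cont (g := fun x y => g y x) (hg.comp hsw) n)
  have hmp := (Measure.measurePreserving_swap (μ := (volume : Measure ℝ)) (ν := (volume : Measure ℝ))).measure_preimage hm.nullMeasurableSet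
  rw [← Measure.volume_eq_prod] at hmp
  rw [← hmp] at h2
  refine le_trans (measure_mono ?_) h2
  intro p hp
  exact ⟨⟨hp.1.2, hp.1.1⟩, hp.2⟩

/-! ### The algebraic identity -/

def box (n : ℕ) : Finset (ℤ × ℤ) := Finset.Icc (-(n:ℤ)) n ×ˢ Finset.Icc (-(n:ℤ)) n

def Sq (n : ℕ) (c : ℤ × ℤ → ℂ) (p : ℝ × ℝ) : ℂ := TT (box n) c p.1 p.2

lemma sgn_id (n : ℕ) (m k : ℤ) : (if (m, k) ∈ box n then (2:ℤ) else 0) =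
    (if m = 0 ∧ k = 0 then 2 else 0) + (((if 1 ≤ m ∧ m ≤ n then 1 else 0) - (if 1 ≤ -m ∧ -m ≤ n then 1 else 0)) * ((m + 1 * k).sign + (m + (-1) * k).sign)
      + ((if 1 ≤ k ∧ k ≤ n then 1 else 0) - (if 1 ≤ -k ∧ -k ≤ n then 1 else 0)) * ((m + 1 * k).sign - (m + (-1) * k).sign)) := by
  have hs : ∀ j : ℤ, (0 < j ∧ j.sign = 1) ∨ (j = 0 ∧ j.sign = 0) ∨ (j < 0 ∧ j.sign = -1) := by
    intro j
    rcases lt_trichotomy j 0 with h | h | h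
    · exact Or.inr (Or.inr ⟨h, Int.sign_eq_neg_one_of_neg h⟩)
    · subst h; simp
    · exact Or.inl ⟨h, Int.sign_eq_one_of_pos h⟩
  simp only [box, Finset.mem_product, Finset.mem_Icc]
  rcases hs (m + 1 * k) with ⟨a1, a2⟩ | ⟨a1, a2⟩ | ⟨a1, a2⟩ <;>
  rcases hs (m + (-1) * k) with ⟨b1, b2⟩ | ⟨b1, b2⟩ | ⟨b1, b2⟩ <;>
  rw [a2, b2] <;> split_ifs <;> omega

lemma Q_TT (s : Finset (ℤ × ℤ)) (a : ℤ × ℤ → ℂ) (n : ℕ) (x y : ℝ) :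
    Q n (fun x => TT s a x y) x = ∑ q ∈ s, (if 1 ≤ q.1 ∧ q.1 ≤ n then 1 else 0) * (a q * ee (q.1 * x + q.2 * y)) := by
  have hee := ee_cont
  have hk := Ker_cont n
  unfold Q TT
  have e : ∀ u, (∑ q ∈ s, a q * ee (q.1 * (x - u) + q.2 * y)) * Ker n u = ∑ q ∈ s, (a q * ee (q.2 * y)) * (ee (q.1 * (x - u)) * Ker n u) := by
    intro u
    rw [Finset.sum_mul]
    apply Finset.sum_congr rfl; intro q _
    rw [ee_add]; ring
  rw [av_congr e, av_sum _ (by intro q _; fun_prop)]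
  apply Finset.sum_congr rfl; intro q _
  rw [av_cmul, Q_ee, ee_add]
  split_ifs <;> ring

lemma TT_conj (s : Finset (ℤ × ℤ)) (a : ℤ × ℤ → ℂ) (x y : ℝ) :
    (starRingEnd ℂ) (TT s a x y) = ∑ q ∈ s, (starRingEnd ℂ) (a q) * ee ((-q.1 : ℤ) * x + (-q.2 : ℤ) * y) := by
  unfold TT
  rw [map_sum]
  apply Finset.sum_congr rfl; intro q _
  rw [map_mul, ee_conj]
  congr 2; push_cast; ring

lemma Q_TT_conj (s : Finset (ℤ × ℤ)) (a : ℤ × ℤ → ℂ) (n : ℕ) (x y : ℝ) :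
    (starRingEnd ℂ) (Q n (fun x => (starRingEnd ℂ) (TT s a x y)) x) = ∑ q ∈ s, (if 1 ≤ -q.1 ∧ -q.1 ≤ n then 1 else 0) * (a q * ee (q.1 * x + q.2 * y)) := by
  have hee := ee_cont
  have hk := Ker_cont n
  unfold Q
  simp only [TT_conj]
  have e : ∀ u, (∑ q ∈ s, (starRingEnd ℂ) (a q) * ee ((-q.1 : ℤ) * (x - u) + (-q.2 : ℤ) * y)) * Ker n u = ∑ q ∈ s, ((starRingEnd ℂ) (a q) * ee ((-q.2 : ℤ) * y)) * (ee ((-q.1 : ℤ) * (x - u)) * Ker n u) := by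
    intro u
    rw [Finset.sum_mul]
    apply Finset.sum_congr rfl; intro q _
    rw [ee_add]; ring
  rw [av_congr e, av_sum _ (by intro q _; fun_prop), map_sum]
  apply Finset.sum_congr rfl; intro q _
  rw [av_cmul, Q_ee, ee_add]
  split_ifs
  · rw [map_mul, map_mul, Complex.conj_conj, ee_conj, ee_conj]
    push_cast
    rw [show -(-(q.2:ℝ) * y) = q.2 * y by ring, show -(-(q.1:ℝ) * x) = q.1 * x by ring]
    ring
  · simp

end AES

namespace AES

def swp : ℤ × ℤ ≃ ℤ × ℤ := Equiv.prodComm ℤ ℤ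

lemma TT_swap (s : Finset (ℤ × ℤ)) (a : ℤ × ℤ → ℂ) (x y : ℝ) :
    TT s a x y = TT (s.map swp.toEmbedding) (fun q => a q.swap) y x := by
  unfold TT
  rw [Finset.sum_map]
  apply Finset.sum_congr rfl; intro q _
  simp only [swp, Equiv.coe_toEmbedding, Equiv.prodComm_apply, Prod.swap_swap, Prod.fst_swap, Prod.snd_swap]
  rw [add_comm]

lemma Q_TTy (s : Finset (ℤ × ℤ)) (a : ℤ × ℤ → ℂ) (n : ℕ) (x y : ℝ) :
    Q n (fun y => TT s a x y) y = ∑ q ∈ s, (if 1 ≤ q.2 ∧ q.2 ≤ n then 1 else 0) * (a q * ee (q.1 * x + q.2 * y)) := by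
  simp only [TT_swap s a]
  rw [Q_TT, Finset.sum_map]
  apply Finset.sum_congr rfl; intro q _
  simp only [swp, Equiv.coe_toEmbedding, Equiv.prodComm_apply, Prod.swap_swap, Prod.fst_swap, Prod.snd_swap]
  rw [add_comm]
  congr

lemma Q_TT_conjy (s : Finset (ℤ × ℤ)) (a : ℤ × ℤ → ℂ) (n : ℕ) (x y : ℝ) :
    (starRingEnd ℂ) (Q n (fun y => (starRingEnd ℂ) (TT s a x y)) y) = ∑ q ∈ s, (if 1 ≤ -q.2 ∧ -q.2 ≤ n then 1 else 0) * (a q * ee (q.1 * x + q.2 * y)) := by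
  simp only [TT_swap s a]
  rw [Q_TT_conj, Finset.sum_map]
  apply Finset.sum_congr rfl; intro q _
  simp only [swp, Equiv.coe_toEmbedding, Equiv.prodComm_apply, Prod.swap_swap, Prod.fst_swap, Prod.snd_swap]
  rw [add_comm]
  congr

lemma Sq_eq {s : Finset (ℤ × ℤ)} {c : ℤ × ℤ → ℂ} (hs : ∀ q, q ∉ s → c q = 0) (n : ℕ) (p : ℝ × ℝ) :
    Sq n c p = ∑ q ∈ s, (if q ∈ box n then 1 else 0) * (c q * ee (q.1 * p.1 + q.2 * p.2)) := by
  unfold Sq TT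
  simp only [ite_mul, one_mul, zero_mul]
  rw [Finset.sum_ite_mem]
  symm
  apply Finset.sum_subset Finset.inter_subset_right
  intro q h1 h2
  rw [hs q (fun h => h2 (Finset.mem_inter.mpr ⟨h, h1⟩)), zero_mul]

/-- the four building blocks -/
def gB (s : Finset (ℤ × ℤ)) (c : ℤ × ℤ → ℂ) (b e : Bool) (x y : ℝ) : ℂ :=
  cond b (TT s (sgc (cond e 1 (-1)) c) x y) ((starRingEnd ℂ) (TT s (sgc (cond e 1 (-1)) c) x y))

def uB (s : Finset (ℤ × ℤ)) (c : ℤ × ℤ → ℂ) (i : Bool × Bool × Bool) (n : ℕ) (p : ℝ × ℝ) : ℝ :=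
  cond i.1 ‖Q n (fun x => gB s c i.2.1 i.2.2 x p.2) p.1‖ ‖Q n (fun y => gB s c i.2.1 i.2.2 p.1 y) p.2‖

lemma Sq_id {s : Finset (ℤ × ℤ)} {c : ℤ × ℤ → ℂ} (hs : ∀ q, q ∉ s → c q = 0) (n : ℕ) (p : ℝ × ℝ) :
    2 * Sq n c p = 2 * c 0 +
      ((Q n (fun x => gB s c true true x p.2) p.1 - (starRingEnd ℂ) (Q n (fun x => gB s c false true x p.2) p.1))
      + (Q n (fun x => gB s c true false x p.2) p.1 - (starRingEnd ℂ) (Q n (fun x => gB s c false false x p.2) p.1))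
      + (Q n (fun y => gB s c true true p.1 y) p.2 - (starRingEnd ℂ) (Q n (fun y => gB s c false true p.1 y) p.2))
      - (Q n (fun y => gB s c true false p.1 y) p.2 - (starRingEnd ℂ) (Q n (fun y => gB s c false false p.1 y) p.2))) := by
  have h0 : 2 * c 0 = ∑ q ∈ s, (if q.1 = 0 ∧ q.2 = 0 then 2 else 0) * (c q * ee (q.1 * p.1 + q.2 * p.2)) := by
    by_cases h : (0 : ℤ × ℤ) ∈ s
    · rw [Finset.sum_eq_single (0 : ℤ × ℤ)]
      · simp [ee_zero]
      · intro q _ hq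
        rw [if_neg (fun h => hq (Prod.ext h.1 h.2)), zero_mul]
      · intro h'; exact absurd h h'
    · rw [hs 0 h, mul_zero, Finset.sum_eq_zero]
      intro q hq
      rw [if_neg, zero_mul]
      intro hh
      exact h (by rw [show (0 : ℤ × ℤ) = q from (Prod.ext hh.1 hh.2).symm]; exact hq)
  simp only [gB, cond_true, cond_false]
  rw [Sq_eq hs, h0, Q_TT, Q_TT, Q_TT_conj, Q_TT_conj, Q_TTy, Q_TTy, Q_TT_conjy, Q_TT_conjy, Finset.mul_sum]
  simp only [← Finset.sum_sub_distrib, ← Finset.sum_add_distrib]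
  apply Finset.sum_congr rfl
  intro q _
  have h := congrArg (fun z : ℤ => (z : ℂ)) (sgn_id n q.1 q.2)
  push_cast at h
  simp only [sgc]
  push_cast
  have h2 : (2:ℂ) * ((if q ∈ box n then 1 else 0) * (c q * ee (q.1 * p.1 + q.2 * p.2))) =
      (if (q.1, q.2) ∈ box n then (2:ℂ) else 0) * (c q * ee (q.1 * p.1 + q.2 * p.2)) := by
    by_cases hq : q ∈ box n
    · simp [hq]
    · simp [hq]
  rw [h2, h]
  ring

lemma Sq_le {s : Finset (ℤ × ℤ)} {c : ℤ × ℤ → ℂ} (hs : ∀ q, q ∉ s → c q = 0) (n : ℕ) (p : ℝ × ℝ) :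
    2 * ‖Sq n c p‖ ≤ 2 * ‖c 0‖ + ∑ i, uB s c i n p := by
  have h := congrArg norm (Sq_id hs n p)
  rw [norm_mul, Complex.norm_ofNat] at h
  rw [h]
  refine (norm_add_le _ _).trans ?_
  rw [norm_mul, Complex.norm_ofNat]
  gcongr
  simp only [Fintype.sum_prod_type, Fintype.sum_bool, uB, cond_true, cond_false]
  have t : ∀ a b : ℂ, ‖a - (starRingEnd ℂ) b‖ ≤ ‖a‖ + ‖b‖ := by
    intro a b
    refine (norm_sub_le _ _).trans ?_
    rw [RCLike.norm_conj]
  refine (norm_sub_le _ _).trans ?_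
  refine (add_le_add ((norm_add_le _ _).trans (add_le_add ((norm_add_le _ _).trans (add_le_add (t _ _) (t _ _))) (t _ _))) (t _ _)).trans ?_
  linarith

lemma exp_sum_le {ι : Type*} [Fintype ι] [Nonempty ι] (a : ι → ℝ) {M : ℝ} (hM : 0 ≤ M) :
    Real.exp (M * ∑ i, a i) ≤ ∑ i, Real.exp (M * Fintype.card ι * a i) := by
  obtain ⟨j, _, hj⟩ := Finset.exists_max_image Finset.univ a Finset.univ_nonempty
  have h1 : ∑ i, a i ≤ Fintype.card ι * a j := by
    have := Finset.sum_le_card_nsmul Finset.univ a (a j) (fun i hi => hj i hi)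
    simpa using this
  calc Real.exp (M * ∑ i, a i) ≤ Real.exp (M * (Fintype.card ι * a j)) := by gcongr
    _ = Real.exp (M * Fintype.card ι * a j) := by rw [mul_assoc]
    _ ≤ _ := Finset.single_le_sum (f := fun i => Real.exp (M * Fintype.card ι * a i)) (fun i _ => (Real.exp_pos _).le) (Finset.mem_univ j)

lemma coef_zero_le {s : Finset (ℤ × ℤ)} {c : ℤ × ℤ → ℂ} (hs : ∀ q, q ∉ s → c q = 0) :
    ‖c 0‖ ≤ av (fun x => av (fun y => ‖TT s c x y‖)) := by
  have hee := ee_cont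
  have e : av (fun x => av (fun y => TT s c x y)) = c 0 := by
    have e1 : ∀ x, av (fun y => TT s c x y) = ∑ q ∈ s, c q * ((if q.2 = 0 then 1 else 0) * ee (q.1 * x)) := by
      intro x
      unfold TT
      rw [av_sum _ (by intro q _; fun_prop)]
      apply Finset.sum_congr rfl; intro q _
      rw [av_cmul]
      congr 1
      simp only [ee_add]
      rw [av_cmul, av_ee, mul_comm]
    rw [av_congr e1, av_sum _ (by intro q _; fun_prop)]
    have e2 : ∀ q ∈ s, av (fun x => c q * ((if q.2 = 0 then 1 else 0) * ee (q.1 * x))) = if q = 0 then c q else 0 := by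
      intro q _
      rw [av_cmul, av_cmul, av_ee]
      by_cases h1 : q.1 = 0 <;> by_cases h2 : q.2 = 0 <;> simp [h1, h2, Prod.ext_iff]
    rw [Finset.sum_congr rfl e2, Finset.sum_ite_eq']
    split_ifs with h
    · rfl
    · exact (hs 0 h).symm
  rw [← e]
  refine (norm_av_le _).trans ?_
  have hc := TT_cont s c
  apply av_mono (av_cont (F := fun x y => TT s c x y) hc).norm (av_cont (F := fun x y => ‖TT s c x y‖) hc.norm)
  intro x; exact norm_av_le _

theorem weak {M ε : ℝ} (hM : 0 < M) (hε : 0 < ε) : ∃ κ : ℝ, 0 < κ ∧ ∀ (s : Finset (ℤ × ℤ)) (c : ℤ × ℤ → ℂ),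
    (∀ q, q ∉ s → c q = 0) → av (fun x => av (fun y => Psi (κ * ‖TT s c x y‖))) ≤ 1 → ∀ K : ℕ,
    volume (Bd M 300 K (fun n p => ‖Sq n c p‖)) ≤ ENNReal.ofReal ε := by
  obtain ⟨η, hη, H⟩ := two_dim' (M := M / 2 * 8) (ε := ε / 8) (by positivity) (by positivity)
  refine ⟨max (32 / η) M, by positivity, ?_⟩
  intro s c hs hPsi K
  set κ := max (32 / η) M with hκd
  have hκ : 0 < κ := by positivity
  have hκη : 32 / κ ≤ η := by
    rw [div_le_iff₀ hκ]
    have : 32 / η ≤ κ := le_max_left _ _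
    rw [div_le_iff₀ hη] at this
    linarith
  have hc0 : M * ‖c 0‖ ≤ 1 := by
    have h1 : κ * ‖c 0‖ ≤ 1 := by
      have hcc := TT_cont s c
      calc κ * ‖c 0‖ ≤ κ * av (fun x => av (fun y => ‖TT s c x y‖)) := by gcongr; exact coef_zero_le hs
        _ = av (fun x => av (fun y => κ * ‖TT s c x y‖)) := by
            rw [← av_cmul]; apply av_congr; intro x; rw [← av_cmul]
        _ ≤ av (fun x => av (fun y => Psi (κ * ‖TT s c x y‖))) := by
            refine av_mono2 (F := fun x y => κ * ‖TT s c x y‖) (G := fun x y => Psi (κ * ‖TT s c x y‖)) (by fun_prop) (Psi_cont (by fun_prop) (fun p => by positivity)) ?_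
            intro x y; exact le_Psi (by positivity)
        _ ≤ 1 := hPsi
    have : M ≤ κ := le_max_right _ _
    refine le_trans ?_ h1
    gcongr
  have hi : ∀ i, volume (Bd (M / 2 * 8) 12 K (uB s c i)) ≤ ENNReal.ofReal (ε / 8) := by
    rintro ⟨a, b, e⟩
    have hcT := TT_cont s (sgc (cond e 1 (-1)) c)
    have hcg : Continuous (fun p : ℝ × ℝ => gB s c b e p.1 p.2) := by
      cases b
      · exact Complex.continuous_conj.comp hcT
      · exact hcT
    have hpx : ∀ y, Function.Periodic (fun x => gB s c b e x y) (2 * Real.pi) := by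
      intro y x
      have := TT_perx s (sgc (cond e 1 (-1)) c) y x
      simp only at this
      simp only [gB, this]
    have hpy : ∀ x, Function.Periodic (fun y => gB s c b e x y) (2 * Real.pi) := by
      intro x y
      have := TT_pery s (sgc (cond e 1 (-1)) c) x y
      simp only at this
      simp only [gB, this]
    have hn : ∀ x y, ‖gB s c b e x y‖ = ‖TT s (sgc (cond e 1 (-1)) c) x y‖ := by
      intro x y
      cases b
      · exact RCLike.norm_conj _
      · rfl
    have hav : av (fun x => av (fun y => ‖gB s c b e x y‖)) ≤ η := by
      simp only [hn]
      refine (conj_L1_2 s c _ hκ).trans ?_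
      refine le_trans ?_ hκη
      calc _ ≤ 16 / κ * (1 + 1) := by gcongr
        _ = 32 / κ := by ring
    have := H K (gB s c b e) hcg hpx hpy hav
    cases a
    · exact this.2
    · exact this.1
  have hsub : Bd M 300 K (fun n p => ‖Sq n c p‖) ⊆ ⋃ i, Bd (M / 2 * 8) 12 K (uB s c i) := by
    intro p hp
    by_contra hcon
    simp only [Set.mem_iUnion, not_exists] at hcon
    obtain ⟨hp2, k, hk, hlt⟩ := hp
    have hall : ∀ i, ∑ n ∈ Finset.range (2 ^ k), Real.exp (M / 2 * 8 * uB s c i n p) ≤ 12 * 2 ^ k := by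
      intro i
      by_contra h
      exact hcon i ⟨hp2, k, hk, not_le.mp h⟩
    have h1 : ∑ n ∈ Finset.range (2 ^ k), Real.exp (M * ‖Sq n c p‖) ≤
        ∑ n ∈ Finset.range (2 ^ k), Real.exp 1 * ∑ i, Real.exp (M / 2 * 8 * uB s c i n p) := by
      apply Finset.sum_le_sum
      intro n _
      have h2 := Sq_le hs n p
      have h3 := exp_sum_le (fun i => uB s c i n p) (M := M / 2) (by positivity)
      have hcard : (Fintype.card (Bool × Bool × Bool) : ℝ) = 8 := by simp
      rw [hcard] at h3
      calc Real.exp (M * ‖Sq n c p‖) ≤ Real.exp (1 + M / 2 * ∑ i, uB s c i n p) := by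
            apply Real.exp_le_exp.mpr
            nlinarith
        _ = Real.exp 1 * Real.exp (M / 2 * ∑ i, uB s c i n p) := Real.exp_add _ _
        _ ≤ _ := by gcongr
    rw [← Finset.mul_sum, Finset.sum_comm] at h1
    have h4 : ∑ i, ∑ n ∈ Finset.range (2 ^ k), Real.exp (M / 2 * 8 * uB s c i n p) ≤ 96 * 2 ^ k := by
      refine (Finset.sum_le_sum (fun i _ => hall i)).trans (le_of_eq ?_)
      rw [Finset.sum_const, Finset.card_univ]
      simp only [Fintype.card_prod, Fintype.card_bool]
      norm_num
      ring
    have h5 := Real.exp_one_lt_d9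
    have h6 : (0:ℝ) < 2 ^ k := by positivity
    have h7 : Real.exp 1 * ∑ i, ∑ n ∈ Finset.range (2 ^ k), Real.exp (M / 2 * 8 * uB s c i n p) ≤ 3 * (96 * 2 ^ k) := by
      gcongr; linarith
    linarith
  refine (measure_mono hsub).trans ((measure_iUnion_fintype_le _ _).trans ((Finset.sum_le_sum (fun i _ => hi i)).trans (le_of_eq ?_)))
  rw [Finset.sum_const, Finset.card_univ]
  simp only [Fintype.card_prod, Fintype.card_bool]
  rw [nsmul_eq_mul, show ((2 * (2 * 2) : ℕ) : ENNReal) = ENNReal.ofReal 8 by norm_num, ← ENNReal.ofReal_mul (by norm_num)]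
  congr 1; ring

end AES

namespace AES

section torus

abbrev circMS : MeasureSpace UnitAddCircle := ⟨AddCircle.haarAddCircle⟩

attribute [local instance] circMS

theorem circHaar : Measure.IsAddHaarMeasure (volume : Measure UnitAddCircle) :=
  inferInstanceAs (Measure.IsAddHaarMeasure AddCircle.haarAddCircle)

theorem circProb : IsProbabilityMeasure (volume : Measure UnitAddCircle) :=
  inferInstanceAs (IsProbabilityMeasure AddCircle.haarAddCircle)

attribute [local instance] circHaar circProb

def tor (p : ℝ × ℝ) : UnitAddTorus (Fin 2) := ![((p.1 / (2 * Real.pi) : ℝ) : UnitAddCircle), ((p.2 / (2 * Real.pi) : ℝ) : UnitAddCircle)]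

lemma T2_Ioc : (volume : Measure (ℝ × ℝ)).restrict T2 = volume.restrict (Ioc (-Real.pi) Real.pi ×ˢ Ioc (-Real.pi) Real.pi) := by
  unfold T2 T1
  rw [Measure.volume_eq_prod, ← Measure.prod_restrict, ← Measure.prod_restrict, Measure.restrict_congr_set Ico_ae_eq_Ioc]

lemma tor_lintegral (h : UnitAddTorus (Fin 2) → ENNReal) :
    ∫⁻ p in T2, h (tor p) = ENNReal.ofReal (4 * Real.pi ^ 2) * ∫⁻ t, h t := by
  have hpi := Real.pi_pos
  rw [UnitAddTorus.lintegral_preimage h (fun _ => -1/2), T2_Ioc]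
  have e1 : (∫⁻ (x : Fin 2 → ℝ) in {x : Fin 2 → ℝ | ∀ i, x i ∈ Ioc ((-1/2 : ℝ)) (-1/2 + 1)}, h (fun i => x i))
      = ∫⁻ p in Ioc (-1/2 : ℝ) (1/2) ×ˢ Ioc (-1/2 : ℝ) (1/2), h ![(p.1 : UnitAddCircle), (p.2 : UnitAddCircle)] := by
    rw [← (volume_preserving_finTwoArrow ℝ).setLIntegral_comp_preimage_emb (MeasurableEquiv.finTwoArrow.measurableEmbedding)]
    congr 1
    · congr 1
      ext x
      simp [Fin.forall_fin_two]
      norm_num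
    · ext x
      congr 1
      ext i
      fin_cases i <;> rfl
  rw [e1]
  have hr : (2 * Real.pi)⁻¹ ≠ 0 := by positivity
  have hm := Measure.map_addHaar_smul (volume : Measure (ℝ × ℝ)) hr
  have hemb : MeasurableEmbedding (fun p : ℝ × ℝ => (2 * Real.pi)⁻¹ • p) := (Homeomorph.smulOfNeZero _ hr).measurableEmbedding
  have e2 := (hemb.measurable.measurePreserving volume).setLIntegral_comp_preimage_emb hemb (fun p : ℝ × ℝ => h ![(p.1 : UnitAddCircle), (p.2 : UnitAddCircle)]) (Ioc (-1/2 : ℝ) (1/2) ×ˢ Ioc (-1/2 : ℝ) (1/2))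
  have hp : (fun p : ℝ × ℝ => (2 * Real.pi)⁻¹ • p) ⁻¹' (Ioc (-1/2 : ℝ) (1/2) ×ˢ Ioc (-1/2 : ℝ) (1/2)) = Ioc (-Real.pi) Real.pi ×ˢ Ioc (-Real.pi) Real.pi := by
    have key : ∀ u : ℝ, (2 * Real.pi)⁻¹ * u ∈ Ioc (-1/2 : ℝ) (1/2) ↔ u ∈ Ioc (-Real.pi) Real.pi := by
      intro u
      simp only [Set.mem_Ioc]
      rw [inv_mul_eq_div, lt_div_iff₀ (by positivity), div_le_iff₀ (by positivity)]
      constructor <;> rintro ⟨h1, h2⟩ <;> constructor <;> linarith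
    ext p
    simp only [Set.mem_preimage, Set.mem_prod, Prod.smul_fst, Prod.smul_snd, smul_eq_mul, key]
  rw [hp] at e2
  have e3 : ∀ p : ℝ × ℝ, tor p = ![((((2 * Real.pi)⁻¹ • p).1 : ℝ) : UnitAddCircle), ((((2 * Real.pi)⁻¹ • p).2 : ℝ) : UnitAddCircle)] := by
    intro p
    simp only [tor, Prod.smul_fst, Prod.smul_snd, smul_eq_mul, inv_mul_eq_div]
  simp only [e3]
  rw [e2, hm, Measure.restrict_smul, lintegral_smul_measure, smul_eq_mul]
  congr 2
  simp
  rw [abs_of_pos hpi]; field_simp; norm_num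

lemma mF_tor (k : Fin 2 → ℤ) (p : ℝ × ℝ) : UnitAddTorus.mFourier k (tor p) = ee (k 0 * p.1 + k 1 * p.2) := by
  have hpi : (Real.pi : ℂ) ≠ 0 := by exact_mod_cast Real.pi_ne_zero
  rw [ee_add]
  simp only [UnitAddTorus.mFourier, ContinuousMap.coe_mk, Fin.prod_univ_two, tor, Matrix.cons_val_zero, Matrix.cons_val_one, fourier_coe_apply, ee]
  push_cast
  congr 2 <;> field_simp

def rep (t : UnitAddTorus (Fin 2)) : ℝ × ℝ := 
  (2 * Real.pi * (AddCircle.equivIco 1 (-1/2) (t 0) : ℝ), 2 * Real.pi * (AddCircle.equivIco 1 (-1/2) (t 1) : ℝ))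

lemma rep_meas : Measurable rep := by
  have h : Measurable (fun t : UnitAddCircle => (AddCircle.equivIco 1 (-1/2) t : ℝ)) := 
    measurable_subtype_coe.comp (AddCircle.measurableEquivIco (1:ℝ) (-1/2)).measurable
  exact ((h.comp (measurable_pi_apply (0 : Fin 2))).const_mul _).prodMk ((h.comp (measurable_pi_apply (1 : Fin 2))).const_mul _)

lemma rep_tor {p : ℝ × ℝ} (hp : p ∈ T2) : rep (tor p) = p := by
  have hpi := Real.pi_pos
  have key : ∀ u ∈ T1, 2 * Real.pi * (AddCircle.equivIco 1 (-1/2) ((u / (2 * Real.pi) : ℝ) : UnitAddCircle) : ℝ) = u := by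
    intro u hu
    have hu' : u / (2 * Real.pi) ∈ Ico (-1/2 : ℝ) (-1/2 + 1) := by
      obtain ⟨h1, h2⟩ := hu
      constructor
      · rw [le_div_iff₀ (by positivity)]; linarith
      · rw [div_lt_iff₀ (by positivity)]; linarith
    rw [AddCircle.equivIco_coe_eq hu']
    simp only
    field_simp
  exact Prod.ext (key _ hp.1) (key _ hp.2)

lemma L2_dense {b : ℝ × ℝ → ℝ} (hb : Measurable b) {R : ℝ} (hR : ∀ p, |b p| ≤ R) {δ : ℝ} (hδ : 0 < δ) :
    ∃ (s : Finset (ℤ × ℤ)) (c : ℤ × ℤ → ℂ), (∀ q, q ∉ s → c q = 0) ∧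
      ∫⁻ p in T2, ENNReal.ofReal (‖(b p : ℂ) - TT s c p.1 p.2‖ ^ 2) ≤ ENNReal.ofReal δ := by
  have hpi := Real.pi_pos
  set G : UnitAddTorus (Fin 2) → ℂ := fun t => (b (rep t) : ℂ) with hG
  have hGm : MemLp G 2 volume := by
    refine MemLp.of_bound (C := R) ?_ (ae_of_all _ ?_)
    · exact (Complex.measurable_ofReal.comp (hb.comp rep_meas)).aestronglyMeasurable
    · intro t
      simp only [hG, Complex.norm_real, Real.norm_eq_abs]; exact hR _
  have hd : (hGm.toLp G) ∈ (Submodule.span ℂ (range (@UnitAddTorus.mFourierLp (Fin 2) _ 2 _))).topologicalClosure := by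
    rw [UnitAddTorus.span_mFourierLp_closure_eq_top (by norm_num)]; trivial
  set τ := Real.sqrt (δ / (4 * Real.pi ^ 2)) with hτ
  have hτ0 : 0 < τ := by positivity
  rw [← SetLike.mem_coe, Submodule.topologicalClosure_coe, Metric.mem_closure_iff] at hd
  obtain ⟨P, hP, hdist⟩ := hd τ hτ0
  obtain ⟨l, hl⟩ := (Finsupp.mem_span_range_iff_exists_finsupp).mp hP
  set C : C(UnitAddTorus (Fin 2), ℂ) := ∑ k ∈ l.support, l k • UnitAddTorus.mFourier k with hC
  have hPC : P = ContinuousMap.toLp (E := ℂ) 2 volume ℂ C := by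
    rw [← hl, hC, map_sum, Finsupp.sum]
    apply Finset.sum_congr rfl; intro k _
    rw [map_smul]
  have hCae : P =ᵐ[volume] C := by
    rw [hPC]; exact ContinuousMap.coeFn_toLp volume C
  have h2 : eLpNorm (G - ⇑C) 2 volume ≤ ENNReal.ofReal τ := by
    have h3 : edist (hGm.toLp G) P ≤ ENNReal.ofReal τ := by
      rw [edist_dist]; exact ENNReal.ofReal_le_ofReal hdist.le
    rw [Lp.edist_def] at h3
    rwa [eLpNorm_congr_ae (hGm.coeFn_toLp.sub hCae)] at h3
  have h4 : ∫⁻ t, ENNReal.ofReal (‖G t - C t‖ ^ 2) ≤ ENNReal.ofReal (τ ^ 2) := by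
    have h5 := eLpNorm_nnreal_pow_eq_lintegral (μ := volume) (f := G - ⇑C) (p := 2) (by norm_num)
    calc ∫⁻ t, ENNReal.ofReal (‖G t - C t‖ ^ 2) = ∫⁻ t, ‖(G - ⇑C) t‖ₑ ^ (2:ℝ) := by
          apply lintegral_congr; intro t
          rw [ENNReal.ofReal_pow (norm_nonneg _), ofReal_norm, Pi.sub_apply]
          norm_cast
      _ = eLpNorm (G - ⇑C) 2 volume ^ (2:ℝ) := by rw [← NNReal.coe_two, ← h5]; rfl
      _ ≤ (ENNReal.ofReal τ) ^ (2:ℝ) := by gcongr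
      _ = ENNReal.ofReal (τ ^ 2) := by
          rw [ENNReal.ofReal_pow hτ0.le]; norm_cast
  have inj : Function.Injective (fun k : Fin 2 → ℤ => (k 0, k 1)) := by
    intro k k' h
    simp only [Prod.mk.injEq] at h
    ext i; fin_cases i
    · exact h.1
    · exact h.2
  refine ⟨l.support.map ⟨_, inj⟩, fun q => l ![q.1, q.2], ?_, ?_⟩
  · intro q hq
    by_contra hne
    apply hq
    rw [Finset.mem_map]
    exact ⟨![q.1, q.2], Finsupp.mem_support_iff.mpr hne, rfl⟩
  · have e1 : ∀ p ∈ T2, ENNReal.ofReal (‖(b p : ℂ) - TT (l.support.map ⟨_, inj⟩) (fun q => l ![q.1, q.2]) p.1 p.2‖ ^ 2) =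
        (fun t => ENNReal.ofReal (‖G t - C t‖ ^ 2)) (tor p) := by
      intro p hp
      simp only [hG, rep_tor hp, hC, ContinuousMap.coe_sum, Finset.sum_apply, ContinuousMap.coe_smul, Pi.smul_apply, smul_eq_mul, mF_tor]
      unfold TT
      rw [Finset.sum_map]
      congr 4
      apply Finset.sum_congr rfl; intro k _
      simp only [Function.Embedding.coeFn_mk]
      congr 2
      ext i; fin_cases i <;> rfl
    rw [setLIntegral_congr_fun T2_meas e1, tor_lintegral (fun t => ENNReal.ofReal (‖G t - C t‖ ^ 2))]
    calc _ ≤ ENNReal.ofReal (4 * Real.pi ^ 2) * ENNReal.ofReal (τ ^ 2) := by gcongr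
      _ = ENNReal.ofReal δ := by
        rw [← ENNReal.ofReal_mul (by positivity), hτ, Real.sq_sqrt (by positivity)]
        congr 1; field_simp

end torus

end AES

namespace AES

lemma Psi_zero : Psi 0 = 0 := by simp [Psi]

lemma Psi_add {a b : ℝ} (ha : 0 ≤ a) (hb : 0 ≤ b) : Psi (a + b) ≤ Psi (2 * a) + Psi (2 * b) := by
  rcases le_total a b with h | h
  · have := Psi_mono (x := a + b) (y := 2 * b) (by positivity) (by linarith)
    have := Psi_nonneg (y := 2 * a) (by positivity)
    linarith
  · have := Psi_mono (x := a + b) (y := 2 * a) (by positivity) (by linarith)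
    have := Psi_nonneg (y := 2 * b) (by positivity)
    linarith

lemma Psi_meas : Measurable Psi := by
  unfold Psi
  exact (measurable_id.add_const 1).mul (Real.measurable_log.comp (measurable_id.add_const 1))

lemma logPlus_nonneg (u : ℝ) : 0 ≤ logPlus u := by
  unfold logPlus
  split_ifs with h
  · exact (Real.log_pos h).le
  · exact le_refl _

lemma Psi_LlogL {κ y : ℝ} (hκ : 0 < κ) (hy : 0 ≤ y) :
    Psi (κ * y) ≤ (κ + 1) * Real.log (κ + 1) * (1 + y) + (κ + 1) * (y * logPlus y) := by
  have hl : 0 ≤ Real.log (κ + 1) := Real.log_nonneg (by linarith)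
  have hlp := logPlus_nonneg y
  by_cases h : 1 < y
  · have e : logPlus y = Real.log y := by simp [logPlus, h]
    rw [e] at *
    have h1 : Psi (κ * y) ≤ (κ + 1) * y * Real.log ((κ + 1) * y) := by
      unfold Psi
      have h2 : κ * y + 1 ≤ (κ + 1) * y := by nlinarith
      have h3 : 0 < κ * y + 1 := by positivity
      have h4 : 0 ≤ Real.log (κ * y + 1) := Real.log_nonneg (by nlinarith)
      gcongr
    rw [Real.log_mul (by positivity) (by positivity)] at h1
    have : 0 ≤ (κ + 1) * Real.log (κ + 1) := by positivity
    nlinarith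
  · have h1 : Psi (κ * y) ≤ Psi κ := Psi_mono (by positivity) (by nlinarith)
    have h2 : Psi κ = (κ + 1) * Real.log (κ + 1) := rfl
    have : 0 ≤ (κ + 1) * Real.log (κ + 1) := by positivity
    have : 0 ≤ (κ + 1) * (y * logPlus y) := by positivity
    nlinarith

lemma T2_vol : volume T2 = ENNReal.ofReal (4 * Real.pi ^ 2) := by
  have hpi := Real.pi_pos
  unfold T2 T1
  rw [Measure.volume_eq_prod, Measure.prod_prod, Real.volume_Ico, ← ENNReal.ofReal_mul (by linarith)]
  congr 1; ring

lemma T2_fin : volume T2 < ⊤ := by rw [T2_vol]; exact ENNReal.ofReal_lt_top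

lemma Psi_int {f : ℝ × ℝ → ℝ} (hmeas : Measurable f)
    (hint : IntegrableOn f T2) (hlog : IntegrableOn (fun p => |f p| * logPlus |f p|) T2) {κ : ℝ} (hκ : 0 < κ) :
    IntegrableOn (fun p => Psi (κ * |f p|)) T2 := by
  have h1 : IntegrableOn (fun p => (κ + 1) * Real.log (κ + 1) * (1 + |f p|) + (κ + 1) * (|f p| * logPlus |f p|)) T2 := by
    have hc : IntegrableOn (fun _ : ℝ × ℝ => (1:ℝ)) T2 := integrableOn_const (hs := T2_fin.ne)
    exact ((hc.add hint.abs).const_mul _).add (hlog.const_mul _)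
  refine h1.mono' (Psi_meas.comp ((hmeas.abs).const_mul _)).aestronglyMeasurable (ae_of_all _ ?_)
  intro p
  rw [Real.norm_of_nonneg (Psi_nonneg (by positivity))]
  exact Psi_LlogL hκ (abs_nonneg _)

theorem dense_Psi {f : ℝ × ℝ → ℝ} (hmeas : Measurable f)
    (hint : IntegrableOn f T2) (hlog : IntegrableOn (fun p => |f p| * logPlus |f p|) T2) {κ δ : ℝ} (hκ : 0 < κ) (hδ : 0 < δ) :
    ∃ (s : Finset (ℤ × ℤ)) (c : ℤ × ℤ → ℂ), (∀ q, q ∉ s → c q = 0) ∧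
      ∫⁻ p in T2, ENNReal.ofReal (Psi (κ * ‖(f p : ℂ) - TT s c p.1 p.2‖)) ≤ ENNReal.ofReal δ := by
  have hpi := Real.pi_pos
  have hI := Psi_int hmeas hint hlog (κ := 2 * κ) (by positivity)
  set h : ℕ → ℝ × ℝ → ENNReal := fun N p => if |f p| ≤ N then 0 else ENNReal.ofReal (Psi (2 * κ * |f p|)) with hh
  have hPm : Measurable (fun p => ENNReal.ofReal (Psi (2 * κ * |f p|))) :=
    (Psi_meas.comp ((hmeas.abs).const_mul _)).ennreal_ofReal
  have hset : ∀ N : ℕ, MeasurableSet {p | |f p| ≤ N} := fun N => measurableSet_le hmeas.abs measurable_const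
  have hhm : ∀ N, Measurable (h N) := fun N => Measurable.ite (hset N) measurable_const hPm
  have ht : Tendsto (fun N => ∫⁻ p in T2, h N p) atTop (nhds (∫⁻ p in T2, 0)) := by
    refine tendsto_lintegral_of_dominated_convergence (fun p => ENNReal.ofReal (Psi (2 * κ * |f p|))) hhm ?_ ?_ ?_
    · intro N; refine ae_of_all _ (fun p => ?_)
      simp only [hh]; split_ifs
      · exact zero_le
      · exact le_refl _
    · exact hI.lintegral_lt_top.ne
    · refine ae_of_all _ (fun p => ?_)
      obtain ⟨N0, hN0⟩ := exists_nat_ge |f p|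
      refine tendsto_const_nhds.congr' ?_
      filter_upwards [eventually_ge_atTop N0] with N hN
      simp only [hh]
      rw [if_pos (hN0.trans (by exact_mod_cast hN))]
  rw [lintegral_zero] at ht
  obtain ⟨N, hN⟩ := (ht.eventually (gt_mem_nhds (show (0:ENNReal) < ENNReal.ofReal (δ / 2) by simpa using hδ))).exists
  set b : ℝ × ℝ → ℝ := fun p => if |f p| ≤ N then f p else 0 with hb
  have hbm : Measurable b := Measurable.ite (hset N) hmeas measurable_const
  have hbb : ∀ p, |b p| ≤ N := by
    intro p; simp only [hb]; split_ifs with h1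
    · exact h1
    · simp
  set η := δ / (4 * (4 * Real.pi ^ 2)) with hη
  have hη0 : 0 < η := by positivity
  set L := (1 + 1 / η) * (2 * κ) ^ 2 with hL
  have hL0 : 0 < L := by positivity
  obtain ⟨s, c, hs, hsc⟩ := L2_dense hbm hbb (δ := δ / 4 / L) (by positivity)
  refine ⟨s, c, hs, ?_⟩
  have hpt : ∀ p, ENNReal.ofReal (Psi (κ * ‖(f p : ℂ) - TT s c p.1 p.2‖)) ≤
      h N p + (ENNReal.ofReal L * ENNReal.ofReal (‖(b p : ℂ) - TT s c p.1 p.2‖ ^ 2) + ENNReal.ofReal η) := by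
    intro p
    set y := ‖(b p : ℂ) - TT s c p.1 p.2‖ with hy
    have hy0 : 0 ≤ y := norm_nonneg _
    have h1 : ‖(f p : ℂ) - TT s c p.1 p.2‖ ≤ |f p - b p| + y := by
      have : (f p : ℂ) - TT s c p.1 p.2 = ((f p - b p : ℝ) : ℂ) + ((b p : ℂ) - TT s c p.1 p.2) := by push_cast; ring
      rw [this]
      refine (norm_add_le _ _).trans ?_
      rw [Complex.norm_real, Real.norm_eq_abs]
    have h2 : Psi (κ * ‖(f p : ℂ) - TT s c p.1 p.2‖) ≤ Psi (2 * κ * |f p - b p|) + (L * y ^ 2 + η) := by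
      calc _ ≤ Psi (κ * |f p - b p| + κ * y) := Psi_mono (by positivity) (by rw [← mul_add]; gcongr)
        _ ≤ _ := Psi_add (by positivity) (by positivity)
        _ ≤ _ := by
          have h3 := Psi_le (y := 2 * (κ * y)) (by positivity)
          have h4 : 2 * (κ * y) ≤ η + 1 / η * (2 * (κ * y)) ^ 2 := by
            have : 0 ≤ 1 / η * (2 * (κ * y) - η) ^ 2 := by positivity
            have e : 1 / η * (2 * (κ * y) - η) ^ 2 = 1 / η * (2 * (κ * y)) ^ 2 - 2 * (2 * (κ * y)) + η := by
              field_simp; ring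
            have : 0 ≤ κ * y := by positivity
            linarith
          have e2 : L * y ^ 2 = (2 * (κ * y)) ^ 2 + 1 / η * (2 * (κ * y)) ^ 2 := by rw [hL]; ring
          rw [e2, mul_assoc 2 κ]
          linarith
    refine (ENNReal.ofReal_le_ofReal h2).trans ?_
    rw [ENNReal.ofReal_add (Psi_nonneg (by positivity)) (by positivity), ENNReal.ofReal_add (by positivity) hη0.le, ENNReal.ofReal_mul hL0.le]
    gcongr
    simp only [hb, hh]
    split_ifs
    · simp [Psi_zero]
    · simp
  refine (lintegral_mono hpt).trans ?_
  rw [lintegral_add_left (hhm N), lintegral_add_right _ measurable_const, lintegral_const_mul' _ _ ENNReal.ofReal_ne_top, lintegral_const,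
    Measure.restrict_apply_univ, T2_vol, ← ENNReal.ofReal_mul hη0.le]
  calc _ ≤ ENNReal.ofReal (δ / 2) + (ENNReal.ofReal L * ENNReal.ofReal (δ / 4 / L) + ENNReal.ofReal (η * (4 * Real.pi ^ 2))) := by gcongr
    _ = ENNReal.ofReal δ := by
      rw [← ENNReal.ofReal_mul hL0.le, ← ENNReal.ofReal_add (by positivity) (by positivity), ← ENNReal.ofReal_add (by positivity) (by positivity)]
      congr 1
      rw [hη]; field_simp; norm_num

end AES

namespace AES

def fh (f : ℝ × ℝ → ℝ) (q : ℤ × ℤ) : ℂ := fourierCoef2 f q.1 q.2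

lemma Snn_eq (f : ℝ × ℝ → ℝ) (n : ℕ) (p : ℝ × ℝ) : Snn f n p.1 p.2 = (Sq n (fh f) p).re := by
  unfold Snn Sq TT box fh
  rw [Finset.sum_product]
  congr 1
  apply Finset.sum_congr rfl; intro m _
  apply Finset.sum_congr rfl; intro k _
  congr 1
  unfold ee
  push_cast
  rw [mul_comm]

lemma lint_av2 {F : ℝ × ℝ → ℝ} (hF : Continuous F) (h0 : ∀ p, 0 ≤ F p) :
    ∫⁻ p in T2, ENNReal.ofReal (F p) = ENNReal.ofReal (4 * Real.pi ^ 2 * av (fun x => av (fun y => F (x, y)))) := by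
  have hpi := Real.pi_pos
  unfold T2
  rw [Measure.volume_eq_prod, ← Measure.prod_restrict, lintegral_prod _ (by fun_prop)]
  have h1 : ∀ x, ∫⁻ y in T1, ENNReal.ofReal (F (x, y)) = ENNReal.ofReal (2 * Real.pi * av (fun y => F (x, y))) := by
    intro x; exact lint_av (φ := fun y => F (x, y)) (by fun_prop) (fun y => h0 _)
  simp only [h1]
  have hc : Continuous (fun x => av (fun y => F (x, y))) := av_cont (F := fun x y => F (x, y)) hF
  rw [lint_av (φ := fun x => 2 * Real.pi * av (fun y => F (x, y))) (by fun_prop) (fun x => mul_nonneg (by positivity) (av_nonneg (fun y => h0 _)))]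
  rw [av_cmul]
  congr 1; ring

lemma int_av {φ : ℝ → ℂ} : ∫ y in T1, φ y = 2 * Real.pi * av φ := by
  have hpi : (Real.pi : ℂ) ≠ 0 := by exact_mod_cast Real.pi_ne_zero
  unfold av T1
  rw [integral_Ico_eq_integral_Ioc, ← intervalIntegral.integral_of_le pi_le, Complex.real_smul]
  push_cast
  field_simp

lemma int_T2 {F : ℝ × ℝ → ℂ} (hF : Continuous F) : IntegrableOn F T2 := by
  have : IntegrableOn F (Icc (-Real.pi) Real.pi ×ˢ Icc (-Real.pi) Real.pi) :=
    hF.continuousOn.integrableOn_compact (isCompact_Icc.prod isCompact_Icc)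
  exact this.mono_set (Set.prod_mono Set.Ico_subset_Icc_self Set.Ico_subset_Icc_self)

lemma int_av2 {F : ℝ × ℝ → ℂ} (hF : Continuous F) :
    ∫ p in T2, F p = 4 * Real.pi ^ 2 * av (fun x => av (fun y => F (x, y))) := by
  have h := int_T2 hF
  unfold T2 at *
  rw [Measure.volume_eq_prod] at *
  rw [setIntegral_prod _ h]
  simp only [int_av]
  rw [av_cmul]
  ring

lemma orth {s : Finset (ℤ × ℤ)} {c : ℤ × ℤ → ℂ} (hs : ∀ q, q ∉ s → c q = 0) (r : ℤ × ℤ) :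
    av (fun x => av (fun y => TT s c x y * ee (-(r.1 * x + r.2 * y)))) = c r := by
  have hee := ee_cont
  have e0 : ∀ x y, TT s c x y * ee (-(r.1 * x + r.2 * y)) = ∑ q ∈ s, c q * (ee ((q.1 - r.1 : ℤ) * x) * ee ((q.2 - r.2 : ℤ) * y)) := by
    intro x y
    unfold TT
    rw [Finset.sum_mul]
    apply Finset.sum_congr rfl; intro q _
    rw [mul_assoc, ← ee_add, ← ee_add]
    congr 2
    push_cast; ring
  simp only [e0]
  have e1 : ∀ x, av (fun y => ∑ q ∈ s, c q * (ee ((q.1 - r.1 : ℤ) * x) * ee ((q.2 - r.2 : ℤ) * y))) = ∑ q ∈ s, c q * ((if q.2 - r.2 = 0 then 1 else 0) * ee ((q.1 - r.1 : ℤ) * x)) := by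
    intro x
    rw [av_sum _ (by intro q _; fun_prop)]
    apply Finset.sum_congr rfl; intro q _
    rw [av_cmul, av_cmul, av_ee, mul_comm (ee _)]
  rw [av_congr e1, av_sum _ (by intro q _; fun_prop)]
  have e2 : ∀ q ∈ s, av (fun x => c q * ((if q.2 - r.2 = 0 then 1 else 0) * ee ((q.1 - r.1 : ℤ) * x))) = if q = r then c q else 0 := by
    intro q _
    rw [av_cmul, av_cmul, av_ee]
    by_cases h1 : q.1 = r.1 <;> by_cases h2 : q.2 = r.2 <;> simp [h1, h2, Prod.ext_iff, sub_eq_zero]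
  rw [Finset.sum_congr rfl e2, Finset.sum_ite_eq']
  split_ifs with h
  · rfl
  · exact (hs r h).symm

lemma coef_le {f : ℝ × ℝ → ℝ} (hint : IntegrableOn f T2)
    {s : Finset (ℤ × ℤ)} {c : ℤ × ℤ → ℂ} (hs : ∀ q, q ∉ s → c q = 0) {κ δ : ℝ} (hκ : 0 < κ) (hδ : 0 ≤ δ)
    (h : ∫⁻ p in T2, ENNReal.ofReal (Psi (κ * ‖(f p : ℂ) - TT s c p.1 p.2‖)) ≤ ENNReal.ofReal δ) (r : ℤ × ℤ) :
    ‖fh f r - c r‖ ≤ δ / κ := by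
  have hpi : (Real.pi : ℂ) ≠ 0 := by exact_mod_cast Real.pi_ne_zero
  have hee := ee_cont
  have hT := TT_cont s c
  have e1 : c r = (1 / (4 * (Real.pi : ℂ) ^ 2)) * ∫ p in T2, TT s c p.1 p.2 * ee (-(r.1 * p.1 + r.2 * p.2)) := by
    rw [int_av2 (F := fun p => TT s c p.1 p.2 * ee (-(r.1 * p.1 + r.2 * p.2))) (by fun_prop), orth hs]
    field_simp
  have e2 : fh f r = (1 / (4 * (Real.pi : ℂ) ^ 2)) * ∫ p in T2, (f p : ℂ) * ee (-(r.1 * p.1 + r.2 * p.2)) := by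
    unfold fh fourierCoef2
    congr 2
    ext p
    congr 1
    unfold ee
    push_cast
    congr 1; ring
  have i1 : IntegrableOn (fun p => (f p : ℂ) * ee (-(r.1 * p.1 + r.2 * p.2))) T2 := by
    have : IntegrableOn (fun p => (f p : ℂ)) T2 := hint.ofReal
    refine Integrable.mul_bdd (c := 1) this (by fun_prop) (ae_of_all _ (fun p => (norm_ee _).le))
  have i2 : IntegrableOn (fun p : ℝ × ℝ => TT s c p.1 p.2 * ee (-(r.1 * p.1 + r.2 * p.2))) T2 :=
    int_T2 (by fun_prop)
  rw [e2, e1, ← mul_sub, ← integral_sub i1 i2, norm_mul]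
  have h1 : ‖(1 / (4 * (Real.pi : ℂ) ^ 2))‖ ≤ 1 := by
    rw [norm_div, norm_one, norm_mul, norm_pow, Complex.norm_real, Real.norm_of_nonneg Real.pi_pos.le, Complex.norm_ofNat]
    rw [div_le_one (by positivity)]
    nlinarith [Real.pi_gt_three]
  have h2 : ‖∫ p in T2, (f p : ℂ) * ee (-(r.1 * p.1 + r.2 * p.2)) - TT s c p.1 p.2 * ee (-(r.1 * p.1 + r.2 * p.2))‖ ≤ δ / κ := by
    refine (norm_integral_le_lintegral_norm _).trans ?_
    apply ENNReal.toReal_le_of_le_ofReal (by positivity)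
    have h3 : ∀ p : ℝ × ℝ, ENNReal.ofReal ‖(f p : ℂ) * ee (-(r.1 * p.1 + r.2 * p.2)) - TT s c p.1 p.2 * ee (-(r.1 * p.1 + r.2 * p.2))‖ ≤
        ENNReal.ofReal κ⁻¹ * ENNReal.ofReal (Psi (κ * ‖(f p : ℂ) - TT s c p.1 p.2‖)) := by
      intro p
      rw [← ENNReal.ofReal_mul (by positivity)]
      apply ENNReal.ofReal_le_ofReal
      rw [← sub_mul, norm_mul, norm_ee, mul_one, ← div_eq_inv_mul, le_div_iff₀ hκ, mul_comm]
      exact le_Psi (by positivity)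
    refine (lintegral_mono h3).trans ?_
    rw [lintegral_const_mul' _ _ ENNReal.ofReal_ne_top]
    refine (mul_le_mul_right h _).trans (le_of_eq ?_)
    rw [← ENNReal.ofReal_mul (by positivity)]
    congr 1; field_simp
  calc _ ≤ 1 * (δ / κ) := by gcongr
    _ = _ := one_mul _

lemma TT_ext {s t : Finset (ℤ × ℤ)} {c : ℤ × ℤ → ℂ} (hs : ∀ q, q ∉ s → c q = 0) (hst : s ⊆ t) (x y : ℝ) :
    TT t c x y = TT s c x y := by
  unfold TT
  symm
  apply Finset.sum_subset hst
  intro q _ h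
  rw [hs q h, zero_mul]

lemma TT_sub (s : Finset (ℤ × ℤ)) (c d : ℤ × ℤ → ℂ) (x y : ℝ) :
    TT s (fun q => c q - d q) x y = TT s c x y - TT s d x y := by
  unfold TT
  rw [← Finset.sum_sub_distrib]
  apply Finset.sum_congr rfl; intro q _; ring

lemma Sq_bd (n : ℕ) (c : ℤ × ℤ → ℂ) (p : ℝ × ℝ) {B : ℝ} (hB : ∀ q, ‖c q‖ ≤ B) : ‖Sq n c p‖ ≤ (2 * n + 1) ^ 2 * B := by
  unfold Sq TT
  refine (norm_sum_le _ _).trans ?_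
  have h : ∀ q ∈ box n, ‖c q * ee (q.1 * p.1 + q.2 * p.2)‖ ≤ B := by
    intro q _; rw [norm_mul, norm_ee, mul_one]; exact hB q
  refine (Finset.sum_le_card_nsmul _ _ _ h).trans (le_of_eq ?_)
  have hc : (box n).card = (2 * n + 1) ^ 2 := by
    unfold box
    rw [Finset.card_product, Int.card_Icc, sq]
    congr 1 <;> omega
  rw [hc, nsmul_eq_mul]; push_cast; ring

end AES

namespace AES

lemma level {f : ℝ × ℝ → ℝ} (hmeas : Measurable f)
    (hint : IntegrableOn f T2) (hlog : IntegrableOn (fun p => |f p| * logPlus |f p|) T2)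
    {M ε κ : ℝ} (hM : 0 < M) (hκ : 0 < κ)
    (hw : ∀ (s : Finset (ℤ × ℤ)) (c : ℤ × ℤ → ℂ),
    (∀ q, q ∉ s → c q = 0) → av (fun x => av (fun y => Psi (κ * ‖TT s c x y‖))) ≤ 1 → ∀ K : ℕ,
    volume (Bd M 300 K (fun n p => ‖Sq n c p‖)) ≤ ENNReal.ofReal ε)
    {s : Finset (ℤ × ℤ)} {c : ℤ × ℤ → ℂ} (hs : ∀ q, q ∉ s → c q = 0)
    (hsc : ∫⁻ p in T2, ENNReal.ofReal (Psi (2 * κ * ‖(f p : ℂ) - TT s c p.1 p.2‖)) ≤ ENNReal.ofReal 1) (K : ℕ) :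
    volume (Bd M 600 K (fun n p => ‖Sq n (fun q => fh f q - c q) p‖)) ≤ ENNReal.ofReal ε := by
  have hpi := Real.pi_pos
  have hl2 : 0 < Real.log 2 := Real.log_pos (by norm_num)
  set W : ℝ := Real.log 2 / (M * (2 * 2 ^ K + 1) ^ 2) with hW
  have hW0 : 0 < W := by positivity
  obtain ⟨s', c', hs', hsc'⟩ := dense_Psi hmeas hint hlog (κ := 2 * κ) (δ := min 1 (2 * κ * W)) (by positivity) (by positivity)
  have hcoef : ∀ q, ‖fh f q - c' q‖ ≤ W := by
    intro q
    refine (coef_le hint hs' (κ := 2 * κ) (by positivity) (by positivity) hsc' q).trans ?_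
    rw [div_le_iff₀ (by positivity), mul_comm W]
    exact min_le_right _ _
  have hd : ∀ q, q ∉ s ∪ s' → (fun q => c' q - c q) q = 0 := by
    intro q hq
    rw [Finset.mem_union, not_or] at hq
    simp only [hs q hq.1, hs' q hq.2, sub_zero]
  have hTd : ∀ x y, TT (s ∪ s') (fun q => c' q - c q) x y = TT s' c' x y - TT s c x y := by
    intro x y
    rw [TT_sub, TT_ext hs Finset.subset_union_left, TT_ext hs' Finset.subset_union_right]
  have hav : av (fun x => av (fun y => Psi (κ * ‖TT (s ∪ s') (fun q => c' q - c q) x y‖))) ≤ 1 := by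
    have hTc := TT_cont (s ∪ s') (fun q => c' q - c q)
    have h1 := lint_av2 (F := fun p => Psi (κ * ‖TT (s ∪ s') (fun q => c' q - c q) p.1 p.2‖))
      (Psi_cont (by fun_prop) (fun p => by positivity)) (fun p => Psi_nonneg (by positivity))
    have h2 : ∫⁻ p in T2, ENNReal.ofReal (Psi (κ * ‖TT (s ∪ s') (fun q => c' q - c q) p.1 p.2‖)) ≤ ENNReal.ofReal 2 := by
      have hpt : ∀ p : ℝ × ℝ, ENNReal.ofReal (Psi (κ * ‖TT (s ∪ s') (fun q => c' q - c q) p.1 p.2‖)) ≤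
          ENNReal.ofReal (Psi (2 * κ * ‖(f p : ℂ) - TT s c p.1 p.2‖)) + ENNReal.ofReal (Psi (2 * κ * ‖(f p : ℂ) - TT s' c' p.1 p.2‖)) := by
        intro p
        rw [← ENNReal.ofReal_add (Psi_nonneg (by positivity)) (Psi_nonneg (by positivity))]
        apply ENNReal.ofReal_le_ofReal
        have h3 : ‖TT (s ∪ s') (fun q => c' q - c q) p.1 p.2‖ ≤ ‖(f p : ℂ) - TT s c p.1 p.2‖ + ‖(f p : ℂ) - TT s' c' p.1 p.2‖ := by
          rw [hTd]
          have : TT s' c' p.1 p.2 - TT s c p.1 p.2 = ((f p : ℂ) - TT s c p.1 p.2) - ((f p : ℂ) - TT s' c' p.1 p.2) := by ring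
          rw [this]; exact norm_sub_le _ _
        calc _ ≤ Psi (κ * ‖(f p : ℂ) - TT s c p.1 p.2‖ + κ * ‖(f p : ℂ) - TT s' c' p.1 p.2‖) :=
              Psi_mono (by positivity) (by rw [← mul_add]; gcongr)
          _ ≤ _ := Psi_add (by positivity) (by positivity)
          _ = _ := by rw [mul_assoc, mul_assoc]
      refine (lintegral_mono hpt).trans ?_
      have hm : Measurable (fun p : ℝ × ℝ => ENNReal.ofReal (Psi (2 * κ * ‖(f p : ℂ) - TT s c p.1 p.2‖))) :=
        (Psi_meas.comp (((Complex.measurable_ofReal.comp hmeas).sub (TT_cont s c).measurable).norm.const_mul _)).ennreal_ofReal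
      rw [lintegral_add_left hm]
      calc _ ≤ ENNReal.ofReal 1 + ENNReal.ofReal 1 := by
            gcongr
            exact hsc'.trans (ENNReal.ofReal_le_ofReal (min_le_left _ _))
        _ = ENNReal.ofReal 2 := by rw [← ENNReal.ofReal_add] <;> norm_num
    rw [h1, ENNReal.ofReal_le_ofReal_iff (by norm_num)] at h2
    simp only at h2
    have h9 : (9:ℝ) ≤ Real.pi ^ 2 := by nlinarith [Real.pi_gt_three]
    nlinarith
  refine le_trans (measure_mono ?_) (hw _ _ hd hav K)
  rintro p ⟨hp, k, hk, hlt⟩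
  refine ⟨hp, k, hk, ?_⟩
  have h4 : ∑ n ∈ Finset.range (2 ^ k), Real.exp (M * ‖Sq n (fun q => fh f q - c q) p‖) ≤
      ∑ n ∈ Finset.range (2 ^ k), 2 * Real.exp (M * ‖Sq n (fun q => c' q - c q) p‖) := by
    apply Finset.sum_le_sum
    intro n hn
    rw [Finset.mem_range] at hn
    have h5 : ‖Sq n (fun q => fh f q - c q) p‖ ≤ ‖Sq n (fun q => fh f q - c' q) p‖ + ‖Sq n (fun q => c' q - c q) p‖ := by
      have : Sq n (fun q => fh f q - c q) p = Sq n (fun q => fh f q - c' q) p + Sq n (fun q => c' q - c q) p := by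
        unfold Sq; rw [TT_sub, TT_sub, TT_sub]; ring
      rw [this]; exact norm_add_le _ _
    have h6 := Sq_bd n (fun q => fh f q - c' q) p hcoef
    have h7 : M * ((2 * n + 1) ^ 2 * W) ≤ Real.log 2 := by
      have hn' : (n : ℝ) ≤ 2 ^ K := by
        have : n ≤ 2 ^ K := hn.le.trans (Nat.pow_le_pow_right (by norm_num) hk)
        exact_mod_cast this
      calc M * ((2 * n + 1) ^ 2 * W) ≤ M * ((2 * 2 ^ K + 1) ^ 2 * W) := by gcongr
        _ = Real.log 2 := by rw [hW]; field_simp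
    calc Real.exp (M * ‖Sq n (fun q => fh f q - c q) p‖) ≤ Real.exp (Real.log 2 + M * ‖Sq n (fun q => c' q - c q) p‖) := by
          apply Real.exp_le_exp.mpr
          nlinarith
      _ = _ := by rw [Real.exp_add, Real.exp_log (by norm_num)]
  rw [← Finset.mul_sum] at h4
  linarith

lemma Bd_mono (M C : ℝ) (u : ℕ → ℝ × ℝ → ℝ) : Monotone (fun K => Bd M C K u) := by
  intro K K' h p hp
  obtain ⟨h1, k, hk, h2⟩ := hp
  exact ⟨h1, k, hk.trans h, h2⟩

lemma exp_conv {A M t : ℝ} (hA : 0 < A) (hAM : A ≤ M) : Real.exp (A * t) - 1 ≤ A / M * Real.exp (M * t) := by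
  have hM : 0 < M := hA.trans_le hAM
  have h1 : A / M ≤ 1 := (div_le_one hM).mpr hAM
  have h := convexOn_exp.2 (Set.mem_univ (M * t)) (Set.mem_univ 0) (show 0 ≤ A / M by positivity) (show 0 ≤ 1 - A / M by linarith) (by ring)
  simp only [smul_eq_mul, mul_zero, add_zero, Real.exp_zero, mul_one] at h
  rw [show A / M * (M * t) = A * t by field_simp] at h
  have : 0 < A / M := by positivity
  linarith

lemma main_eps {f : ℝ × ℝ → ℝ} (hmeas : Measurable f)
    (hint : IntegrableOn f T2) (hlog : IntegrableOn (fun p => |f p| * logPlus |f p|) T2)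
    {A M ε : ℝ} (hA : 0 < A) (hAM : A ≤ M) (hε : 0 < ε) :
    ∃ E : Set (ℝ × ℝ), volume E ≤ ENNReal.ofReal (2 * ε) ∧ ∀ p ∈ T2, p ∉ E →
      ∀ᶠ m : ℕ in atTop, (1 / ((m : ℝ) + 1)) * ∑ n ∈ Finset.range (m + 1),
            (Real.exp (A * |Snn f n p.1 p.2 - f p|) - 1) ≤ 3601 * (A / M) := by
  have hM : 0 < M := hA.trans_le hAM
  obtain ⟨κ, hκ, hw⟩ := weak hM hε
  obtain ⟨s, c, hs, hsc⟩ := dense_Psi hmeas hint hlog (κ := 2 * κ) (δ := min 1 (ε * (2 * κ / M))) (by positivity) (by positivity)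
  set E1 : Set (ℝ × ℝ) := {p | p ∈ T2 ∧ 1 / M ≤ ‖(f p : ℂ) - TT s c p.1 p.2‖} with hE1
  set u : ℕ → ℝ × ℝ → ℝ := fun n p => ‖Sq n (fun q => fh f q - c q) p‖ with hu
  set E2 : Set (ℝ × ℝ) := ⋃ K, Bd M 600 K u with hE2
  refine ⟨E1 ∪ E2, ?_, ?_⟩
  · have b1 : volume E1 ≤ ENNReal.ofReal ε := by
      have hm : Measurable (fun p : ℝ × ℝ => ENNReal.ofReal (Psi (2 * κ * ‖(f p : ℂ) - TT s c p.1 p.2‖))) :=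
        (Psi_meas.comp (((Complex.measurable_ofReal.comp hmeas).sub (TT_cont s c).measurable).norm.const_mul _)).ennreal_ofReal
      have h0 : (0:ℝ) < 2 * κ / M := by positivity
      have h1 := meas_ge_le_lintegral_div (μ := volume.restrict T2) hm.aemeasurable (ε := ENNReal.ofReal (2 * κ / M)) (by simpa using h0) ENNReal.ofReal_ne_top
      calc volume E1 ≤ volume ({p | ENNReal.ofReal (2 * κ / M) ≤ ENNReal.ofReal (Psi (2 * κ * ‖(f p : ℂ) - TT s c p.1 p.2‖))} ∩ T2) := by
            apply measure_mono
            rintro p ⟨hp, h2⟩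
            refine ⟨?_, hp⟩
            apply ENNReal.ofReal_le_ofReal
            refine le_trans ?_ (le_Psi (by positivity))
            rw [div_eq_mul_one_div]
            gcongr
        _ = (volume.restrict T2) {p | ENNReal.ofReal (2 * κ / M) ≤ ENNReal.ofReal (Psi (2 * κ * ‖(f p : ℂ) - TT s c p.1 p.2‖))} :=
            (Measure.restrict_apply (measurableSet_le measurable_const hm)).symm
        _ ≤ _ := h1
        _ ≤ ENNReal.ofReal (ε * (2 * κ / M)) / ENNReal.ofReal (2 * κ / M) := by
            gcongr
            exact hsc.trans (ENNReal.ofReal_le_ofReal (min_le_right _ _))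
        _ = ENNReal.ofReal ε := by
            rw [← ENNReal.ofReal_div_of_pos h0]
            congr 1; field_simp
    have b2 : volume E2 ≤ ENNReal.ofReal ε := by
      rw [hE2, (Bd_mono M 600 u).measure_iUnion]
      exact iSup_le (fun K => level hmeas hint hlog hM hκ hw hs (hsc.trans (ENNReal.ofReal_le_ofReal (min_le_left _ _))) K)
    refine (measure_union_le _ _).trans ((add_le_add b1 b2).trans (le_of_eq ?_))
    rw [← ENNReal.ofReal_add hε.le hε.le]; congr 1; ring
  · intro p hp hpE
    rw [Set.mem_union, not_or] at hpE
    obtain ⟨n1, n2⟩ := hpE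
    have hf : ‖(f p : ℂ) - TT s c p.1 p.2‖ ≤ 1 / M := by
      by_contra h
      exact n1 ⟨hp, (not_le.mp h).le⟩
    have hsum : ∀ k : ℕ, ∑ n ∈ Finset.range (2 ^ k), Real.exp (M * u n p) ≤ 600 * 2 ^ k := by
      intro k
      by_contra h
      exact n2 (Set.mem_iUnion.mpr ⟨k, hp, k, le_refl _, not_le.mp h⟩)
    obtain ⟨N, hN⟩ : ∃ N : ℕ, ∀ n ≥ N, s ⊆ box n := by
      refine ⟨∑ q ∈ s, (q.1.natAbs + q.2.natAbs), ?_⟩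
      intro n hn q hq
      have := Finset.single_le_sum (f := fun q : ℤ × ℤ => q.1.natAbs + q.2.natAbs) (fun _ _ => Nat.zero_le _) hq
      simp only [box, Finset.mem_product, Finset.mem_Icc]
      omega
    set a : ℕ → ℝ := fun n => Real.exp (A * |Snn f n p.1 p.2 - f p|) - 1 with ha
    have ha0 : ∀ n, 0 ≤ a n := by
      intro n
      have := Real.one_le_exp (x := A * |Snn f n p.1 p.2 - f p|) (by positivity)
      simp only [ha]; linarith
    have hbig : ∀ n ≥ N, a n ≤ A / M * (3 * Real.exp (M * u n p)) := by
      intro n hn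
      have h1 : |Snn f n p.1 p.2 - f p| ≤ u n p + 1 / M := by
        have e : Sq n (fh f) p - (f p : ℂ) = Sq n (fun q => fh f q - c q) p - ((f p : ℂ) - TT s c p.1 p.2) := by
          unfold Sq
          rw [TT_sub, TT_ext hs (hN n hn)]; ring
        have e2 : Snn f n p.1 p.2 - f p = (Sq n (fh f) p - (f p : ℂ)).re := by
          rw [Snn_eq]; simp
        rw [e2, e]
        refine (Complex.abs_re_le_norm _).trans ((norm_sub_le _ _).trans ?_)
        simp only [hu]; gcongr
      refine (exp_conv hA hAM).trans ?_
      have h2 : Real.exp (M * |Snn f n p.1 p.2 - f p|) ≤ 3 * Real.exp (M * u n p) := by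
        calc _ ≤ Real.exp (1 + M * u n p) := by
              apply Real.exp_le_exp.mpr
              calc _ ≤ M * (u n p + 1 / M) := by gcongr
                _ = _ := by field_simp; ring
          _ = Real.exp 1 * Real.exp (M * u n p) := Real.exp_add _ _
          _ ≤ _ := by gcongr; linarith [Real.exp_one_lt_d9]
      gcongr
    set B := ∑ n ∈ Finset.range N, a n with hB
    have hB0 : 0 ≤ B := Finset.sum_nonneg (fun n _ => ha0 n)
    have htot : ∀ m : ℕ, ∑ n ∈ Finset.range (m + 1), a n ≤ B + A / M * (3600 * (m + 1)) := by
      intro m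
      obtain ⟨k, hk1, hk2⟩ : ∃ k : ℕ, m + 1 ≤ 2 ^ k ∧ 2 ^ k ≤ 2 * (m + 1) := by
        refine ⟨Nat.log 2 (m + 1) + 1, (Nat.lt_pow_succ_log_self (by norm_num) _).le, ?_⟩
        rw [pow_succ, mul_comm]
        exact Nat.mul_le_mul_left 2 (Nat.pow_log_le_self 2 (by omega))
      have h1 : ∀ n ∈ Finset.range (m + 1), a n ≤ (if n < N then a n else 0) + A / M * (3 * Real.exp (M * u n p)) := by
        intro n _
        split_ifs with h
        · have : 0 ≤ A / M * (3 * Real.exp (M * u n p)) := by positivity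
          linarith
        · rw [zero_add]; exact hbig n (not_lt.mp h)
      refine (Finset.sum_le_sum h1).trans ?_
      rw [Finset.sum_add_distrib]
      apply add_le_add
      · rw [← Finset.sum_filter]
        apply Finset.sum_le_sum_of_subset_of_nonneg
        · intro n hn; exact Finset.mem_range.mpr (Finset.mem_filter.mp hn).2
        · intro n _ _; exact ha0 n
      · rw [← Finset.mul_sum, ← Finset.mul_sum]
        have h2 : ∑ n ∈ Finset.range (m + 1), Real.exp (M * u n p) ≤ ∑ n ∈ Finset.range (2 ^ k), Real.exp (M * u n p) := by
          apply Finset.sum_le_sum_of_subset_of_nonneg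
          · exact Finset.range_subset_range.mpr hk1
          · intro n _ _; positivity
        have h3 : ((2:ℝ) ^ k) ≤ 2 * (m + 1) := by exact_mod_cast hk2
        have h4 := hsum k
        have h5 : 3 * ∑ n ∈ Finset.range (m + 1), Real.exp (M * u n p) ≤ 3600 * (m + 1) := by linarith
        gcongr
    obtain ⟨m0, hm0⟩ := exists_nat_ge (B / (A / M))
    filter_upwards [eventually_ge_atTop m0] with m hm
    have hAM0 : 0 < A / M := by positivity
    rw [div_le_iff₀ hAM0] at hm0
    have hm' : (m0 : ℝ) ≤ m := by exact_mod_cast hm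
    rw [one_div, inv_mul_le_iff₀ (by positivity)]
    have := htot m
    nlinarith

theorem final (f : ℝ × ℝ → ℝ) (hmeas : Measurable f)
    (hint : IntegrableOn f T2) (hlog : IntegrableOn (fun p => |f p| * logPlus |f p|) T2) (A : ℝ) (hA : 0 < A) :
    ∀ᵐ p ∂(volume.restrict T2), Filter.Tendsto (fun m : ℕ => (1 / ((m : ℝ) + 1)) * ∑ n ∈ Finset.range (m + 1),
            (Real.exp (A * |Snn f n p.1 p.2 - f p|) - 1)) Filter.atTop (nhds 0) := by
  rw [ae_restrict_iff' T2_meas]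
  have key : ∀ j : ℕ, ∀ᵐ p ∂(volume : Measure (ℝ × ℝ)), p ∈ T2 → ∀ᶠ m : ℕ in atTop, (1 / ((m : ℝ) + 1)) * ∑ n ∈ Finset.range (m + 1),
            (Real.exp (A * |Snn f n p.1 p.2 - f p|) - 1) ≤ 3601 * (A / (A * (j + 1))) := by
    intro j
    rw [ae_iff]
    apply le_antisymm _ zero_le
    apply ENNReal.le_of_forall_pos_le_add
    intro ε hε _
    have hε' : (0:ℝ) < ε := hε
    obtain ⟨E, hE, hE2⟩ := main_eps hmeas hint hlog hA (M := A * (j + 1)) (ε := ε / 2) (by nlinarith [(Nat.cast_nonneg j : (0:ℝ) ≤ j)]) (by positivity)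
    rw [zero_add]
    refine (measure_mono ?_).trans (hE.trans (le_of_eq ?_))
    · intro p hp
      simp only [Set.mem_ofPred_eq, Classical.not_imp] at hp
      by_contra h
      exact hp.2 (hE2 p hp.1 h)
    · rw [mul_div_cancel₀ _ (by norm_num), ENNReal.ofReal_coe_nnreal]
  filter_upwards [ae_all_iff.mpr key] with p hp hpT
  rw [Metric.tendsto_nhds]
  intro δ hδ
  obtain ⟨j, hj⟩ := exists_nat_gt (3601 / δ)
  filter_upwards [hp j hpT] with m hm
  have h0 : 0 ≤ (1 / ((m : ℝ) + 1)) * ∑ n ∈ Finset.range (m + 1), (Real.exp (A * |Snn f n p.1 p.2 - f p|) - 1) := by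
    apply mul_nonneg (by positivity)
    apply Finset.sum_nonneg
    intro n _
    have := Real.one_le_exp (x := A * |Snn f n p.1 p.2 - f p|) (by positivity)
    linarith
  rw [Real.dist_eq, sub_zero, abs_of_nonneg h0]
  refine hm.trans_lt ?_
  have : 3601 * (A / (A * ((j:ℝ) + 1))) = 3601 / (j + 1) := by field_simp
  rw [this, div_lt_iff₀ (by positivity)]
  rw [div_lt_iff₀ hδ] at hj
  nlinarith

end AES

/-- Theorem 2, exponential summability: if `f ∈ L log L(𝕋²)`, then for
every `A > 0`, for a.e. `(x,y) ∈ 𝕋²`,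
`lim_{m→∞} (1/(m+1)) Σ_{n=0}^m (exp(A |S_{nn}(x,y,f) - f(x,y)|) - 1) = 0`. -/
theorem ae_exponential_summability (f : ℝ × ℝ → ℝ)
    (hmeas : Measurable f) (hper : Biperiodic f)
    (hint : IntegrableOn f T2)
    (hlog : IntegrableOn (fun p => |f p| * logPlus |f p|) T2)
    (A : ℝ) (hA : 0 < A) :
    ∀ᵐ p ∂(volume.restrict T2),
      Filter.Tendsto
        (fun m : ℕ =>
          (1 / ((m : ℝ) + 1)) * ∑ n ∈ Finset.range (m + 1),
            (Real.exp (A * |Snn f n p.1 p.2 - f p|) - 1))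
        Filter.atTop (nhds 0) := by
  exact AES.final f hmeas hint hlog A hA
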